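/- Let A, B be integers with 2 ≤ −A ≤ B and 2|A| < B + 3, let M be the 2×2 real matrix with rows (0, −B) and (1, −A), and let T be the unique nonempty compact subset of ℝ² satisfying M·T + ((B−1)/2, 0) = (⋃_{i=0}^{B−2} (T + (i,0))) ∪ (−T). Then: (1) if A = −2 (and B ≥ 2), then T is disk-like; (2) if A ≤ −3 (and hence B ≥ 4), then T is not disk-like. -/

import Mathlib

open Set Pointwise

noncomputable section

/-- The plane. -/
abbrev Pt : Type := Fin 2 → ℝ

/-- A planar set is disk-like if it is homeomorphic to the closed unit (Euclidean) disk. -/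
def DiskLike (S : Set Pt) : Prop :=
  Nonempty (↥S ≃ₜ ↥(Metric.closedBall (0 : EuclideanSpace ℝ (Fin 2)) 1))

/-- The set equation `M T + ((B-1)/2, 0) = (⋃_{i=0}^{B-2} (T + (i,0))) ∪ (-T)`
for `M = !![0, -B; 1, -A]`. -/
def CrysEq (A B : ℤ) (T : Set Pt) : Prop :=
  (fun x => (!![0, -(B:ℝ); 1, -(A:ℝ)]).mulVec x + ![((B:ℝ)-1)/2, 0]) '' T
    = (⋃ i ∈ Finset.Icc (0:ℤ) (B-2), (fun x => x + ![(i:ℝ), 0]) '' T) ∪ (-T)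

/-- The set equation `M L = ⋃_{i=0}^{B-1} (L + (i,0))` for `M = !![0, -B; 1, -A]`. -/
def LatEq (A B : ℤ) (L : Set Pt) : Prop :=
  (fun x => (!![0, -(B:ℝ); 1, -(A:ℝ)]).mulVec x) '' L
    = ⋃ i ∈ Finset.Icc (0:ℤ) (B-1), (fun x => x + ![(i:ℝ), 0]) '' L

/-- Membership in the crystallographic group p2: maps `x ↦ ε x + (p,q)`,
`ε = ±1`, `p q` integers. -/
def IsP2 (γ : Pt → Pt) : Prop :=
  ∃ (ε : ℝ) (p q : ℤ), (ε = 1 ∨ ε = -1) ∧ γ = fun x => ε • x + ![(p:ℝ), (q:ℝ)]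

open Filter Topology

/-- `f` is affine with slope `u` along a short initial piece of the ray from `z` in direction `v`. -/
def EvAff (f : ℂ → ℂ) (z v u : ℂ) : Prop :=
  ∀ᶠ t : ℝ in 𝓝[≥] 0, f (z + t * v) = f z + t * u

theorem ray_sign (p q : ℝ) :
    (∀ᶠ t : ℝ in 𝓝[≥] 0, 0 ≤ p + t * q) ∨ (∀ᶠ t : ℝ in 𝓝[≥] 0, p + t * q ≤ 0) := by
  have hc : Tendsto (fun t : ℝ => p + t * q) (𝓝[≥] 0) (𝓝 p) := by
    have : Continuous (fun t : ℝ => p + t * q) := by fun_prop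
    have h := this.tendsto 0
    simp only [zero_mul, add_zero] at h
    exact h.mono_left nhdsWithin_le_nhds
  have hpos : ∀ᶠ t : ℝ in 𝓝[≥] 0, 0 ≤ t := eventually_mem_nhdsWithin
  rcases lt_trichotomy p 0 with h | h | h
  · right
    filter_upwards [hc.eventually (eventually_lt_nhds h)] with t ht using ht.le
  · rcases le_total 0 q with hq | hq
    · left
      filter_upwards [hpos] with t ht
      rw [h]; positivity
    · right
      filter_upwards [hpos] with t ht
      rw [h]; nlinarith
  · left
    filter_upwards [hc.eventually (eventually_gt_nhds h)] with t ht using ht.le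

theorem ray_floor (x a : ℝ) :
    ∃ n : ℤ, ∀ᶠ t : ℝ in 𝓝[≥] 0, (n : ℝ) ≤ x + t * a ∧ x + t * a ≤ n + 1 := by
  have hc : Tendsto (fun t : ℝ => x + t * a) (𝓝[≥] 0) (𝓝 x) := by
    have : Continuous (fun t : ℝ => x + t * a) := by fun_prop
    have h := this.tendsto 0
    simp only [zero_mul, add_zero] at h
    exact h.mono_left nhdsWithin_le_nhds
  have h1 : ∀ᶠ t : ℝ in 𝓝[≥] 0, (⌊x⌋ : ℝ) - 1 < x + t * a :=
    hc.eventually (eventually_gt_nhds (by linarith [Int.floor_le x]))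
  have h2 : ∀ᶠ t : ℝ in 𝓝[≥] 0, x + t * a < ⌊x⌋ + 1 :=
    hc.eventually (eventually_lt_nhds (Int.lt_floor_add_one x))
  rcases ray_sign (x - ⌊x⌋) a with h | h
  · refine ⟨⌊x⌋, ?_⟩
    filter_upwards [h, h2] with t h h2
    constructor <;> linarith
  · refine ⟨⌊x⌋ - 1, ?_⟩
    filter_upwards [h, h1] with t h h1
    push_cast
    constructor <;> linarith

theorem EvAff.hasDeriv {f : ℂ → ℂ} {z v u : ℂ} {s : ℝ} (h : EvAff f (z + s * v) v u) :
    HasDerivWithinAt (fun t : ℝ => f (z + t * v)) u (Ici s) s := by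
  have h1 : ∀ᶠ r : ℝ in 𝓝[≥] s, f (z + r * v) = f (z + s * v) + ((r - s : ℝ) : ℂ) * u := by
    have hm : Tendsto (fun r : ℝ => r - s) (𝓝[≥] s) (𝓝[≥] 0) := by
      refine tendsto_nhdsWithin_iff.2 ⟨?_, ?_⟩
      · have : Continuous (fun r : ℝ => r - s) := by fun_prop
        have h := this.tendsto s
        simp only [sub_self] at h
        exact h.mono_left nhdsWithin_le_nhds
      · filter_upwards [eventually_mem_nhdsWithin] with r hr
        simpa using hr
    filter_upwards [hm.eventually h] with r hr
    rw [← hr]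
    congr 1
    push_cast
    ring
  have h2 : HasDerivWithinAt (fun r : ℝ => f (z + s * v) + ((r - s : ℝ) : ℂ) * u) u (Ici s) s := by
    have h3 : HasDerivAt (fun r : ℝ => ((r - s : ℝ) : ℂ)) 1 s := by
      have := ((hasDerivAt_id s).sub_const s).ofReal_comp
      simpa using this
    have := (h3.mul_const u).const_add (f (z + s * v))
    rw [one_mul] at this
    exact this.hasDerivWithinAt
  exact h2.congr_of_eventuallyEq h1 (by simp)

theorem norm_sub_le_of_evAff {f : ℂ → ℂ} (hc : Continuous f) {L : ℝ}
    (h : ∀ z v, ∃ u, EvAff f z v u ∧ ‖u‖ ≤ L * ‖v‖) (z z' : ℂ) :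
    ‖f z' - f z‖ ≤ L * ‖z' - z‖ := by
  choose u hu hL using h
  set v := z' - z with hv
  have hcont : Continuous (fun t : ℝ => f (z + t * v)) := by fun_prop
  have key := norm_image_sub_le_of_norm_deriv_right_le_segment (a := 0) (b := 1)
    (f := fun t : ℝ => f (z + t * v)) (f' := fun t => u (z + t * v) v) (C := L * ‖v‖)
    hcont.continuousOn (fun x _ => (hu (z + x * v) v).hasDeriv)
    (fun x _ => hL _ _) 1 (by simp)
  simpa [hv] using key

/-- The bilinear pairing given by a real `2 × 2` matrix. -/
def bil (a b c d : ℝ) (v u : ℂ) : ℝ :=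
  (a * v.re + b * v.im) * u.re + (c * v.re + d * v.im) * u.im

theorem bil_lower_of_evAff {f : ℂ → ℂ} (hc : Continuous f) {a b c d m : ℝ}
    (h : ∀ z v, ∃ u, EvAff f z v u ∧ m * ‖v‖ ^ 2 ≤ bil a b c d v u) (z z' : ℂ) :
    m * ‖z' - z‖ ^ 2 ≤ bil a b c d (z' - z) (f z' - f z) := by
  choose u hu hL using h
  set v := z' - z with hv
  have hcont : Continuous (fun t : ℝ => f (z + t * v)) := by fun_prop
  have key := image_le_of_deriv_right_le_deriv_boundary (a := 0) (b := 1)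
    (f := fun t : ℝ => - bil a b c d v (f (z + t * v)))
    (f' := fun t => - bil a b c d v (u (z + t * v) v))
    (B := fun t : ℝ => - bil a b c d v (f z) - t * (m * ‖v‖ ^ 2))
    (B' := fun t : ℝ => - (m * ‖v‖ ^ 2))
    (by unfold bil; fun_prop)
    (by
      intro x _
      have hd := (hu (z + x * v) v).hasDeriv
      have hre := (Complex.reCLM.hasFDerivAt.comp_hasDerivWithinAt x hd)
      have him := (Complex.imCLM.hasFDerivAt.comp_hasDerivWithinAt x hd)
      exact ((hre.const_mul _).add (him.const_mul _)).neg)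
    (by simp) (by fun_prop)
    (by
      intro x _
      have := ((hasDerivAt_id x).mul_const (m * ‖v‖ ^ 2)).const_sub (- bil a b c d v (f z))
      simpa using this.hasDerivWithinAt)
    (by intro x _; have := hL (z + x * v) v; linarith)
    (x := 1) (by simp)
  have hz : z + ((1 : ℝ) : ℂ) * v = z' := by simp [hv]
  simp only [hz] at key
  have e : bil a b c d v (f z' - f z) = bil a b c d v (f z') - bil a b c d v (f z) := by
    simp [bil]; ring
  rw [e]; linarith

theorem bil_le {a b c d : ℝ} (v u : ℂ) :
    bil a b c d v u ≤ (|a| + |b| + |c| + |d|) * ‖v‖ * ‖u‖ := by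
  have h1 := Complex.abs_re_le_norm v
  have h2 := Complex.abs_im_le_norm v
  have h3 := Complex.abs_re_le_norm u
  have h4 := Complex.abs_im_le_norm u
  have key : ∀ (a x y : ℝ), |x| ≤ ‖v‖ → |y| ≤ ‖u‖ → a * x * y ≤ |a| * ‖v‖ * ‖u‖ := by
    intro a x y hx hy
    calc a * x * y ≤ |a * x * y| := le_abs_self _
      _ = |a| * |x| * |y| := by rw [abs_mul, abs_mul]
      _ ≤ _ := by gcongr
  unfold bil
  linarith [key a _ _ h1 h3, key b _ _ h2 h3, key c _ _ h1 h4, key d _ _ h2 h4]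

/-- Strongly monotone Lipschitz self-maps of the plane are surjective. -/
theorem surjective_of_monotone {g : ℂ → ℂ} {m L : ℝ} (hm : 0 < m)
    (hL : ∀ z z', ‖g z' - g z‖ ≤ L * ‖z' - z‖)
    (hg : ∀ z z', m * ‖z' - z‖ ^ 2 ≤ bil 1 0 0 1 (z' - z) (g z' - g z)) :
    Function.Surjective g := by
  intro y
  set M : ℝ := |L| + m with hM
  have hM0 : 0 < M := by positivity
  have hLM : ∀ z z', ‖g z' - g z‖ ≤ M * ‖z' - z‖ := fun z z' =>
    (hL z z').trans (by gcongr; rw [hM]; linarith [le_abs_self L])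
  set τ : ℝ := m / M ^ 2 with hτ
  have hτ0 : 0 < τ := by positivity
  have hq1 : m ^ 2 / M ^ 2 ≤ 1 := by
    rw [div_le_one (by positivity)]
    have : m ≤ M := by rw [hM]; linarith [abs_nonneg L]
    gcongr
  have hq0 : 0 < m ^ 2 / M ^ 2 := by positivity
  set K : ℝ := Real.sqrt (1 - m ^ 2 / M ^ 2) with hK
  have hK1 : K < 1 := by
    rw [hK, Real.sqrt_lt' one_pos]; linarith
  have hK0 : 0 ≤ K := Real.sqrt_nonneg _
  set Φ : ℂ → ℂ := fun z => z - τ * (g z - y) with hΦ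
  have hsq : ∀ w : ℂ, ‖w‖ ^ 2 = w.re * w.re + w.im * w.im := by
    intro w; rw [← Complex.normSq_eq_norm_sq, Complex.normSq_apply]
  have hcontr : ∀ z z', ‖Φ z' - Φ z‖ ≤ K * ‖z' - z‖ := by
    intro z z'
    have h1 := hLM z z'
    have h2 := hg z z'
    have h1' : ‖g z' - g z‖ ^ 2 ≤ M ^ 2 * ‖z' - z‖ ^ 2 := by
      rw [← mul_pow]; gcongr
    have e : Φ z' - Φ z = (z' - z) - τ * (g z' - g z) := by simp [hΦ]; ring
    have h3 : ‖Φ z' - Φ z‖ ^ 2 ≤ (1 - m ^ 2 / M ^ 2) * ‖z' - z‖ ^ 2 := by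
      have e2 : ‖Φ z' - Φ z‖ ^ 2 = ‖z' - z‖ ^ 2 - 2 * τ * bil 1 0 0 1 (z' - z) (g z' - g z)
          + τ ^ 2 * ‖g z' - g z‖ ^ 2 := by
        rw [e, hsq, hsq, hsq]; simp [bil]; ring
      have e3 : m ^ 2 / M ^ 2 = 2 * τ * m - τ ^ 2 * M ^ 2 := by
        rw [hτ]; field_simp; ring
      rw [e2, e3]
      nlinarith [mul_le_mul_of_nonneg_left h2 hτ0.le, mul_le_mul_of_nonneg_left h1' (sq_nonneg τ)]
    have h4 : (K * ‖z' - z‖) ^ 2 = (1 - m ^ 2 / M ^ 2) * ‖z' - z‖ ^ 2 := by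
      rw [mul_pow, hK, Real.sq_sqrt (by linarith)]
    rw [← h4] at h3
    exact (sq_le_sq₀ (norm_nonneg _) (by positivity)).1 h3
  have hCW : ContractingWith ⟨K, hK0⟩ Φ := by
    refine ⟨?_, LipschitzWith.of_dist_le_mul fun x z => ?_⟩
    · exact_mod_cast hK1
    · rw [dist_eq_norm, dist_eq_norm]; exact hcontr z x
  refine ⟨hCW.fixedPoint, ?_⟩
  have hfix : Φ hCW.fixedPoint = hCW.fixedPoint := hCW.fixedPoint_isFixedPt
  have h5 : (τ : ℂ) * (g hCW.fixedPoint - y) = 0 := by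
    have : hCW.fixedPoint - (τ : ℂ) * (g hCW.fixedPoint - y) = hCW.fixedPoint := hfix
    linear_combination -this
  have hτc : (τ : ℂ) ≠ 0 := by exact_mod_cast hτ0.ne'
  have := (mul_eq_zero.1 h5).resolve_left hτc
  linear_combination this

theorem injective_of_bil {f : ℂ → ℂ} {a b c d m : ℝ} (hm : 0 < m)
    (hf : ∀ z z', m * ‖z' - z‖ ^ 2 ≤ bil a b c d (z' - z) (f z' - f z)) :
    Function.Injective f := by
  intro z z' h
  have := hf z z'
  rw [h] at this
  simp only [sub_self, bil, Complex.zero_re, Complex.zero_im, mul_zero, add_zero] at this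
  have h2 : ‖z' - z‖ ^ 2 ≤ 0 := by nlinarith [sq_nonneg ‖z' - z‖]
  have h3 : ‖z' - z‖ = 0 := by nlinarith [norm_nonneg (z' - z)]
  exact (sub_eq_zero.1 (norm_eq_zero.1 h3)).symm

theorem surjective_of_bil {f : ℂ → ℂ} {a b c d m L : ℝ} (hm : 0 < m) (hdet : a * d - b * c ≠ 0)
    (hL : ∀ z z', ‖f z' - f z‖ ≤ L * ‖z' - z‖)
    (hf : ∀ z z', m * ‖z' - z‖ ^ 2 ≤ bil a b c d (z' - z) (f z' - f z)) :
    Function.Surjective f := by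
  intro y
  set A : ℂ → ℂ := fun u => ⟨a * u.re + c * u.im, b * u.re + d * u.im⟩ with hA
  have hAs : ∀ u w, A u - A w = A (u - w) := by
    intro u w; apply Complex.ext <;> simp [hA] <;> ring
  have hAn : ∀ u, ‖A u‖ ≤ (|a| + |b| + |c| + |d|) * ‖u‖ := by
    intro u
    have h3 := Complex.abs_re_le_norm u
    have h4 := Complex.abs_im_le_norm u
    calc ‖A u‖ ≤ |a * u.re + c * u.im| + |b * u.re + d * u.im| := Complex.norm_le_abs_re_add_abs_im _
      _ ≤ (|a| * |u.re| + |c| * |u.im|) + (|b| * |u.re| + |d| * |u.im|) := by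
          refine add_le_add ?_ ?_ <;>
          · rw [← abs_mul, ← abs_mul]; exact abs_add_le _ _
      _ ≤ (|a| * ‖u‖ + |c| * ‖u‖) + (|b| * ‖u‖ + |d| * ‖u‖) := by gcongr
      _ = _ := by ring
  obtain ⟨z, hz⟩ := surjective_of_monotone (g := fun z => A (f z)) (m := m)
    (L := (|a| + |b| + |c| + |d|) * L) hm
    (by
      intro z z'
      rw [hAs, mul_assoc]
      exact (hAn _).trans (by gcongr; exact hL z z'))
    (by
      intro z z'
      refine (hf z z').trans (le_of_eq ?_)
      rw [hAs]
      simp [bil, hA]; ring) (A y)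
  refine ⟨z, ?_⟩
  have h1 := congrArg Complex.re hz
  have h2 := congrArg Complex.im hz
  simp only [hA] at h1 h2
  apply Complex.ext
  · apply mul_left_cancel₀ hdet; linear_combination d * h1 - c * h2
  · apply mul_left_cancel₀ hdet; linear_combination a * h2 - b * h1

/-- Continuous, piecewise affine along rays, with slopes that are uniformly bounded and uniformly
monotone with respect to a fixed invertible matrix. -/
structure Tame (f : ℂ → ℂ) : Prop where
  cont : Continuous f
  slopes : ∃ a b c d m L : ℝ, 0 < m ∧ a * d - b * c ≠ 0 ∧
    ∀ z v, ∃ u, EvAff f z v u ∧ ‖u‖ ≤ L * ‖v‖ ∧ m * ‖v‖ ^ 2 ≤ bil a b c d v u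

theorem Tame.bijective {f : ℂ → ℂ} (hf : Tame f) : Function.Bijective f := by
  obtain ⟨a, b, c, d, m, L, hm, hdet, h⟩ := hf.slopes
  have h1 := norm_sub_le_of_evAff hf.cont fun z v =>
    let ⟨u, h1, h2, _⟩ := h z v; ⟨u, h1, h2⟩
  have h2 := bil_lower_of_evAff hf.cont fun z v =>
    let ⟨u, h1, _, h2⟩ := h z v; ⟨u, h1, h2⟩
  exact ⟨injective_of_bil hm h2, surjective_of_bil hm hdet h1 h2⟩

theorem Tame.antilip {f : ℂ → ℂ} (hf : Tame f) : ∃ K, ∀ z z', ‖z' - z‖ ≤ K * ‖f z' - f z‖ := by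
  obtain ⟨a, b, c, d, m, L, hm, hdet, h⟩ := hf.slopes
  have h2 := bil_lower_of_evAff hf.cont fun z v =>
    let ⟨u, h1, _, h2⟩ := h z v; ⟨u, h1, h2⟩
  refine ⟨(|a| + |b| + |c| + |d|) / m, fun z z' => ?_⟩
  have h3 := (h2 z z').trans (bil_le _ _)
  rcases (norm_nonneg (z' - z)).eq_or_lt with h0 | h0
  · rw [← h0]; positivity
  · have h4 : m * ‖z' - z‖ ≤ (|a| + |b| + |c| + |d|) * ‖f z' - f z‖ := by
      apply le_of_mul_le_mul_right _ h0
      nlinarith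
    rw [div_mul_eq_mul_div, le_div_iff₀ hm]; linarith

/-- The homeomorphism of the plane given by a tame map. -/
def Tame.homeo {f : ℂ → ℂ} (hf : Tame f) : ℂ ≃ₜ ℂ where
  toEquiv := Equiv.ofBijective f hf.bijective
  continuous_toFun := hf.cont
  continuous_invFun := by
    obtain ⟨K, hK⟩ := hf.antilip
    refine (LipschitzWith.of_dist_le' (K := K) fun x y => ?_).continuous
    have := hK ((Equiv.ofBijective f hf.bijective).symm y) ((Equiv.ofBijective f hf.bijective).symm x)
    have e : ∀ w, f ((Equiv.ofBijective f hf.bijective).symm w) = w :=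
      (Equiv.ofBijective f hf.bijective).apply_symm_apply
    rw [e, e] at this
    rw [dist_eq_norm, dist_eq_norm]
    exact this

theorem Tame.homeo_apply {f : ℂ → ℂ} (hf : Tame f) (z : ℂ) : hf.homeo z = f z := rfl

theorem Tame.apply_symm {f : ℂ → ℂ} (hf : Tame f) (w : ℂ) : f (hf.homeo.symm w) = w :=
  hf.homeo.apply_symm_apply w

theorem Tame.symm_apply {f : ℂ → ℂ} (hf : Tame f) (z : ℂ) : hf.homeo.symm (f z) = z :=
  hf.homeo.symm_apply_apply z

theorem Tame.exists_direction {f : ℂ → ℂ} (hf : Tame f) (z u : ℂ) : ∃ v, EvAff f z v u := by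
  obtain ⟨a, b, c, d, m, L, hm, hdet, h⟩ := hf.slopes
  have h1 := norm_sub_le_of_evAff hf.cont fun z v =>
    let ⟨u, h1, h2, _⟩ := h z v; ⟨u, h1, h2⟩
  have h2 := bil_lower_of_evAff hf.cont fun z v =>
    let ⟨u, h1, _, h2⟩ := h z v; ⟨u, h1, h2⟩
  choose D hD using fun v => (h z v)
  have key : ∀ v v', ∃ t : ℝ, 0 < t ∧ f (z + t * v) = f z + t * D v ∧
      f (z + t * v') = f z + t * D v' := by
    intro v v'
    have h3 : ∀ᶠ t : ℝ in 𝓝[>] 0, 0 < t ∧ f (z + t * v) = f z + t * D v ∧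
        f (z + t * v') = f z + t * D v' := by
      have hle : 𝓝[>] (0 : ℝ) ≤ 𝓝[≥] 0 := nhdsWithin_mono _ Ioi_subset_Ici_self
      filter_upwards [eventually_mem_nhdsWithin, hle (hD v).1, hle (hD v').1] with t a b c
      exact ⟨a, b, c⟩
    exact h3.exists
  obtain ⟨v, hv⟩ := surjective_of_bil (f := D) hm hdet (L := L)
    (by
      intro v v'
      obtain ⟨t, ht, e1, e2⟩ := key v v'
      have := h1 (z + t * v) (z + t * v')
      rw [e1, e2] at this
      have e3 : f z + t * D v' - (f z + t * D v) = t * (D v' - D v) := by ring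
      have e4 : z + t * v' - (z + t * v) = t * (v' - v) := by ring
      rw [e3, e4, norm_mul, norm_mul, Complex.norm_real, Real.norm_of_nonneg ht.le] at this
      apply le_of_mul_le_mul_left _ ht
      linarith)
    (by
      intro v v'
      obtain ⟨t, ht, e1, e2⟩ := key v v'
      have := h2 (z + t * v) (z + t * v')
      rw [e1, e2] at this
      have e3 : f z + t * D v' - (f z + t * D v) = t * (D v' - D v) := by ring
      have e4 : z + t * v' - (z + t * v) = t * (v' - v) := by ring
      rw [e3, e4, norm_mul, Complex.norm_real, Real.norm_of_nonneg ht.le] at this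
      have e5 : bil a b c d (t * (v' - v)) (t * (D v' - D v))
          = t ^ 2 * bil a b c d (v' - v) (D v' - D v) := by
        simp [bil]; ring
      rw [e5] at this
      have ht2 : 0 < t ^ 2 := by positivity
      apply le_of_mul_le_mul_left _ ht2
      linarith) u
  exact ⟨v, hv ▸ (hD v).1⟩

/-- Comparison of slopes makes `Q ∘ P⁻¹` a contraction. -/
theorem Tame.lip_comp_symm {P Q : ℂ → ℂ} (hP : Tame P) (hQ : Continuous Q) {κ : ℝ}
    (h : ∀ z v u, EvAff P z v u → ∃ u', EvAff Q z v u' ∧ ‖u'‖ ≤ κ * ‖u‖) (w w' : ℂ) :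
    ‖Q (hP.homeo.symm w') - Q (hP.homeo.symm w)‖ ≤ κ * ‖w' - w‖ := by
  refine norm_sub_le_of_evAff (f := fun w => Q (hP.homeo.symm w))
    (hQ.comp hP.homeo.symm.continuous) (fun w u => ?_) w w'
  obtain ⟨v, hv⟩ := hP.exists_direction (hP.homeo.symm w) u
  obtain ⟨u', h1, h2⟩ := h _ _ _ hv
  refine ⟨u', ?_, h2⟩
  filter_upwards [hv, h1] with t ht hslope
  rw [hP.apply_symm] at ht
  rw [← ht, hP.symm_apply, hslope]

/-- An integer vector as a complex number. -/
def toC (p : ℤ × ℤ) : ℂ := ⟨p.1, p.2⟩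

@[simp] theorem toC_re (p : ℤ × ℤ) : (toC p).re = p.1 := rfl
@[simp] theorem toC_im (p : ℤ × ℤ) : (toC p).im = p.2 := rfl

/-- Values prescribed at the vertices and at the centers of the unit cells of `ℤ²`. -/
structure Mesh where
  V : ℤ → ℤ → ℤ × ℤ
  C : ℤ → ℤ → ℤ × ℤ

namespace Mesh

/-- Slope along the diagonal direction, on the upper right or lower left half of a cell. -/
def sP (M : Mesh) (i j : ℤ) (p : Bool) : ℤ × ℤ :=
  if p then M.V (i + 1) (j + 1) - M.C i j else M.C i j - M.V i j

/-- Slope along the antidiagonal direction, on the lower right or upper left half of a cell. -/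
def sD (M : Mesh) (i j : ℤ) (d : Bool) : ℤ × ℤ :=
  if d then M.V (i + 1) j - M.C i j else M.C i j - M.V i (j + 1)

/-- The diagonal coordinate centered in the cell `(i, j)`. -/
def cp (i j : ℤ) (z : ℂ) : ℝ := z.re - i - 1 / 2 + (z.im - j - 1 / 2)

/-- The antidiagonal coordinate centered in the cell `(i, j)`. -/
def cd (i j : ℤ) (z : ℂ) : ℝ := z.re - i - 1 / 2 - (z.im - j - 1 / 2)

/-- The piecewise affine interpolation on the cell `(i, j)`. -/
def cell (M : Mesh) (i j : ℤ) (z : ℂ) : ℂ :=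
  toC (M.C i j) + max (cp i j z) 0 * toC (M.sP i j true) + min (cp i j z) 0 * toC (M.sP i j false)
    + max (cd i j z) 0 * toC (M.sD i j true) + min (cd i j z) 0 * toC (M.sD i j false)

/-- The piecewise affine interpolation. -/
def map (M : Mesh) (z : ℂ) : ℂ := M.cell ⌊z.re⌋ ⌊z.im⌋ z

theorem cell_continuous (M : Mesh) (i j : ℤ) : Continuous (M.cell i j) := by
  have h1 : Continuous (cp i j) := by unfold cp; fun_prop
  have h2 : Continuous (cd i j) := by unfold cd; fun_prop
  unfold cell
  fun_prop

theorem cell_succ_left (M : Mesh) {i j : ℤ} {z : ℂ} (h : z.re = i + 1) (h1 : (j : ℝ) ≤ z.im)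
    (h2 : z.im ≤ j + 1) : M.cell (i + 1) j z = M.cell i j z := by
  have a1 : 0 ≤ cp i j z := by unfold cp; linarith
  have a2 : 0 ≤ cd i j z := by unfold cd; linarith
  have a3 : cp (i + 1) j z ≤ 0 := by unfold cp; push_cast; linarith
  have a4 : cd (i + 1) j z ≤ 0 := by unfold cd; push_cast; linarith
  unfold cell
  rw [max_eq_left a1, min_eq_right a1, max_eq_left a2, min_eq_right a2,
    max_eq_right a3, min_eq_left a3, max_eq_right a4, min_eq_left a4]
  apply Complex.ext <;> simp [sP, sD, cp, cd, h] <;> ring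

theorem cell_succ_right (M : Mesh) {i j : ℤ} {z : ℂ} (h : z.im = j + 1) (h1 : (i : ℝ) ≤ z.re)
    (h2 : z.re ≤ i + 1) : M.cell i (j + 1) z = M.cell i j z := by
  have a1 : 0 ≤ cp i j z := by unfold cp; linarith
  have a2 : cd i j z ≤ 0 := by unfold cd; linarith
  have a3 : cp i (j + 1) z ≤ 0 := by unfold cp; push_cast; linarith
  have a4 : 0 ≤ cd i (j + 1) z := by unfold cd; push_cast; linarith
  unfold cell
  rw [max_eq_left a1, min_eq_right a1, max_eq_right a2, min_eq_left a2,
    max_eq_right a3, min_eq_left a3, max_eq_left a4, min_eq_right a4]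
  apply Complex.ext <;> simp [sP, sD, cp, cd, h] <;> ring

/-- The closed unit cell with lower left corner `(i, j)`. -/
def box (i j : ℤ) : Set ℂ := {z | (i ≤ z.re ∧ z.re ≤ i + 1) ∧ j ≤ z.im ∧ z.im ≤ j + 1}

theorem box_isClosed (i j : ℤ) : IsClosed (box i j) := by
  apply IsClosed.inter <;> apply IsClosed.inter
  · exact isClosed_le continuous_const Complex.continuous_re
  · exact isClosed_le Complex.continuous_re continuous_const
  · exact isClosed_le continuous_const Complex.continuous_im
  · exact isClosed_le Complex.continuous_im continuous_const

theorem mem_box_floor (z : ℂ) : z ∈ box ⌊z.re⌋ ⌊z.im⌋ :=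
  ⟨⟨Int.floor_le _, (Int.lt_floor_add_one _).le⟩, Int.floor_le _, (Int.lt_floor_add_one _).le⟩

theorem floor_cases {x : ℝ} {i : ℤ} (h1 : i ≤ x) (h2 : x ≤ i + 1) :
    ⌊x⌋ = i ∨ (⌊x⌋ = i + 1 ∧ x = i + 1) := by
  rcases h2.eq_or_lt with h | h
  · right
    refine ⟨?_, h⟩
    rw [h]; exact_mod_cast Int.floor_intCast (i + 1)
  · left; exact Int.floor_eq_iff.2 ⟨h1, h⟩

theorem map_eq_cell (M : Mesh) {i j : ℤ} {z : ℂ} (h : z ∈ box i j) : M.map z = M.cell i j z := by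
  obtain ⟨⟨h1, h2⟩, h3, h4⟩ := h
  unfold map
  have e : M.cell ⌊z.re⌋ ⌊z.im⌋ z = M.cell i ⌊z.im⌋ z := by
    rcases floor_cases h1 h2 with h | ⟨h, h'⟩
    · rw [h]
    · rw [h, cell_succ_left M h' (Int.floor_le _) (Int.lt_floor_add_one _).le]
  rw [e]
  rcases floor_cases h3 h4 with h | ⟨h, h'⟩
  · rw [h]
  · rw [h, cell_succ_right M h' h1 h2]

theorem map_continuous (M : Mesh) : Continuous M.map := by
  have hlf : LocallyFinite (fun p : ℤ × ℤ => box p.1 p.2) := by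
    intro z
    refine ⟨Metric.ball z 1, Metric.ball_mem_nhds _ one_pos, ?_⟩
    refine ((Set.finite_Icc (⌊z.re⌋ - 2) (⌊z.re⌋ + 2)).prod
      (Set.finite_Icc (⌊z.im⌋ - 2) (⌊z.im⌋ + 2))).subset ?_
    rintro ⟨i, j⟩ ⟨w, ⟨⟨h1, h2⟩, h3, h4⟩, hw⟩
    rw [Metric.mem_ball, dist_eq_norm] at hw
    have hr := (abs_le.1 ((Complex.abs_re_le_norm _).trans hw.le))
    have hi := (abs_le.1 ((Complex.abs_im_le_norm _).trans hw.le))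
    simp only [Complex.sub_re, Complex.sub_im] at hr hi
    have f1 := Int.floor_le z.re
    have f2 := Int.lt_floor_add_one z.re
    have f3 := Int.floor_le z.im
    have f4 := Int.lt_floor_add_one z.im
    simp only at h1 h2 h3 h4
    have g1 : (⌊z.re⌋ : ℝ) - 3 < i := by linarith
    have g2 : (i : ℝ) < ⌊z.re⌋ + 3 := by linarith
    have g3 : (⌊z.im⌋ : ℝ) - 3 < j := by linarith
    have g4 : (j : ℝ) < ⌊z.im⌋ + 3 := by linarith
    norm_cast at g1 g2 g3 g4
    simp only [mem_prod, mem_Icc]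
    omega
  refine hlf.continuous ?_ (fun p => box_isClosed _ _) (fun p => ?_)
  · exact eq_univ_of_forall fun z => mem_iUnion.2 ⟨(⌊z.re⌋, ⌊z.im⌋), mem_box_floor z⟩
  · exact (M.cell_continuous p.1 p.2).continuousOn.congr fun z hz => M.map_eq_cell hz

/-- A closed triangle of the criss-cross triangulation. -/
def tri (i j : ℤ) (p d : Bool) : Set ℂ :=
  {z | z ∈ box i j ∧ (if p then 0 ≤ cp i j z else cp i j z ≤ 0) ∧
    (if d then 0 ≤ cd i j z else cd i j z ≤ 0)}

/-- The linear part of the interpolation on a triangle. -/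
def lin (g h : ℤ × ℤ) (v : ℂ) : ℂ := ((v.re + v.im : ℝ) : ℂ) * toC g + ((v.re - v.im : ℝ) : ℂ) * toC h

theorem map_tri (M : Mesh) {i j : ℤ} {p d : Bool} {z : ℂ} (h : z ∈ tri i j p d) :
    M.map z = toC (M.C i j) + cp i j z * toC (M.sP i j p) + cd i j z * toC (M.sD i j d) := by
  obtain ⟨hb, hp, hd⟩ := h
  rw [M.map_eq_cell hb, cell]
  cases p <;> cases d <;> simp only [Bool.false_eq_true, if_false, if_true] at hp hd
  · rw [max_eq_right hp, min_eq_left hp, max_eq_right hd, min_eq_left hd]; push_cast; ring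
  · rw [max_eq_right hp, min_eq_left hp, max_eq_left hd, min_eq_right hd]; push_cast; ring
  · rw [max_eq_left hp, min_eq_right hp, max_eq_right hd, min_eq_left hd]; push_cast; ring
  · rw [max_eq_left hp, min_eq_right hp, max_eq_left hd, min_eq_right hd]; push_cast; ring

theorem evAff_map (M : Mesh) {i j : ℤ} {p d : Bool} {z v : ℂ}
    (h : ∀ᶠ t : ℝ in 𝓝[≥] 0, z + t * v ∈ tri i j p d) :
    EvAff M.map z v (lin (M.sP i j p) (M.sD i j d) v) := by
  have h0 : z ∈ tri i j p d := by simpa using h.self_of_nhdsWithin (by simp)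
  filter_upwards [h] with t ht
  rw [M.map_tri ht, M.map_tri h0]
  apply Complex.ext <;> simp [cp, cd, lin] <;> ring

theorem ray_tri {i j : ℤ} {z v : ℂ} (h1 : ∀ᶠ t : ℝ in 𝓝[≥] 0, (i : ℝ) ≤ z.re + t * v.re ∧
      z.re + t * v.re ≤ i + 1)
    (h2 : ∀ᶠ t : ℝ in 𝓝[≥] 0, (j : ℝ) ≤ z.im + t * v.im ∧ z.im + t * v.im ≤ j + 1) :
    ∃ p d, ∀ᶠ t : ℝ in 𝓝[≥] 0, z + t * v ∈ tri i j p d := by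
  have hp : ∃ p : Bool, ∀ᶠ t : ℝ in 𝓝[≥] 0,
      (if p then 0 ≤ cp i j (z + t * v) else cp i j (z + t * v) ≤ 0) := by
    have e : ∀ t : ℝ, cp i j (z + t * v) = cp i j z + t * (v.re + v.im) := by
      intro t; simp [cp]; ring
    simp only [e]
    rcases ray_sign (cp i j z) (v.re + v.im) with h | h
    · exact ⟨true, by simpa using h⟩
    · exact ⟨false, by simpa using h⟩
  have hd : ∃ d : Bool, ∀ᶠ t : ℝ in 𝓝[≥] 0,
      (if d then 0 ≤ cd i j (z + t * v) else cd i j (z + t * v) ≤ 0) := by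
    have e : ∀ t : ℝ, cd i j (z + t * v) = cd i j z + t * (v.re - v.im) := by
      intro t; simp [cd]; ring
    simp only [e]
    rcases ray_sign (cd i j z) (v.re - v.im) with h | h
    · exact ⟨true, by simpa using h⟩
    · exact ⟨false, by simpa using h⟩
  obtain ⟨p, hp⟩ := hp
  obtain ⟨d, hd⟩ := hd
  refine ⟨p, d, ?_⟩
  filter_upwards [h1, h2, hp, hd] with t h1 h2 hp hd
  exact ⟨by simpa [box] using ⟨h1, h2⟩, hp, hd⟩

theorem exists_tri (z v : ℂ) :
    ∃ i j p d, ∀ᶠ t : ℝ in 𝓝[≥] 0, z + t * v ∈ tri i j p d := by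
  obtain ⟨i, hi⟩ := ray_floor z.re v.re
  obtain ⟨j, hj⟩ := ray_floor z.im v.im
  obtain ⟨p, d, h⟩ := ray_tri hi hj
  exact ⟨i, j, p, d, h⟩

/-! Integer positive semidefiniteness tests. -/

/-- The quadratic form `x s² + y s t + w t²` is positive semidefinite. -/
def psd (x y w : ℤ) : Bool := decide (0 ≤ x) && decide (0 ≤ w) && decide (y * y ≤ 4 * x * w)

theorem psd_nonneg {x y w : ℤ} (h : psd x y w = true) (s t : ℝ) :
    0 ≤ x * s ^ 2 + y * (s * t) + w * t ^ 2 := by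
  simp only [psd, Bool.and_eq_true, decide_eq_true_eq] at h
  obtain ⟨⟨hx, hw⟩, hy⟩ := h
  have hx' : (0 : ℝ) ≤ x := by exact_mod_cast hx
  have hw' : (0 : ℝ) ≤ w := by exact_mod_cast hw
  have hy' : (y : ℝ) * y ≤ 4 * x * w := by exact_mod_cast hy
  rcases hx'.eq_or_lt with h0 | h0
  · have : (y : ℝ) = 0 := by
      rw [← h0] at hy'; nlinarith [mul_self_nonneg (y : ℝ)]
    rw [← h0, this]; nlinarith [sq_nonneg t, mul_nonneg hw' (sq_nonneg t)]
  · have : 0 ≤ 4 * x * (x * s ^ 2 + y * (s * t) + w * t ^ 2) := by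
      nlinarith [sq_nonneg (2 * x * s + y * t), mul_nonneg (sub_nonneg.2 hy') (sq_nonneg t)]
    exact nonneg_of_mul_nonneg_right this (by positivity)

/-- Scalar product of integer vectors. -/
def dt (g h : ℤ × ℤ) : ℤ := g.1 * h.1 + g.2 * h.2

/-- `a |s g + t h|² ≥ b |s g' + t h'|²`, tested on integer data. -/
def dominates (a b : ℤ) (g h g' h' : ℤ × ℤ) : Bool :=
  psd (a * dt g g - b * dt g' g') (2 * (a * dt g h - b * dt g' h')) (a * dt h h - b * dt h' h')

theorem norm_sq_toC (g h : ℤ × ℤ) (s t : ℝ) :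
    ‖(s : ℂ) * toC g + (t : ℂ) * toC h‖ ^ 2 = dt g g * s ^ 2 + 2 * dt g h * (s * t) + dt h h * t ^ 2 := by
  rw [← Complex.normSq_eq_norm_sq, Complex.normSq_apply]
  simp [dt]; ring

theorem norm_le_of_dominates {a b : ℤ} {g h g' h' : ℤ × ℤ} (hd : dominates a b g h g' h' = true)
    (hb : 0 < b) {κ : ℝ} (hκ : 0 ≤ κ) (hκ2 : (a : ℝ) ≤ κ ^ 2 * b) (s t : ℝ) :
    ‖(s : ℂ) * toC g' + (t : ℂ) * toC h'‖ ≤ κ * ‖(s : ℂ) * toC g + (t : ℂ) * toC h‖ := by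
  have h1 := psd_nonneg hd s t
  have h2 : b * ‖(s : ℂ) * toC g' + (t : ℂ) * toC h'‖ ^ 2
      ≤ a * ‖(s : ℂ) * toC g + (t : ℂ) * toC h‖ ^ 2 := by
    rw [norm_sq_toC, norm_sq_toC]; push_cast at h1; linarith
  have hb' : (0 : ℝ) < b := by exact_mod_cast hb
  apply (sq_le_sq₀ (norm_nonneg _) (by positivity)).1
  apply le_of_mul_le_mul_left _ hb'
  rw [mul_pow]
  nlinarith [sq_nonneg ‖(s : ℂ) * toC g + (t : ℂ) * toC h‖]

/-- Monotonicity of the linear map with diagonal slope `g` and antidiagonal slope `h`, with respect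
to the matrix with rows `(a, b)` and `(c, d)`. -/
def mono (a b c d : ℤ) (g h : ℤ × ℤ) : Bool :=
  psd ((a + b) * g.1 + (c + d) * g.2 - 1)
    ((a - b) * g.1 + (c - d) * g.2 + (a + b) * h.1 + (c + d) * h.2)
    ((a - b) * h.1 + (c - d) * h.2 - 1)

theorem bil_of_mono {a b c d : ℤ} {g h : ℤ × ℤ} (hm : mono a b c d g h = true) (v : ℂ) :
    1 * ‖v‖ ^ 2 ≤ bil a b c d v (lin g h v) := by
  have h1 := psd_nonneg hm (v.re + v.im) (v.re - v.im)
  rw [← Complex.normSq_eq_norm_sq, Complex.normSq_apply]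
  push_cast at h1
  simp [bil, lin]
  linarith

end Mesh

theorem toC_add (p q : ℤ × ℤ) : toC (p + q) = toC p + toC q := by
  apply Complex.ext <;> simp

theorem toC_neg (p : ℤ × ℤ) : toC (-p) = -toC p := by
  apply Complex.ext <;> simp

theorem toC_sub (p q : ℤ × ℤ) : toC (p - q) = toC p - toC q := by
  apply Complex.ext <;> simp

namespace Mesh

theorem map_add_of_periodic (M : Mesh) {p q : ℤ} {τ : ℤ × ℤ}
    (hV : ∀ i j, M.V (i + p) (j + q) = M.V i j + τ) (hC : ∀ i j, M.C (i + p) (j + q) = M.C i j + τ)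
    (z : ℂ) : M.map (z + toC (p, q)) = M.map z + toC τ := by
  have hb : z + toC (p, q) ∈ box (⌊z.re⌋ + p) (⌊z.im⌋ + q) := by
    obtain ⟨⟨h1, h2⟩, h3, h4⟩ := mem_box_floor z
    simp only [box, mem_ofPred_eq, Complex.add_re, Complex.add_im, toC_re, toC_im]
    push_cast
    refine ⟨⟨?_, ?_⟩, ?_, ?_⟩ <;> linarith
  rw [M.map_eq_cell hb, map]
  have hV1 : ∀ i j, M.V (i + p + 1) (j + q) = M.V (i + 1) j + τ := by
    intro i j; rw [← hV]; ring_nf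
  have hV2 : ∀ i j, M.V (i + p) (j + q + 1) = M.V i (j + 1) + τ := by
    intro i j; rw [← hV]; ring_nf
  have hV3 : ∀ i j, M.V (i + p + 1) (j + q + 1) = M.V (i + 1) (j + 1) + τ := by
    intro i j; rw [← hV]; ring_nf
  have e1 : ∀ i j, cp (i + p) (j + q) (z + toC (p, q)) = cp i j z := by
    intro i j; simp [cp]
  have e2 : ∀ i j, cd (i + p) (j + q) (z + toC (p, q)) = cd i j z := by
    intro i j; simp [cd]
  simp only [cell, sP, sD, e1, e2, hV, hV1, hV2, hV3, hC, toC_add, toC_sub, if_true,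
    Bool.false_eq_true, if_false]
  ring

theorem map_halfturn (M : Mesh) {p q : ℤ}
    (hV : ∀ i j, M.V (p - i) (q - j) = -M.V i j) (hC : ∀ i j, M.C (p - 1 - i) (q - 1 - j) = -M.C i j)
    (z : ℂ) : M.map (toC (p, q) - z) = -M.map z := by
  have hb : toC (p, q) - z ∈ box (p - 1 - ⌊z.re⌋) (q - 1 - ⌊z.im⌋) := by
    obtain ⟨⟨h1, h2⟩, h3, h4⟩ := mem_box_floor z
    simp only [box, mem_ofPred_eq, Complex.sub_re, Complex.sub_im, toC_re, toC_im]
    push_cast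
    refine ⟨⟨?_, ?_⟩, ?_, ?_⟩ <;> linarith
  rw [M.map_eq_cell hb, map]
  have hV0 : ∀ i j, M.V (p - 1 - i) (q - 1 - j) = -M.V (i + 1) (j + 1) := by
    intro i j; rw [← hV]; ring_nf
  have hV1 : ∀ i j, M.V (p - 1 - i + 1) (q - 1 - j) = -M.V i (j + 1) := by
    intro i j; rw [← hV]; ring_nf
  have hV2 : ∀ i j, M.V (p - 1 - i) (q - 1 - j + 1) = -M.V (i + 1) j := by
    intro i j; rw [← hV]; ring_nf
  have hV3 : ∀ i j, M.V (p - 1 - i + 1) (q - 1 - j + 1) = -M.V i j := by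
    intro i j; rw [← hV]; ring_nf
  have e1 : ∀ i j, cp (p - 1 - i) (q - 1 - j) (toC (p, q) - z) = -cp i j z := by
    intro i j; simp [cp]; ring
  have e2 : ∀ i j, cd (p - 1 - i) (q - 1 - j) (toC (p, q) - z) = -cd i j z := by
    intro i j; simp [cd]; ring
  have n1 : ∀ x : ℝ, max (-x) 0 = -min x 0 := by
    intro x; rw [← neg_zero, max_neg_neg, neg_zero]
  have n2 : ∀ x : ℝ, min (-x) 0 = -max x 0 := by
    intro x; rw [← neg_zero, min_neg_neg, neg_zero]
  simp only [cell, sP, sD, e1, e2, hV0, hV1, hV2, hV3, hC, toC_sub, toC_neg, if_true,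
    Bool.false_eq_true, if_false, n1, n2]
  push_cast
  ring

end Mesh

theorem lattice_induction {w H : ℕ} {s : ℤ} (hw : 0 < w) (hH : 0 < H) {Φ : ℤ → ℤ → Prop}
    (h1 : ∀ i j, Φ (i + w) j ↔ Φ i j) (h2 : ∀ i j, Φ (i + s) (j + H) ↔ Φ i j)
    (h : ∀ i j : ℕ, i < w → j < H → Φ i j) (i j : ℤ) : Φ i j := by
  have g1 : ∀ (n : ℤ) i j, Φ (i + n * w) j ↔ Φ i j := by
    intro n
    induction n using Int.induction_on with
    | zero => simp
    | succ n ih => intro i j; rw [← ih i j, ← h1 (i + n * w) j]; ring_nf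
    | pred n ih => intro i j; rw [← ih i j, ← h1 (i + (-n - 1) * w) j]; ring_nf
  have g2 : ∀ (n : ℤ) i j, Φ (i + n * s) (j + n * H) ↔ Φ i j := by
    intro n
    induction n using Int.induction_on with
    | zero => simp
    | succ n ih => intro i j; rw [← ih i j, ← h2 (i + n * s) (j + n * H)]; ring_nf
    | pred n ih => intro i j; rw [← ih i j, ← h2 (i + (-n - 1) * s) (j + (-n - 1) * H)]; ring_nf
  have hH' : (0 : ℤ) < H := by exact_mod_cast hH
  have hw' : (0 : ℤ) < w := by exact_mod_cast hw
  set n := j / (H : ℤ)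
  set k := (i - n * s) / (w : ℤ)
  have a1 := Int.emod_nonneg j hH'.ne'
  have a2 := Int.emod_lt_of_pos j hH'
  have a3 := Int.emod_nonneg (i - n * s) hw'.ne'
  have a4 := Int.emod_lt_of_pos (i - n * s) hw'
  have base := h ((i - n * s) % w).toNat (j % H).toNat (by omega) (by omega)
  rw [Int.toNat_of_nonneg a1, Int.toNat_of_nonneg a3] at base
  rw [← g1 k, ← g2 n] at base
  have e1 : (i - n * s) % w + k * w + n * s = i := by
    have := Int.emod_add_mul_ediv (i - n * s) w
    simp only [k]; linarith
  have e2 : j % H + n * H = j := by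
    have := Int.emod_add_mul_ediv j H
    simp only [n]; linarith
  rwa [e1, e2] at base

/-- Values of an interpolation that is equivariant under the lattice spanned by `(w, 0)` and
`(s, H)`, which act on values as the translations by `U` and `W`. -/
structure Table where
  TV : List (ℤ × ℤ)
  TC : List (ℤ × ℤ)
  w : ℕ
  s : ℤ
  H : ℕ
  U : ℤ × ℤ
  W : ℤ × ℤ

namespace Table

/-- The equivariant extension of a list of values. -/
def val (T : Table) (l : List (ℤ × ℤ)) (i j : ℤ) : ℤ × ℤ :=
  let n := j / T.H
  let k := (i - n * T.s) / T.w
  let t := l.getD ((j % T.H) * T.w + (i - n * T.s) % T.w).toNat (0, 0)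
  (t.1 + k * T.U.1 + n * T.W.1, t.2 + k * T.U.2 + n * T.W.2)

/-- The mesh with the given table of values. -/
def mesh (T : Table) : Mesh := ⟨T.val T.TV, T.val T.TC⟩

theorem val_add_left (T : Table) (hw : 0 < T.w) (l : List (ℤ × ℤ)) (i j : ℤ) :
    T.val l (i + T.w) j = T.val l i j + T.U := by
  have hw' : (T.w : ℤ) ≠ 0 := by exact_mod_cast hw.ne'
  have e : i + T.w - j / T.H * T.s = i - j / T.H * T.s + 1 * T.w := by ring
  simp only [val, e, Int.add_mul_emod_self_right, Int.add_mul_ediv_right _ _ hw']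
  apply Prod.ext <;> simp <;> ring

theorem val_add_right (T : Table) (hH : 0 < T.H) (l : List (ℤ × ℤ)) (i j : ℤ) :
    T.val l (i + T.s) (j + T.H) = T.val l i j + T.W := by
  have hH' : (T.H : ℤ) ≠ 0 := by exact_mod_cast hH.ne'
  have e : (j + T.H) / T.H = j / T.H + 1 := by
    have := Int.add_mul_ediv_right j 1 hH'
    simpa using this
  have e' : i + T.s - (j / T.H + 1) * T.s = i - j / T.H * T.s := by ring
  simp only [val, e, e', Int.add_emod_right]
  apply Prod.ext <;> simp <;> ring

theorem sP_add_left (T : Table) (hw : 0 < T.w) (i j : ℤ) (p : Bool) :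
    T.mesh.sP (i + T.w) j p = T.mesh.sP i j p := by
  have h := T.val_add_left hw
  have e : i + T.w + 1 = i + 1 + T.w := by ring
  simp only [Mesh.sP, mesh, e, h, add_sub_add_right_eq_sub]

theorem sD_add_left (T : Table) (hw : 0 < T.w) (i j : ℤ) (p : Bool) :
    T.mesh.sD (i + T.w) j p = T.mesh.sD i j p := by
  have h := T.val_add_left hw
  have e : i + T.w + 1 = i + 1 + T.w := by ring
  simp only [Mesh.sD, mesh, e, h, add_sub_add_right_eq_sub]

theorem sP_add_right (T : Table) (hH : 0 < T.H) (i j : ℤ) (p : Bool) :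
    T.mesh.sP (i + T.s) (j + T.H) p = T.mesh.sP i j p := by
  have h := T.val_add_right hH
  have e : i + T.s + 1 = i + 1 + T.s := by ring
  have e' : j + T.H + 1 = j + 1 + T.H := by ring
  simp only [Mesh.sP, mesh, e, e', h, add_sub_add_right_eq_sub]

theorem sD_add_right (T : Table) (hH : 0 < T.H) (i j : ℤ) (p : Bool) :
    T.mesh.sD (i + T.s) (j + T.H) p = T.mesh.sD i j p := by
  have h := T.val_add_right hH
  have e : i + T.s + 1 = i + 1 + T.s := by ring
  have e' : j + T.H + 1 = j + 1 + T.H := by ring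
  simp only [Mesh.sD, mesh, e, e', h, add_sub_add_right_eq_sub]

/-- Run a test on all `i < w`, `j < H`. -/
def allCells (w H : ℕ) (φ : ℤ → ℤ → Bool) : Bool :=
  (List.range w).all fun i => (List.range H).all fun j => φ i j

theorem allCells_spec {w H : ℕ} {φ : ℤ → ℤ → Bool} (h : allCells w H φ = true) {i j : ℕ}
    (hi : i < w) (hj : j < H) : φ i j = true := by
  simp only [allCells, List.all_eq_true, List.mem_range] at h
  exact h i hi j hj

/-- Run a test on both truth values. -/
def both (φ : Bool → Bool) : Bool := φ true && φ false

theorem both_spec {φ : Bool → Bool} (h : both φ = true) (b : Bool) : φ b = true := by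
  simp only [both, Bool.and_eq_true] at h
  cases b
  · exact h.2
  · exact h.1

/-- The finite test that makes the interpolation tame. -/
def tameTest (T : Table) (a b c d N : ℤ) : Bool :=
  allCells T.w T.H fun i j => both fun p => both fun q =>
    Mesh.mono a b c d (T.mesh.sP i j p) (T.mesh.sD i j q) &&
    Mesh.dominates N 1 (1, 1) (1, -1) (T.mesh.sP i j p) (T.mesh.sD i j q)

theorem tame_of_test (T : Table) {a b c d N : ℤ} (hw : 0 < T.w) (hH : 0 < T.H) (hN : 1 ≤ N)
    (hdet : a * d - b * c ≠ 0) (h : T.tameTest a b c d N = true) : Tame T.mesh.map := by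
  have key : ∀ i j : ℤ, ∀ p q, Mesh.mono a b c d (T.mesh.sP i j p) (T.mesh.sD i j q) = true ∧
      Mesh.dominates N 1 (1, 1) (1, -1) (T.mesh.sP i j p) (T.mesh.sD i j q) = true := by
    refine lattice_induction (s := T.s) hw hH ?_ ?_ ?_
    · intro i j; simp only [T.sP_add_left hw, T.sD_add_left hw]
    · intro i j; simp only [T.sP_add_right hH, T.sD_add_right hH]
    · intro i j hi hj p q
      have := both_spec (both_spec (allCells_spec h hi hj) p) q
      simpa using this
  refine ⟨T.mesh.map_continuous, a, b, c, d, 1, 2 * N, one_pos, by exact_mod_cast hdet, ?_⟩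
  intro z v
  obtain ⟨i, j, p, q, hz⟩ := Mesh.exists_tri z v
  refine ⟨_, T.mesh.evAff_map hz, ?_, Mesh.bil_of_mono (key i j p q).1 v⟩
  have hN' : (1 : ℝ) ≤ N := by exact_mod_cast hN
  have h1 := Mesh.norm_le_of_dominates (key i j p q).2 one_pos (κ := N) (by linarith)
    (by push_cast; nlinarith) (v.re + v.im) (v.re - v.im)
  have e : ((v.re + v.im : ℝ) : ℂ) * toC (1, 1) + ((v.re - v.im : ℝ) : ℂ) * toC (1, -1)
      = ((2 : ℝ) : ℂ) * v := by
    apply Complex.ext <;> simp [toC] <;> ring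
  rw [e, norm_mul, Complex.norm_real, Real.norm_of_nonneg (by norm_num : (0 : ℝ) ≤ 2)] at h1
  unfold Mesh.lin
  linarith

/-- The finite test for the half-turn `z ↦ (p, q) - z` to act as `w ↦ -w`. -/
def turnTest (T : Table) (p q : ℤ) : Bool :=
  allCells T.w T.H fun i j => decide (T.mesh.V (p - i) (q - j) = -T.mesh.V i j) &&
    decide (T.mesh.C (p - 1 - i) (q - 1 - j) = -T.mesh.C i j)

theorem map_turn (T : Table) {p q : ℤ} (hw : 0 < T.w) (hH : 0 < T.H)
    (h : T.turnTest p q = true) (z : ℂ) : T.mesh.map (toC (p, q) - z) = -T.mesh.map z := by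
  have cancel : ∀ a b u : ℤ × ℤ, (a - u = -(b + u) ↔ a = -b) := by
    intro a b u; rw [neg_add, ← sub_eq_add_neg, sub_left_inj]
  have s1 : ∀ (l : List (ℤ × ℤ)) i j, T.val l (i - T.w) j = T.val l i j - T.U := by
    intro l i j
    have := T.val_add_left hw l (i - T.w) j
    rw [sub_add_cancel] at this; rw [this]; ring
  have s2 : ∀ (l : List (ℤ × ℤ)) i j, T.val l (i - T.s) (j - T.H) = T.val l i j - T.W := by
    intro l i j
    have := T.val_add_right hH l (i - T.s) (j - T.H)
    rw [sub_add_cancel, sub_add_cancel] at this; rw [this]; ring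
  have key : ∀ (l : List (ℤ × ℤ)) (a b : ℤ),
      (∀ i j : ℕ, i < T.w → j < T.H → T.val l (a - i) (b - j) = -T.val l i j) →
      ∀ i j : ℤ, T.val l (a - i) (b - j) = -T.val l i j := by
    intro l a b hab
    refine lattice_induction (s := T.s) hw hH ?_ ?_ hab
    · intro i j
      rw [T.val_add_left hw, ← sub_sub, s1]; exact cancel _ _ _
    · intro i j
      rw [T.val_add_right hH, ← sub_sub, ← sub_sub, s2]; exact cancel _ _ _
  refine Mesh.map_halfturn _ (key T.TV _ _ fun i j hi hj => ?_) (key T.TC _ _ fun i j hi hj => ?_) z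
  · have := allCells_spec h hi hj
    simp only [Bool.and_eq_true, decide_eq_true_eq] at this
    exact this.1
  · have := allCells_spec h hi hj
    simp only [Bool.and_eq_true, decide_eq_true_eq] at this
    exact this.2

end Table

/-- The value at `p` of the affine form `k`. -/
def levZ (k : ℤ × ℤ × ℤ) (p : ℤ × ℤ) : ℤ := k.1 * p.1 + k.2.1 * p.2 - k.2.2

/-- The value at `w` of the affine form `k`. -/
def lev (k : ℤ × ℤ × ℤ) (w : ℂ) : ℝ := k.1 * w.re + k.2.1 * w.im - k.2.2

theorem lev_toC (k : ℤ × ℤ × ℤ) (p : ℤ × ℤ) : lev k (toC p) = levZ k p := by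
  simp [lev, levZ]

theorem lev_continuous (k : ℤ × ℤ × ℤ) : Continuous (lev k) := by
  unfold lev; fun_prop

/-- The closed polygon on which all forms in `l` are nonpositive. -/
def poly (l : List (ℤ × ℤ × ℤ)) : Set ℂ := {w | ∀ k ∈ l, lev k w ≤ 0}

/-- The open polygon on which all forms in `l` are negative. -/
def polyo (l : List (ℤ × ℤ × ℤ)) : Set ℂ := {w | ∀ k ∈ l, lev k w < 0}

theorem lev_combo (k : ℤ × ℤ × ℤ) (x y : ℂ) {s t : ℝ} (h : s + t = 1) :
    lev k (s • x + t • y) = s * lev k x + t * lev k y := by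
  have : t = 1 - s := by linarith
  subst this
  simp [lev]; ring

theorem poly_convex (l : List (ℤ × ℤ × ℤ)) : Convex ℝ (poly l) := by
  intro x hx y hy s t hs ht hst k hk
  rw [lev_combo k x y hst]
  nlinarith [hx k hk, hy k hk]

theorem polyo_convex (l : List (ℤ × ℤ × ℤ)) : Convex ℝ (polyo l) := by
  intro x hx y hy s t hs ht hst k hk
  rw [lev_combo k x y hst]
  rcases hs.eq_or_lt with h | h
  · have : t = 1 := by linarith
    subst this; rw [← h]; simpa using hy k hk
  · nlinarith [mul_pos h (neg_pos.2 (hx k hk)), mul_nonneg ht (neg_pos.2 (hy k hk)).le]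

theorem polyo_isOpen (l : List (ℤ × ℤ × ℤ)) : IsOpen (polyo l) := by
  have : polyo l = ⋂ k ∈ {k | k ∈ l}, {w | lev k w < 0} := by ext; simp [polyo]
  rw [this]
  exact (List.finite_toSet l).isOpen_biInter fun k _ => isOpen_lt (lev_continuous k) continuous_const

theorem polyo_subset_poly (l : List (ℤ × ℤ × ℤ)) : polyo l ⊆ poly l := fun _ h k hk => (h k hk).le

theorem poly_subset_closure {l : List (ℤ × ℤ × ℤ)} (hne : (polyo l).Nonempty) :
    poly l ⊆ closure (polyo l) := by
  obtain ⟨o, ho⟩ := hne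
  intro x hx
  have ht : Tendsto (fun t : ℝ => (1 - t) • x + t • o) (𝓝[>] 0) (𝓝 x) := by
    have : Continuous (fun t : ℝ => (1 - t) • x + t • o) := by fun_prop
    have h0 := this.tendsto 0
    simp only [sub_zero, one_smul, zero_smul, add_zero] at h0
    exact h0.mono_left nhdsWithin_le_nhds
  refine mem_closure_of_tendsto ht ?_
  have h1 : ∀ᶠ t : ℝ in 𝓝[>] 0, t < 1 := nhdsWithin_le_nhds (Iio_mem_nhds one_pos)
  filter_upwards [self_mem_nhdsWithin, h1] with t ht0 ht1 k hk
  rw [lev_combo k x o (by ring)]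
  have := mul_pos (show (0 : ℝ) < t from ht0) (neg_pos.2 (ho k hk))
  nlinarith [hx k hk]

/-- A homeomorphism of the plane that maps `S` into a convex polygon, and the points of `S` outside
an open subset of `S` into its boundary, maps `S` onto the polygon. -/
theorem image_eq_poly (f : ℂ ≃ₜ ℂ) {l : List (ℤ × ℤ × ℤ)} {S U : Set ℂ} (hS : IsCompact S)
    (hU : IsOpen U) (hUS : U ⊆ S) (hSl : ∀ z ∈ S, f z ∈ poly l)
    (hb : ∀ z ∈ S, z ∈ U ∨ ∃ k ∈ l, lev k (f z) = 0) {z₀ : ℂ} (hz : z₀ ∈ S)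
    (hz' : f z₀ ∈ polyo l) : f '' S = poly l := by
  have key : ∀ z ∈ S, f z ∈ polyo l → z ∈ U := by
    intro z h1 h2
    rcases hb z h1 with h | ⟨k, hk, h⟩
    · exact h
    · exact absurd h (h2 k hk).ne
  have hcl : IsClosed (f '' S) := (hS.image f.continuous).isClosed
  have h1 : polyo l ⊆ f '' U := by
    refine (polyo_convex l).isPreconnected.subset_of_closure_inter_subset (f.isOpenMap U hU)
      ⟨f z₀, hz', z₀, key z₀ hz hz', rfl⟩ ?_
    rintro w ⟨hw, hw'⟩
    obtain ⟨z, hz, rfl⟩ := hcl.closure_subset_iff.2 (image_mono hUS) hw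
    exact ⟨z, key z hz hw', rfl⟩
  apply Subset.antisymm
  · rintro _ ⟨z, hz, rfl⟩; exact hSl z hz
  · exact (poly_subset_closure ⟨_, hz'⟩).trans
      (hcl.closure_subset_iff.2 (h1.trans (image_mono hUS)))

/-- The closed rectangle `[a, b] × [c, d]`. -/
def rect (a b c d : ℤ) : Set ℂ := {z | (a ≤ z.re ∧ z.re ≤ b) ∧ c ≤ z.im ∧ z.im ≤ d}

/-- The open rectangle `(a, b) × (c, d)`. -/
def recto (a b c d : ℤ) : Set ℂ := {z | (a < z.re ∧ z.re < b) ∧ c < z.im ∧ z.im < d}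

theorem rect_isCompact (a b c d : ℤ) : IsCompact (rect a b c d) := by
  have : rect a b c d = Icc (a : ℝ) b ×ℂ Icc (c : ℝ) d := by
    ext; simp [rect, Complex.mem_reProdIm]
  rw [this]
  exact isCompact_Icc.reProdIm isCompact_Icc

theorem recto_isOpen (a b c d : ℤ) : IsOpen (recto a b c d) := by
  apply IsOpen.inter <;> apply IsOpen.inter
  · exact isOpen_lt continuous_const Complex.continuous_re
  · exact isOpen_lt Complex.continuous_re continuous_const
  · exact isOpen_lt continuous_const Complex.continuous_im
  · exact isOpen_lt Complex.continuous_im continuous_const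

theorem recto_subset_rect (a b c d : ℤ) : recto a b c d ⊆ rect a b c d :=
  fun _ h => ⟨⟨h.1.1.le, h.1.2.le⟩, h.2.1.le, h.2.2.le⟩

theorem exists_unit {x : ℝ} {a b : ℤ} (hab : a ≠ b) (h1 : a ≤ x) (h2 : x ≤ b) :
    ∃ i, a ≤ i ∧ i + 1 ≤ b ∧ (i : ℝ) ≤ x ∧ x ≤ i + 1 := by
  have h : a ≤ b := by exact_mod_cast h1.trans h2
  rcases h2.eq_or_lt with h3 | h3
  · exact ⟨b - 1, by omega, by omega, by push_cast; linarith, by push_cast; linarith⟩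
  · exact ⟨⌊x⌋, Int.le_floor.2 h1, Int.floor_lt.2 h3, Int.floor_le x, (Int.lt_floor_add_one x).le⟩

namespace Mesh

variable (M : Mesh) (l : List (ℤ × ℤ × ℤ))

theorem lev_map_le {i j : ℤ} {z : ℂ} (hz : z ∈ box i j) {k : ℤ × ℤ × ℤ}
    (h1 : levZ k (M.V i j) ≤ 0) (h2 : levZ k (M.V (i + 1) j) ≤ 0) (h3 : levZ k (M.V i (j + 1)) ≤ 0)
    (h4 : levZ k (M.V (i + 1) (j + 1)) ≤ 0) (h5 : levZ k (M.C i j) ≤ 0) : lev k (M.map z) ≤ 0 := by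
  have hq : ∀ p q : ℤ × ℤ, ∀ r c d : ℝ, levZ k p ≤ 0 → levZ k q ≤ 0 → levZ k (M.C i j) ≤ 0 →
      0 ≤ c → 0 ≤ d → c + d ≤ 1 →
      lev k (toC (M.C i j) + c * toC (p - M.C i j) + d * toC (q - M.C i j)) ≤ 0 := by
    intro p q _ c d hp hq hC hc hd hcd
    have e : lev k (toC (M.C i j) + c * toC (p - M.C i j) + d * toC (q - M.C i j))
        = (1 - c - d) * levZ k (M.C i j) + c * levZ k p + d * levZ k q := by
      simp [lev, levZ]; ring
    rw [e]
    have hp' : (levZ k p : ℝ) ≤ 0 := by exact_mod_cast hp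
    have hq' : (levZ k q : ℝ) ≤ 0 := by exact_mod_cast hq
    have hC' : (levZ k (M.C i j) : ℝ) ≤ 0 := by exact_mod_cast hC
    nlinarith [mul_nonneg hc (neg_nonneg.2 hp'), mul_nonneg hd (neg_nonneg.2 hq'),
      mul_nonneg (by linarith : 0 ≤ 1 - c - d) (neg_nonneg.2 hC')]
  obtain ⟨⟨b1, b2⟩, b3, b4⟩ := id hz
  rcases le_total 0 (cp i j z) with hp | hp <;> rcases le_total 0 (cd i j z) with hd | hd
  · rw [M.map_tri (p := true) (d := true) ⟨hz, by simpa using hp, by simpa using hd⟩]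
    exact hq _ _ 0 _ _ h4 h2 h5 hp hd (by simp only [cp, cd]; linarith)
  · rw [M.map_tri (p := true) (d := false) ⟨hz, by simpa using hp, by simpa using hd⟩]
    have := hq _ _ 0 _ (-cd i j z) h4 h3 h5 hp (by linarith) (by simp only [cp, cd]; linarith)
    refine le_of_eq_of_le (congrArg _ ?_) this
    simp only [sP, sD, toC_sub]; push_cast; simp only [toC_sub]; ring
  · rw [M.map_tri (p := false) (d := true) ⟨hz, by simpa using hp, by simpa using hd⟩]
    have := hq _ _ 0 (-cp i j z) _ h1 h2 h5 (by linarith) hd (by simp only [cp, cd]; linarith)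
    refine le_of_eq_of_le (congrArg _ ?_) this
    simp only [sP, sD, toC_sub]; push_cast; simp only [toC_sub]; ring
  · rw [M.map_tri (p := false) (d := false) ⟨hz, by simpa using hp, by simpa using hd⟩]
    have := hq _ _ 0 (-cp i j z) (-cd i j z) h1 h3 h5 (by linarith) (by linarith)
      (by simp only [cp, cd]; linarith)
    refine le_of_eq_of_le (congrArg _ ?_) this
    simp only [sP, sD, toC_sub]; push_cast; simp only [toC_sub]; ring

theorem map_center (i j : ℤ) : M.map ⟨i + 1 / 2, j + 1 / 2⟩ = toC (M.C i j) := by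
  have hz : (⟨i + 1 / 2, j + 1 / 2⟩ : ℂ) ∈ tri i j true true := by
    refine ⟨⟨⟨?_, ?_⟩, ?_, ?_⟩, ?_, ?_⟩ <;> simp [cp, cd] <;> norm_num
  rw [M.map_tri hz]; simp [cp, cd]

theorem lev_map_horizontal {i j : ℤ} {z : ℂ} (h1 : (i : ℝ) ≤ z.re) (h2 : z.re ≤ i + 1)
    (h3 : z.im = j) {k : ℤ × ℤ × ℤ} (h : levZ k (M.V i j) = 0) (h' : levZ k (M.V (i + 1) j) = 0) :
    lev k (M.map z) = 0 := by
  have hz : z ∈ tri i j false true := by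
    refine ⟨⟨⟨h1, h2⟩, h3.ge, by linarith⟩, ?_, ?_⟩ <;> simp [cp, cd] <;> linarith
  rw [M.map_tri hz]
  have e : lev k (toC (M.C i j) + cp i j z * toC (M.sP i j false) + cd i j z * toC (M.sD i j true))
      = (1 + cp i j z - cd i j z) * levZ k (M.C i j) - cp i j z * levZ k (M.V i j)
        + cd i j z * levZ k (M.V (i + 1) j) := by
    simp [lev, levZ, sP, sD]; ring
  rw [e, h, h']
  have : 1 + cp i j z - cd i j z = 0 := by simp only [cp, cd]; linarith
  simp [this]

theorem lev_map_vertical {i j : ℤ} {z : ℂ} (h1 : (j : ℝ) ≤ z.im) (h2 : z.im ≤ j + 1)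
    (h3 : z.re = i) {k : ℤ × ℤ × ℤ} (h : levZ k (M.V i j) = 0) (h' : levZ k (M.V i (j + 1)) = 0) :
    lev k (M.map z) = 0 := by
  have hz : z ∈ tri i j false false := by
    refine ⟨⟨⟨h3.ge, by linarith⟩, h1, h2⟩, ?_, ?_⟩ <;> simp [cp, cd] <;> linarith
  rw [M.map_tri hz]
  have e : lev k (toC (M.C i j) + cp i j z * toC (M.sP i j false) + cd i j z * toC (M.sD i j false))
      = (1 + cp i j z + cd i j z) * levZ k (M.C i j) - cp i j z * levZ k (M.V i j)
        - cd i j z * levZ k (M.V i (j + 1)) := by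
    simp [lev, levZ, sP, sD]; ring
  rw [e, h, h']
  have : 1 + cp i j z + cd i j z = 0 := by simp only [cp, cd]; linarith
  simp [this]

/-- The mesh values on `rect a b c d` belong to the polygon. -/
def Inside (a b c d : ℤ) : Prop := ∀ i ∈ Finset.Icc a b, ∀ j ∈ Finset.Icc c d, ∀ k ∈ l,
  levZ k (M.V i j) ≤ 0 ∧ (i < b → j < d → levZ k (M.C i j) ≤ 0)

/-- The mesh values on the segment `[a, b] × {c}` belong to sides of the polygon. -/
def OnH (a b c : ℤ) : Prop := ∀ i ∈ Finset.Ico a b, ∃ k ∈ l,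
  levZ k (M.V i c) = 0 ∧ levZ k (M.V (i + 1) c) = 0

/-- The mesh values on the segment `{a} × [c, d]` belong to sides of the polygon. -/
def OnV (a c d : ℤ) : Prop := ∀ j ∈ Finset.Ico c d, ∃ k ∈ l,
  levZ k (M.V a j) = 0 ∧ levZ k (M.V a (j + 1)) = 0

instance (a b c d : ℤ) : Decidable (M.Inside l a b c d) := by unfold Inside; infer_instance
instance (a b c : ℤ) : Decidable (M.OnH l a b c) := by unfold OnH; infer_instance
instance (a b c : ℤ) : Decidable (M.OnV l a b c) := by unfold OnV; infer_instance

variable {M l}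

theorem Inside.map_mem {a b c d : ℤ} (h : M.Inside l a b c d) (hab : a ≠ b) (hcd : c ≠ d) {z : ℂ}
    (hz : z ∈ rect a b c d) : M.map z ∈ poly l := by
  obtain ⟨⟨h1, h2⟩, h3, h4⟩ := hz
  obtain ⟨i, i1, i2, i3, i4⟩ := exists_unit hab h1 h2
  obtain ⟨j, j1, j2, j3, j4⟩ := exists_unit hcd h3 h4
  intro k hk
  have m : ∀ i' j', a ≤ i' → i' ≤ b → c ≤ j' → j' ≤ d → levZ k (M.V i' j') ≤ 0 :=
    fun i' j' a1 a2 a3 a4 => (h i' (Finset.mem_Icc.2 ⟨a1, a2⟩) j' (Finset.mem_Icc.2 ⟨a3, a4⟩) k hk).1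
  exact M.lev_map_le ⟨⟨i3, i4⟩, j3, j4⟩ (m _ _ i1 (by omega) j1 (by omega))
    (m _ _ (by omega) i2 j1 (by omega)) (m _ _ i1 (by omega) (by omega) j2)
    (m _ _ (by omega) i2 (by omega) j2)
    ((h i (Finset.mem_Icc.2 ⟨i1, by omega⟩) j (Finset.mem_Icc.2 ⟨j1, by omega⟩) k hk).2
      (by omega) (by omega))

theorem OnH.exists_lev {a b c : ℤ} (h : M.OnH l a b c) (hab : a ≠ b) {z : ℂ} (h1 : a ≤ z.re)
    (h2 : z.re ≤ b) (h3 : z.im = c) : ∃ k ∈ l, lev k (M.map z) = 0 := by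
  obtain ⟨i, i1, i2, i3, i4⟩ := exists_unit hab h1 h2
  obtain ⟨k, hk, e, e'⟩ := h i (Finset.mem_Ico.2 ⟨i1, by omega⟩)
  exact ⟨k, hk, M.lev_map_horizontal i3 i4 h3 e e'⟩

theorem OnV.exists_lev {a c d : ℤ} (h : M.OnV l a c d) (hcd : c ≠ d) {z : ℂ} (h1 : c ≤ z.im)
    (h2 : z.im ≤ d) (h3 : z.re = a) : ∃ k ∈ l, lev k (M.map z) = 0 := by
  obtain ⟨i, i1, i2, i3, i4⟩ := exists_unit hcd h1 h2
  obtain ⟨k, hk, e, e'⟩ := h i (Finset.mem_Ico.2 ⟨i1, by omega⟩)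
  exact ⟨k, hk, M.lev_map_vertical i3 i4 h3 e e'⟩

variable (M l)

/-- The finite test for the mesh to map `rect 0 m 0 h` onto the polygon. -/
def RectTest (m h : ℤ) : Prop := M.Inside l 0 m 0 h ∧ M.OnH l 0 m 0 ∧ M.OnH l 0 m h ∧
  M.OnV l 0 0 h ∧ M.OnV l m 0 h ∧ ∀ k ∈ l, levZ k (M.C 0 0) < 0

/-- The finite test for the mesh to map the union of `rect 0 m 0 h` and `rect b e (-h) 0` onto the
polygon. -/
def StepTest (m h b e : ℤ) : Prop := (M.Inside l 0 m 0 h ∧ M.Inside l b e (-h) 0) ∧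
  (M.OnH l 0 m h ∧ M.OnV l 0 0 h ∧ M.OnV l m 0 h) ∧
  (M.OnH l b e (-h) ∧ M.OnV l b (-h) 0 ∧ M.OnV l e (-h) 0) ∧
  (M.OnH l 0 b 0 ∧ M.OnH l e m 0 ∧ M.OnH l b 0 0 ∧ M.OnH l m e 0) ∧
  ∀ k ∈ l, levZ k (M.C 0 0) < 0

instance (m h : ℤ) : Decidable (M.RectTest l m h) := by unfold RectTest; infer_instance
instance (m h b e : ℤ) : Decidable (M.StepTest l m h b e) := by unfold StepTest; infer_instance

variable {M l}

theorem RectTest.image_eq {m h : ℤ} (hm : 0 < m) (hh : 0 < h) (ht : M.RectTest l m h)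
    (f : ℂ ≃ₜ ℂ) (hf : ∀ z, f z = M.map z) : f '' rect 0 m 0 h = poly l := by
  obtain ⟨t1, t2, t3, t4, t5, t6⟩ := ht
  have hm' : (1 : ℝ) ≤ m := by exact_mod_cast hm
  have hh' : (1 : ℝ) ≤ h := by exact_mod_cast hh
  have hc : f ⟨((0 : ℤ) : ℝ) + 1 / 2, ((0 : ℤ) : ℝ) + 1 / 2⟩ ∈ polyo l := by
    intro k hk
    rw [hf, M.map_center, lev_toC]
    exact_mod_cast t6 k hk
  refine image_eq_poly f (rect_isCompact _ _ _ _) (recto_isOpen _ _ _ _) (recto_subset_rect _ _ _ _)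
    (fun z hz => ?_) (fun z hz => ?_) ?_ hc
  · rw [hf]; exact t1.map_mem hm.ne hh.ne hz
  · rw [hf]
    obtain ⟨⟨h1, h2⟩, h3, h4⟩ := hz
    rcases h1.eq_or_lt with e1 | e1
    · exact Or.inr (t4.exists_lev hh.ne h3 h4 e1.symm)
    rcases h2.eq_or_lt with e2 | e2
    · exact Or.inr (t5.exists_lev hh.ne h3 h4 e2)
    rcases h3.eq_or_lt with e3 | e3
    · exact Or.inr (t2.exists_lev hm.ne h1 h2 e3.symm)
    rcases h4.eq_or_lt with e4 | e4
    · exact Or.inr (t3.exists_lev hm.ne h1 h2 e4)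
    exact Or.inl ⟨⟨e1, e2⟩, e3, e4⟩
  · simp [rect]
    constructor <;> linarith

theorem StepTest.image_eq {m h b e : ℤ} (hm : 0 < m) (hh : 0 < h) (hbe : b < e) (hb : b ≠ 0)
    (he : e ≠ m) (ht : M.StepTest l m h b e)
    (f : ℂ ≃ₜ ℂ) (hf : ∀ z, f z = M.map z) :
    f '' (rect 0 m 0 h ∪ rect b e (-h) 0) = poly l := by
  obtain ⟨⟨s1, s2⟩, ⟨t1, t2, t3⟩, ⟨u1, u2, u3⟩, ⟨v1, v2, v3, v4⟩, t6⟩ := ht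
  have hm' : (1 : ℝ) ≤ m := by exact_mod_cast hm
  have hh' : (1 : ℝ) ≤ h := by exact_mod_cast hh
  have hc : f ⟨((0 : ℤ) : ℝ) + 1 / 2, ((0 : ℤ) : ℝ) + 1 / 2⟩ ∈ polyo l := by
    intro k hk
    rw [hf, M.map_center, lev_toC]
    exact_mod_cast t6 k hk
  have hneg : -h ≠ 0 := by omega
  refine image_eq_poly f ((rect_isCompact _ _ _ _).union (rect_isCompact _ _ _ _))
    (U := recto 0 m 0 h ∪ recto b e (-h) 0 ∪ (recto 0 m (-h) h ∩ recto b e (-h) h)) ?_ ?_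
    (fun z hz => ?_) (fun z hz => ?_) ?_ hc
  · exact ((recto_isOpen _ _ _ _).union (recto_isOpen _ _ _ _)).union
      ((recto_isOpen _ _ _ _).inter (recto_isOpen _ _ _ _))
  · rintro z ((hz | hz) | ⟨⟨⟨h1, h2⟩, h3, h4⟩, ⟨h5, h6⟩, -, -⟩)
    · exact Or.inl (recto_subset_rect _ _ _ _ hz)
    · exact Or.inr (recto_subset_rect _ _ _ _ hz)
    · rcases le_total 0 z.im with h0 | h0
      · exact Or.inl ⟨⟨h1.le, h2.le⟩, by simpa using h0, h4.le⟩
      · exact Or.inr ⟨⟨h5.le, h6.le⟩, h3.le, by simpa using h0⟩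
  · rw [hf]
    rcases hz with hz | hz
    · exact s1.map_mem hm.ne hh.ne hz
    · exact s2.map_mem hbe.ne hneg hz
  · rw [hf]
    have mid : ∀ z : ℂ, z.im = ((0 : ℤ) : ℝ) → ((0 : ℤ) : ℝ) < z.re → z.re < m → b < z.re → z.re < e →
        z ∈ recto 0 m (-h) h ∩ recto b e (-h) h := by
      intro z h0 h1 h2 h3 h4
      push_cast at h0
      exact ⟨⟨⟨h1, h2⟩, by push_cast; linarith, by linarith⟩, ⟨h3, h4⟩, by push_cast; linarith, by linarith⟩
    rcases hz with ⟨⟨h1, h2⟩, h3, h4⟩ | ⟨⟨h1, h2⟩, h3, h4⟩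
    · rcases h1.eq_or_lt with e1 | e1
      · exact Or.inr (t2.exists_lev hh.ne h3 h4 e1.symm)
      rcases h2.eq_or_lt with e2 | e2
      · exact Or.inr (t3.exists_lev hh.ne h3 h4 e2)
      rcases h4.eq_or_lt with e4 | e4
      · exact Or.inr (t1.exists_lev hm.ne h1 h2 e4)
      rcases h3.eq_or_lt with e3 | e3
      · rcases le_or_gt z.re b with h5 | h5
        · exact Or.inr (v1.exists_lev hb.symm h1 h5 e3.symm)
        rcases le_or_gt (e : ℝ) z.re with h6 | h6
        · exact Or.inr (v2.exists_lev he h6 h2 e3.symm)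
        exact Or.inl (Or.inr (mid z e3.symm e1 e2 h5 h6))
      exact Or.inl (Or.inl (Or.inl ⟨⟨e1, e2⟩, e3, e4⟩))
    · rcases h1.eq_or_lt with e1 | e1
      · exact Or.inr (u2.exists_lev hneg h3 h4 e1.symm)
      rcases h2.eq_or_lt with e2 | e2
      · exact Or.inr (u3.exists_lev hneg h3 h4 e2)
      rcases h3.eq_or_lt with e3 | e3
      · exact Or.inr (u1.exists_lev hbe.ne h1 h2 e3.symm)
      rcases h4.eq_or_lt with e4 | e4
      · rcases le_or_gt z.re ((0 : ℤ) : ℝ) with h5 | h5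
        · exact Or.inr (v3.exists_lev hb h1 h5 e4)
        rcases le_or_gt (m : ℝ) z.re with h6 | h6
        · exact Or.inr (v4.exists_lev he.symm h6 h2 e4)
        exact Or.inl (Or.inr (mid z e4 h5 h6 e1 e2))
      exact Or.inl (Or.inl (Or.inr ⟨⟨e1, e2⟩, e3, e4⟩))
  · left
    simp [rect]
    constructor <;> linarith

end Mesh

namespace Table

theorem val_add (T : Table) (hw : 0 < T.w) (hH : 0 < T.H) (l : List (ℤ × ℤ)) (k n i j : ℤ) :
    T.val l (i + (k * T.w + n * T.s)) (j + n * T.H)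
      = T.val l i j + (k * T.U.1 + n * T.W.1, k * T.U.2 + n * T.W.2) := by
  have hw' : (T.w : ℤ) ≠ 0 := by exact_mod_cast hw.ne'
  have hH' : (T.H : ℤ) ≠ 0 := by exact_mod_cast hH.ne'
  have e' : i + (k * T.w + n * T.s) - (j / T.H + n) * T.s = i - j / T.H * T.s + k * T.w := by ring
  simp only [val, Int.add_mul_emod_self_right, Int.add_mul_ediv_right _ _ hH', e',
    Int.add_mul_ediv_right _ _ hw']
  apply Prod.ext <;> simp <;> ring

theorem map_add (T : Table) (hw : 0 < T.w) (hH : 0 < T.H) (k n : ℤ) (z : ℂ) :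
    T.mesh.map (z + toC (k * T.w + n * T.s, n * T.H))
      = T.mesh.map z + toC (k * T.U.1 + n * T.W.1, k * T.U.2 + n * T.W.2) :=
  Mesh.map_add_of_periodic _ (T.val_add hw hH T.TV k n) (T.val_add hw hH T.TC k n) z

theorem sP_add (T : Table) (hw : 0 < T.w) (hH : 0 < T.H) (k n i j : ℤ) (p : Bool) :
    T.mesh.sP (i + (k * T.w + n * T.s)) (j + n * T.H) p = T.mesh.sP i j p := by
  have h := T.val_add hw hH
  have e : i + (k * T.w + n * T.s) + 1 = i + 1 + (k * T.w + n * T.s) := by ring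
  have e' : j + n * T.H + 1 = j + 1 + n * T.H := by ring
  simp only [Mesh.sP, mesh, e, e', h, add_sub_add_right_eq_sub]

theorem sD_add (T : Table) (hw : 0 < T.w) (hH : 0 < T.H) (k n i j : ℤ) (d : Bool) :
    T.mesh.sD (i + (k * T.w + n * T.s)) (j + n * T.H) d = T.mesh.sD i j d := by
  have h := T.val_add hw hH
  have e : i + (k * T.w + n * T.s) + 1 = i + 1 + (k * T.w + n * T.s) := by ring
  have e' : j + n * T.H + 1 = j + 1 + n * T.H := by ring
  simp only [Mesh.sD, mesh, e, e', h, add_sub_add_right_eq_sub]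

/-- The finite test for `a |P'|² ≥ b |Q'|²` on all triangles, for two interpolations `P`, `Q`. -/
def contractTest (P Q : Table) (a b : ℤ) : Bool :=
  allCells Q.w Q.H fun i j => both fun p => both fun d =>
    Mesh.dominates a b (P.mesh.sP i j p) (P.mesh.sD i j d) (Q.mesh.sP i j p) (Q.mesh.sD i j d)

theorem dominates_of_test {P Q : Table} {a b k n k' : ℤ} (hPw : 0 < P.w) (hPH : 0 < P.H)
    (hQw : 0 < Q.w) (hQH : 0 < Q.H) (h1 : (Q.w : ℤ) = k * P.w) (h2 : Q.s = k' * P.w + n * P.s)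
    (h3 : (Q.H : ℤ) = n * P.H) (h : contractTest P Q a b = true) (i j : ℤ) (p d : Bool) :
    Mesh.dominates a b (P.mesh.sP i j p) (P.mesh.sD i j d) (Q.mesh.sP i j p) (Q.mesh.sD i j d)
      = true := by
  refine lattice_induction (s := Q.s) (Φ := fun i j => Mesh.dominates a b (P.mesh.sP i j p)
    (P.mesh.sD i j d) (Q.mesh.sP i j p) (Q.mesh.sD i j d) = true) hQw hQH ?_ ?_ ?_ i j
  · intro i j
    have e1 := P.sP_add hPw hPH k 0 i j p
    have e2 := P.sD_add hPw hPH k 0 i j d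
    simp only [zero_mul, add_zero, ← h1] at e1 e2
    rw [e1, e2, Q.sP_add_left hQw, Q.sD_add_left hQw]
  · intro i j
    have e1 := P.sP_add hPw hPH k' n i j p
    have e2 := P.sD_add hPw hPH k' n i j d
    rw [← h2, ← h3] at e1 e2
    rw [e1, e2, Q.sP_add_right hQH, Q.sD_add_right hQH]
  · intro i j hi hj
    exact both_spec (both_spec (allCells_spec h hi hj) p) d

end Table

/-- Model of the plane, adapted to the tiling by the hexagon. -/
def domainTwo : Table where
  TV :=
    [(-550, 350), (550, -350), (-600, 800), (900, 1050)]
  TC :=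
    [(24, 636), (1043, 660), (276, 1214), (1257, 1190)]
  w := 2
  s := 0
  H := 2
  U := (2000, 0)
  W := (300, 1850)

/-- Model of the plane, adapted to the tiling by the expanded hexagon. -/
def targetTwo : Table where
  TV :=
    [(540, 990), (766, -182), (1234, 182), (1460, -990), (900, 1050), (1400, 800), (1450, 350),
    (2550, -350)]
  TC :=
    [(973, 755), (1307, 490), (1761, -32), (2351, -628), (1327, 1095), (1649, 628), (2239, 32),
    (2693, -490)]
  w := 4
  s := 2
  H := 2
  U := (1700, -1850)
  W := (2000, 0)

/-- The hexagon. -/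
def hexagonTwo : List (ℤ × ℤ × ℤ) :=
  [(-9, -1, 4600), (-1, 6, 5400), (1, 2, 3000), (9, 1, 13400), (7, -9, 7000), (-7, -11, 0)]

/-- Model of the plane, adapted to the tiling by the hexagon. -/
def domainThree : Table where
  TV :=
    [(-1350, 50), (-650, -50), (-1650, 1050), (-950, 1600)]
  TC :=
    [(-1153, 454), (19, 658), (-1447, 2196), (-619, 1992)]
  w := 2
  s := 0
  H := 2
  U := (2000, 0)
  W := (-600, 2650)

/-- Model of the plane, adapted to the tiling by the expanded hexagon. -/
def targetThree : Table where
  TV :=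
    [(-1146, 1446), (-1454, 1204), (-626, 504), (-364, -28), (364, 28), (626, -504), (-950, 1600),
    (-404, 1369), (-196, 1281), (350, 1050), (650, 50), (1350, -50)]
  TC :=
    [(-879, 1355), (-612, 1222), (-299, 599), (388, 294), (598, -142), (1316, -855), (-301, 2051),
    (12, 1428), (279, 1295), (684, 855), (1402, 142), (1612, -294)]
  w := 6
  s := 2
  H := 2
  U := (2600, -2650)
  W := (2000, 0)

/-- The hexagon. -/
def hexagonThree : List (ℤ × ℤ × ℤ) :=
  [(-10, -3, 13350), (-11, 14, 32850), (11, 26, 31150), (10, 3, 6650), (1, -13, 0), (-1, -7, 1000)]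

/-- Model of the plane, adapted to the tiling by the hexagon. -/
def domainFour : Table where
  TV :=
    [(-22500, 2000), (22500, -2000), (-28415, 12309), (-7900, 11249), (-40000, 32500), (-27000,
    38500), (-59100, 59751), (-38585, 58691)]
  TC :=
    [(-15244, 6674), (19551, 7209), (-27690, 25826), (3013, 21947), (-39310, 45174), (-20013,
    49053), (-51756, 64326), (-36551, 63791)]
  w := 2
  s := 0
  H := 4
  U := (50000, 0)
  W := (-67000, 71000)

/-- Model of the plane, adapted to the tiling by the expanded hexagon. -/
def targetFour : Table where
  TV :=
    [(-30718, 36784), (-11700, 1040), (-5490, 488), (-1710, 152), (1710, -152), (5490, -488),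
    (11700, -1040), (30718, -36784), (-29340, 37420), (-16891, 28552), (-4404, 11853), (3846,
    2846), (7641, 2315), (11177, 1546), (14580, -1296), (23092, -13310), (-27000, 38500), (-14050,
    36400), (-2950, 34600), (10000, 32500), (21515, 12431), (27500, 2000), (22500, -2000), (28485,
    -12431), (-20846, 68154), (-12596, 59147), (-109, 42448), (12340, 33580), (26908, 13310),
    (35420, 1296), (38823, -1546), (42359, -2315)]
  TC :=
    [(-23787, 32644), (-7174, 9070), (-849, 1690), (3015, 989), (6440, 761), (10228, 614), (17420,
    -7201), (34189, -32442), (-21102, 36330), (-6944, 29183), (2901, 22556), (12623, 7667),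
    (17546, 3443), (20955, 332), (21572, -7421), (32685, -24317), (-19901, 48444), (-10056,
    41817), (4102, 34670), (17315, 24317), (28428, 7421), (29045, -332), (32454, -3443), (37377,
    -7667), (-16151, 69310), (-9826, 61930), (6787, 38356), (15811, 32442), (32580, 7201), (39772,
    -614), (43560, -761), (46985, -989)]
  w := 8
  s := 4
  H := 4
  U := (67000, -71000)
  W := (50000, 0)

/-- The hexagon. -/
def hexagonFour : List (ℤ × ℤ × ℤ) :=
  [(-61, -35, 1302500), (-6, 13, 662500), (6, 37, 1262500), (61, 35, 1747500), (4, -5, 100000), (-4, -45, 0)]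

theorem domainTwo_tame : Tame domainTwo.mesh.map :=
  domainTwo.tame_of_test (a := 104) (b := 0) (c := 60) (d := 107) (N := 10000000) (by decide)
    (by decide) (by decide) (by decide) (by decide +kernel)

theorem targetTwo_tame : Tame targetTwo.mesh.map :=
  targetTwo.tame_of_test (a := 149) (b := 63) (c := -71) (d := 90) (N := 10000000) (by decide)
    (by decide) (by decide) (by decide) (by decide +kernel)

theorem domainThree_tame : Tame domainThree.mesh.map :=
  domainThree.tame_of_test (a := 103) (b := 0) (c := 63) (d := 148) (N := 10000000) (by decide)
    (by decide) (by decide) (by decide) (by decide +kernel)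

theorem targetThree_tame : Tame targetThree.mesh.map :=
  targetThree.tame_of_test (a := 48) (b := 91) (c := -175) (d := 35) (N := 10000000) (by decide)
    (by decide) (by decide) (by decide) (by decide +kernel)

theorem domainFour_tame : Tame domainFour.mesh.map :=
  domainFour.tame_of_test (a := 100) (b := 0) (c := 74) (d := 163) (N := 100000000000) (by decide)
    (by decide) (by decide) (by decide) (by decide +kernel)

theorem targetFour_tame : Tame targetFour.mesh.map :=
  targetFour.tame_of_test (a := 105) (b := 95) (c := -165) (d := 113) (N := 100000000000) (by decide)
    (by decide) (by decide) (by decide) (by decide +kernel)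

theorem domainTwo_rect : domainTwo.mesh.RectTest hexagonTwo 2 1 := by decide +kernel
theorem domainThree_rect : domainThree.mesh.RectTest hexagonThree 2 1 := by decide +kernel
theorem domainFour_rect : domainFour.mesh.RectTest hexagonFour 2 2 := by decide +kernel
theorem targetTwo_step : targetTwo.mesh.StepTest hexagonTwo 2 1 (-1) 1 := by decide +kernel
theorem targetThree_step : targetThree.mesh.StepTest hexagonThree 4 1 1 3 := by decide +kernel
theorem targetFour_step : targetFour.mesh.StepTest hexagonFour 6 2 (-1) 1 := by decide +kernel

theorem domainTwo_turn : domainTwo.turnTest 1 0 = true := by decide +kernel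
theorem domainThree_turn : domainThree.turnTest 3 0 = true := by decide +kernel
theorem domainFour_turn : domainFour.turnTest 1 0 = true := by decide +kernel
theorem targetTwo_turn : targetTwo.turnTest 1 (-2) = true := by decide +kernel
theorem targetThree_turn : targetThree.turnTest 7 0 = true := by decide +kernel
theorem targetFour_turn : targetFour.turnTest 7 0 = true := by decide +kernel

theorem contract_two : Table.contractTest domainTwo targetTwo 9 10 = true := by decide +kernel
theorem contract_three : Table.contractTest domainThree targetThree 9 10 = true := by decide +kernel
theorem contract_four : Table.contractTest domainFour targetFour 99 100 = true := by decide +kernel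

/-- The affine expansion `x ↦ M x + ((B - 1) / 2, 0)`. -/
def expand (A B : ℤ) (x : Pt) : Pt := ![((B : ℝ) - 1) / 2 - B * x 1, x 0 - A * x 1]

theorem crysEq_iff {A B : ℤ} {T : Set Pt} : CrysEq A B T ↔ expand A B '' T
    = (⋃ i ∈ Finset.Icc (0:ℤ) (B-2), (fun x => x + ![(i:ℝ), 0]) '' T) ∪ (-T) := by
  have : (fun x : Pt => (!![0, -(B:ℝ); 1, -(A:ℝ)]).mulVec x + ![((B:ℝ)-1)/2, 0]) = expand A B := by
    funext x
    ext i
    fin_cases i <;> simp [expand, dotProduct, Fin.sum_univ_two] <;> ring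
  rw [CrysEq, this]

theorem expand_continuous (A B : ℤ) : Continuous (expand A B) := by
  unfold expand
  refine continuous_pi fun i => ?_
  fin_cases i <;> simp <;> fun_prop

theorem subset_of_dist_le {α : Type*} [PseudoMetricSpace α] {X Y : Set α} (hY : IsClosed Y) {κ C : ℝ} (h0 : 0 ≤ κ)
    (h1 : κ < 1) (h : ∀ n : ℕ, ∀ x ∈ X, ∃ y ∈ Y, dist x y ≤ κ ^ n * C) : X ⊆ Y := by
  intro x hx
  rw [← hY.closure_eq]
  refine Metric.mem_closure_iff.2 fun ε hε => ?_
  have ht : Tendsto (fun n : ℕ => κ ^ n * C) atTop (𝓝 0) := by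
    simpa using (tendsto_pow_atTop_nhds_zero_of_lt_one h0 h1).mul_const C
  obtain ⟨n, hn⟩ := (ht.eventually (gt_mem_nhds hε)).exists
  obtain ⟨y, hy, hxy⟩ := h n x hx
  exact ⟨y, hy, hxy.trans_lt hn⟩

theorem eq_zero_of_le_mul {ι : Type*} {f : ι → ℝ} {σ : ι → ι} {κ C : ℝ} (h0 : 0 ≤ κ) (h1 : κ < 1)
    (hf : ∀ x, 0 ≤ f x) (hC : ∀ x, f x ≤ C) (h : ∀ x, f x ≤ κ * f (σ x)) (x : ι) : f x = 0 := by
  have key : ∀ n : ℕ, ∀ x, f x ≤ κ ^ n * C := by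
    intro n
    induction n with
    | zero => simpa using hC
    | succ n ih => intro x; rw [pow_succ', mul_assoc]
                   exact (h x).trans (mul_le_mul_of_nonneg_left (ih _) h0)
  have ht : Tendsto (fun n : ℕ => κ ^ n * C) atTop (𝓝 0) := by
    simpa using (tendsto_pow_atTop_nhds_zero_of_lt_one h0 h1).mul_const C
  exact le_antisymm (ge_of_tendsto' ht fun n => key n x) (hf x)

/-- The union of translates and a half-turned copy on the right-hand side of the set equation. -/
def pieces (n : ℤ) (F : ℂ) (X : Set ℂ) : Set ℂ :=
  (⋃ i ∈ Finset.Icc (0 : ℤ) (n - 2), (fun w => w + i * F) '' X) ∪ -X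

theorem mem_pieces {n : ℤ} {F : ℂ} {X : Set ℂ} {w : ℂ} : w ∈ pieces n F X ↔
    (∃ i : ℤ, (0 ≤ i ∧ i ≤ n - 2) ∧ ∃ x ∈ X, w = x + i * F) ∨ ∃ x ∈ X, w = -x := by
  simp only [pieces, mem_union, mem_iUnion, Finset.mem_Icc, mem_image, Set.mem_neg, exists_prop]
  refine or_congr ?_ ?_
  · simp only [eq_comm]
  · exact ⟨fun h => ⟨_, h, (neg_neg w).symm⟩, by rintro ⟨x, hx, rfl⟩; simpa using hx⟩

theorem eq_of_image_pieces {G : ℂ → ℂ} {κ : ℝ} (h0 : 0 ≤ κ) (h1 : κ < 1)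
    (hG : ∀ w w', ‖G w' - G w‖ ≤ κ * ‖w' - w‖) {n : ℤ} {F : ℂ} {X Y : Set ℂ} (hX : IsCompact X)
    (hY : IsCompact Y) (hYne : Y.Nonempty) (eX : G '' pieces n F X = X)
    (eY : G '' pieces n F Y = Y) : X ⊆ Y := by
  obtain ⟨y₀, hy₀⟩ := hYne
  obtain ⟨C, hC⟩ := hX.isBounded.subset_closedBall y₀
  refine subset_of_dist_le hY.isClosed h0 h1 (C := C) fun n => ?_
  induction n with
  | zero => intro x hx; exact ⟨y₀, hy₀, by simpa using hC hx⟩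
  | succ m ih =>
    intro x hx
    have step : ∀ w w', dist w w' ≤ κ ^ m * C → dist (G w) (G w') ≤ κ ^ (m + 1) * C := by
      intro w w' h
      rw [dist_eq_norm] at h ⊢
      rw [pow_succ', mul_assoc]
      exact (hG _ _).trans (mul_le_mul_of_nonneg_left h h0)
    rw [← eX] at hx
    obtain ⟨w, hw, rfl⟩ := hx
    rcases mem_pieces.1 hw with ⟨i, hi, x, hx, rfl⟩ | ⟨x, hx, rfl⟩
    · obtain ⟨y, hy, hxy⟩ := ih x hx
      refine ⟨G (y + i * F), ?_, step _ _ (by simpa using hxy)⟩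
      rw [← eY]; exact ⟨_, mem_pieces.2 (Or.inl ⟨i, hi, y, hy, rfl⟩), rfl⟩
    · obtain ⟨y, hy, hxy⟩ := ih x hx
      refine ⟨G (-y), ?_, step _ _ (by simpa [dist_neg_neg] using hxy)⟩
      rw [← eY]; exact ⟨_, mem_pieces.2 (Or.inr ⟨y, hy, rfl⟩), rfl⟩

section Model

variable {B : ℤ} {G : ℂ → ℂ} {κ : ℝ} {F₁ F₂ : ℂ}

/-- The linear map sending the standard basis to `F₁`, `F₂`. -/
def frame (F₁ F₂ : ℂ) (x : Pt) : ℂ := x 0 * F₁ + x 1 * F₂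

theorem frame_continuous : Continuous (frame F₁ F₂) := by
  unfold frame; fun_prop

theorem frame_add (x y : Pt) : frame F₁ F₂ (x + y) = frame F₁ F₂ x + frame F₁ F₂ y := by
  simp [frame]; ring

theorem frame_neg (x : Pt) : frame F₁ F₂ (-x) = -frame F₁ F₂ x := by
  simp [frame]; ring

theorem exists_frame_bound (hF : F₁.re * F₂.im - F₁.im * F₂.re ≠ 0) :
    ∃ K, 0 ≤ K ∧ ∀ x : Pt, |x 0| ≤ K * ‖frame F₁ F₂ x‖ ∧ |x 1| ≤ K * ‖frame F₁ F₂ x‖ := by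
  set D := F₁.re * F₂.im - F₁.im * F₂.re with hD
  have hD' : 0 < |D| := abs_pos.2 hF
  refine ⟨(2 * ‖F₁‖ + 2 * ‖F₂‖) / |D|, by positivity, fun x => ?_⟩
  have e0 : D * x 0 = (frame F₁ F₂ x).re * F₂.im - (frame F₁ F₂ x).im * F₂.re := by
    simp [frame, hD]; ring
  have e1 : D * x 1 = (frame F₁ F₂ x).im * F₁.re - (frame F₁ F₂ x).re * F₁.im := by
    simp [frame, hD]; ring
  generalize frame F₁ F₂ x = w at *
  have bound : ∀ a b c d : ℝ, |a| ≤ ‖w‖ → |b| ≤ ‖w‖ → ∀ y, |c| ≤ y → |d| ≤ y → 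
      |a * c - b * d| ≤ 2 * y * ‖w‖ := by
    intro a b c d ha hb y hc hd
    have h1 : |a * c| ≤ ‖w‖ * y := by rw [abs_mul]; gcongr
    have h2 : |b * d| ≤ ‖w‖ * y := by rw [abs_mul]; gcongr
    have := abs_sub (a * c) (b * d)
    linarith
  have h1 := Complex.abs_re_le_norm w
  have h2 := Complex.abs_im_le_norm w
  have h3 := bound _ _ _ _ h1 h2 _ (Complex.abs_im_le_norm F₂) (Complex.abs_re_le_norm F₂)
  have h4 := bound _ _ _ _ h2 h1 _ (Complex.abs_re_le_norm F₁) (Complex.abs_im_le_norm F₁)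
  rw [← e0, abs_mul] at h3
  rw [← e1, abs_mul] at h4
  have p1 := mul_nonneg (norm_nonneg F₁) (norm_nonneg w)
  have p2 := mul_nonneg (norm_nonneg F₂) (norm_nonneg w)
  constructor <;> rw [div_mul_eq_mul_div, le_div_iff₀ hD'] <;> nlinarith

theorem expand_add_int (B : ℤ) (x : Pt) (p q : ℤ) : expand (-2) B (x + ![(p : ℝ), q]) =
    expand (-2) B x + ![((-B * q : ℤ) : ℝ), ((p + 2 * q : ℤ) : ℝ)] := by
  ext i; fin_cases i <;> simp [expand] <;> ring

theorem shift_of_gen (h1 : ∀ w, G (w + B * F₁) = G w + (2 * F₁ - F₂))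
    (h2 : ∀ w, G (w + F₂) = G w + F₁) (w : ℂ) (p q : ℤ) :
    G (w + frame F₁ F₂ ![((-B * q : ℤ) : ℝ), ((p + 2 * q : ℤ) : ℝ)])
      = G w + frame F₁ F₂ ![(p : ℝ), q] := by
  have g1 : ∀ (n : ℤ) w, G (w + n * (B * F₁)) = G w + n * (2 * F₁ - F₂) := by
    intro n
    induction n using Int.induction_on with
    | zero => simp
    | succ n ih => 
      intro w; push_cast at ih ⊢; rw [add_mul, one_mul, ← add_assoc, h1, ih]; ring
    | pred n ih =>
      intro w; push_cast at ih ⊢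
      have := h1 (w + (-n - 1) * (B * F₁))
      rw [show w + (-n - 1) * (B * F₁) + B * F₁ = w + -n * (B * F₁) by ring, ih] at this
      rw [← sub_eq_iff_eq_add] at this
      rw [← this]; ring
  have g2 : ∀ (n : ℤ) w, G (w + n * F₂) = G w + n * F₁ := by
    intro n
    induction n using Int.induction_on with
    | zero => simp
    | succ n ih => 
      intro w; push_cast at ih ⊢; rw [add_mul, one_mul, ← add_assoc, h2, ih]; ring
    | pred n ih =>
      intro w; push_cast at ih ⊢
      have := h2 (w + (-n - 1) * F₂)
      rw [show w + (-n - 1) * F₂ + F₂ = w + -n * F₂ by ring, ih] at this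
      rw [← sub_eq_iff_eq_add] at this
      rw [← this]; ring
  have e : w + frame F₁ F₂ ![((-B * q : ℤ) : ℝ), ((p + 2 * q : ℤ) : ℝ)]
      = w + ((-q : ℤ) : ℂ) * (B * F₁) + ((p + 2 * q : ℤ) : ℂ) * F₂ := by
    simp [frame]; ring
  rw [e, g2, g1]
  simp [frame]; ring

theorem exists_conjugacy (h0 : 0 ≤ κ) (hκ : κ < 1) (hG : ∀ w w', ‖G w' - G w‖ ≤ κ * ‖w' - w‖)
    (h1 : ∀ w, G (w + B * F₁) = G w + (2 * F₁ - F₂)) (h2 : ∀ w, G (w + F₂) = G w + F₁) :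
    ∃ b : BoundedContinuousFunction Pt ℂ, ∀ x, frame F₁ F₂ x + b x
      = G (frame F₁ F₂ (expand (-2) B x) + b (expand (-2) B x)) := by
  lift κ to NNReal using h0
  have h0 : (0 : ℝ) ≤ κ := κ.2
  have hGc : Continuous G := (LipschitzWith.of_dist_le_mul (K := κ)
    (fun x y => by simpa [dist_eq_norm] using hG y x)).continuous
  set f : Pt → ℂ := fun x => G (frame F₁ F₂ (expand (-2) B x)) - frame F₁ F₂ x with hf
  have hfc : Continuous f := by
    exact (hGc.comp (frame_continuous.comp (expand_continuous _ _))).sub frame_continuous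
  have hper : ∀ (x : Pt) (p q : ℤ), f (x + ![(p : ℝ), q]) = f x := by
    intro x p q
    simp only [hf, expand_add_int, frame_add, shift_of_gen h1 h2]; ring
  obtain ⟨C, hC⟩ := (isCompact_Icc (a := (0 : Pt)) (b := 1)).exists_bound_of_continuousOn hfc.continuousOn
  have hC' : ∀ x, ‖f x‖ ≤ C := by
    intro x
    have e : x = ![Int.fract (x 0), Int.fract (x 1)] + ![((⌊x 0⌋ : ℤ) : ℝ), ((⌊x 1⌋ : ℤ) : ℝ)] := by
      ext i; fin_cases i <;> simp [Int.fract_add_floor]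
    rw [e, hper]
    refine hC _ ⟨fun i => ?_, fun i => ?_⟩ <;> fin_cases i <;>
      simp [Int.fract_nonneg, (Int.fract_lt_one _).le]
  have hbd : ∀ (b : BoundedContinuousFunction Pt ℂ) x,
      ‖G (frame F₁ F₂ (expand (-2) B x) + b (expand (-2) B x)) - frame F₁ F₂ x‖ ≤ C + κ * ‖b‖ := by
    intro b x
    have a1 := hG (frame F₁ F₂ (expand (-2) B x))
      (frame F₁ F₂ (expand (-2) B x) + b (expand (-2) B x))
    rw [add_sub_cancel_left] at a1
    have a2 := mul_le_mul_of_nonneg_left (b.norm_coe_le_norm (expand (-2) B x)) h0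
    have a3 := norm_add_le (G (frame F₁ F₂ (expand (-2) B x) + b (expand (-2) B x))
      - G (frame F₁ F₂ (expand (-2) B x))) (f x)
    simp only [hf, sub_add_sub_cancel] at a3
    have := hC' x
    simp only [hf] at this
    linarith
  let Φ : BoundedContinuousFunction Pt ℂ → BoundedContinuousFunction Pt ℂ := fun b =>
    BoundedContinuousFunction.ofNormedAddCommGroup
      (fun x => G (frame F₁ F₂ (expand (-2) B x) + b (expand (-2) B x)) - frame F₁ F₂ x)
      (by
        refine (hGc.comp ?_).sub frame_continuous
        exact (frame_continuous.comp (expand_continuous _ _)).add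
          (b.continuous.comp (expand_continuous _ _))) (C + κ * ‖b‖) (hbd b)
  have hΦ : ContractingWith κ Φ := by
    refine ⟨by exact_mod_cast hκ, LipschitzWith.of_dist_le_mul fun b b' => ?_⟩
    refine (BoundedContinuousFunction.dist_le (by positivity)).2 fun x => ?_
    have a1 := hG (frame F₁ F₂ (expand (-2) B x) + b' (expand (-2) B x))
      (frame F₁ F₂ (expand (-2) B x) + b (expand (-2) B x))
    rw [add_sub_add_left_eq_sub, ← dist_eq_norm (b _)] at a1
    have a2 := mul_le_mul_of_nonneg_left (BoundedContinuousFunction.dist_coe_le_dist (f := b)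
      (g := b') (expand (-2) B x)) h0
    rw [dist_eq_norm]
    simp only [Φ, BoundedContinuousFunction.coe_ofNormedAddCommGroup, sub_sub_sub_cancel_right]
    exact a1.trans a2
  refine ⟨hΦ.fixedPoint Φ, fun x => ?_⟩
  have := congrArg (fun g : BoundedContinuousFunction Pt ℂ => g x) hΦ.fixedPoint_isFixedPt
  simp only [Φ, BoundedContinuousFunction.coe_ofNormedAddCommGroup] at this
  exact (sub_eq_iff_eq_add'.1 this).symm

/-- A compact solution of the set equation is homeomorphic to any compact solution of a conjugate
equation that is given by a contraction. -/
theorem homeomorph_of_model (hB : 2 ≤ B) (h0 : 0 ≤ κ) (hκ : κ < 1)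
    (hG : ∀ w w', ‖G w' - G w‖ ≤ κ * ‖w' - w‖) (hGi : Function.Injective G)
    (hF : F₁.re * F₂.im - F₁.im * F₂.re ≠ 0)
    (h1 : ∀ w, G (w + B * F₁) = G w + (2 * F₁ - F₂)) (h2 : ∀ w, G (w + F₂) = G w + F₁)
    (h3 : ∀ w, G ((B - 1) * F₁ - w) = -G w) {H : Set ℂ} (hHc : IsCompact H) (hHne : H.Nonempty)
    (hH : G '' pieces B F₁ H = H) {T : Set Pt} (hTne : T.Nonempty) (hTc : IsCompact T)
    (hT : CrysEq (-2) B T) : Nonempty (T ≃ₜ H) := by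
  obtain ⟨b, hb⟩ := exists_conjugacy h0 hκ hG h1 h2
  set k : Pt → ℂ := fun x => frame F₁ F₂ x + b x with hk
  have hb' : ∀ x, k x = G (k (expand (-2) B x)) := hb
  have kc : Continuous k := frame_continuous.add b.continuous
  have kadd : ∀ (x : Pt) (p q : ℤ), k (x + ![(p : ℝ), q]) = k x + frame F₁ F₂ ![(p : ℝ), q] := by
    intro x p q
    have := eq_zero_of_le_mul (ι := Pt × ℤ × ℤ) (κ := κ) (C := ‖b‖ + ‖b‖)
      (f := fun y => ‖k (y.1 + ![(y.2.1 : ℝ), (y.2.2 : ℝ)]) - (k y.1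
        + frame F₁ F₂ ![(y.2.1 : ℝ), (y.2.2 : ℝ)])‖)
      (σ := fun y => (expand (-2) B y.1, -B * y.2.2, y.2.1 + 2 * y.2.2)) h0 hκ
      (fun _ => norm_nonneg _) ?_ ?_ (x, p, q)
    · exact sub_eq_zero.1 (norm_eq_zero.1 this)
    · rintro ⟨x, p, q⟩
      have : k (x + ![(p : ℝ), q]) - (k x + frame F₁ F₂ ![(p : ℝ), q])
          = b (x + ![(p : ℝ), q]) - b x := by
        simp only [hk, frame_add]; ring
      rw [this]
      exact (norm_sub_le _ _).trans (add_le_add (b.norm_coe_le_norm _) (b.norm_coe_le_norm _))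
    · rintro ⟨x, p, q⟩
      simp only
      rw [hb' (x + _), hb' x, ← shift_of_gen h1 h2, expand_add_int]
      exact hG _ _
  have kneg : ∀ x, k (-x) = -k x := by
    intro x
    have := eq_zero_of_le_mul (κ := κ) (C := ‖b‖ + ‖b‖) (f := fun x => ‖k (-x) - -k x‖)
      (σ := expand (-2) B) h0 hκ (fun _ => norm_nonneg _) ?_ ?_ x
    · exact sub_eq_zero.1 (norm_eq_zero.1 this)
    · intro x
      have : k (-x) - -k x = b (-x) + b x := by
        simp only [hk, frame_neg]; ring
      rw [this]
      exact (norm_add_le _ _).trans (add_le_add (b.norm_coe_le_norm _) (b.norm_coe_le_norm _))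
    · intro x
      have e : expand (-2) B (-x) = -expand (-2) B x + ![((B - 1 : ℤ) : ℝ), ((0 : ℤ) : ℝ)] := by
        ext i; fin_cases i <;> simp [expand] <;> ring
      have e2 : k (expand (-2) B (-x)) = k (-expand (-2) B x) + (B - 1) * F₁ := by
        rw [e, kadd]; simp [frame]
      rw [hb' (-x), hb' x, ← h3, e2]
      refine (hG _ _).trans (le_of_eq ?_)
      congr 2; ring
  have kinj : Function.Injective k := by
    intro x y hxy
    have hn : ∀ n : ℕ, k ((expand (-2) B)^[n] x) = k ((expand (-2) B)^[n] y) := by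
      intro n
      induction n with
      | zero => exact hxy
      | succ n ih => 
        rw [Function.iterate_succ_apply', Function.iterate_succ_apply']
        rw [hb', hb' ((expand (-2) B)^[n] y)] at ih
        exact hGi ih
    obtain ⟨K, hK, hKb⟩ := exists_frame_bound hF
    let N : Pt → ℝ := fun v => v 0 ^ 2 + 2 * (v 0 * v 1) + B * v 1 ^ 2
    have hB' : (2 : ℝ) ≤ B := by exact_mod_cast hB
    have hN : ∀ n : ℕ, N ((expand (-2) B)^[n] x - (expand (-2) B)^[n] y) = B ^ n * N (x - y) := by
      intro n
      induction n with
      | zero => simp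
      | succ n ih =>
        rw [Function.iterate_succ_apply', Function.iterate_succ_apply', pow_succ', mul_assoc, ← ih]
        simp [N, expand]; ring
    have hbd : ∀ n : ℕ, B ^ n * N (x - y) ≤ (B + 3) * (K * (‖b‖ + ‖b‖)) ^ 2 := by
      intro n
      rw [← hN]
      have e : frame F₁ F₂ ((expand (-2) B)^[n] x - (expand (-2) B)^[n] y)
          = b ((expand (-2) B)^[n] y) - b ((expand (-2) B)^[n] x) := by
        have := hn n
        simp only [hk] at this
        rw [sub_eq_add_neg, frame_add, frame_neg]
        linear_combination this
      have hs := (norm_sub_le (b ((expand (-2) B)^[n] y)) (b ((expand (-2) B)^[n] x))).trans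
        (add_le_add (b.norm_coe_le_norm _) (b.norm_coe_le_norm _))
      rw [← e] at hs
      obtain ⟨k1, k2⟩ := hKb ((expand (-2) B)^[n] x - (expand (-2) B)^[n] y)
      generalize (expand (-2) B)^[n] x - (expand (-2) B)^[n] y = v at *
      have hs' := mul_le_mul_of_nonneg_left hs hK
      have q1 := sq_le_sq' (abs_le.1 (k1.trans hs')).1 (abs_le.1 (k1.trans hs')).2
      have q2 := sq_le_sq' (abs_le.1 (k2.trans hs')).1 (abs_le.1 (k2.trans hs')).2
      simp only [N]
      nlinarith [sq_nonneg (v 0 - v 1), mul_le_mul_of_nonneg_left q2 (by linarith : (0 : ℝ) ≤ B)]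
    by_contra hne
    have hpos : 0 < N (x - y) := by
      have e : N (x - y) = ((x - y) 0 + (x - y) 1) ^ 2 + (B - 1) * (x - y) 1 ^ 2 := by
        simp only [N]; ring
      rw [e]
      by_contra hle
      have n1 := sq_nonneg ((x - y) 0 + (x - y) 1)
      have n2 : (x - y) 1 ^ 2 ≤ (B - 1) * (x - y) 1 ^ 2 :=
        le_mul_of_one_le_left (sq_nonneg _) (by linarith)
      have z1 : (x - y) 1 = 0 := by
        apply pow_eq_zero_iff (two_ne_zero) |>.1; nlinarith [sq_nonneg ((x - y) 1)]
      have z0 : (x - y) 0 + (x - y) 1 = 0 := by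
        apply pow_eq_zero_iff (two_ne_zero) |>.1; nlinarith [sq_nonneg ((x - y) 1)]
      apply hne
      rw [← sub_eq_zero]
      ext i; fin_cases i
      · simpa [z1] using z0
      · exact z1
    have ht : Tendsto (fun n : ℕ => (B : ℝ) ^ n * N (x - y)) atTop atTop :=
      (tendsto_pow_atTop_atTop_of_one_lt (by linarith)).atTop_mul_const hpos
    obtain ⟨n, hn⟩ := (ht.eventually_gt_atTop ((B + 3) * (K * (‖b‖ + ‖b‖)) ^ 2)).exists
    exact absurd (hbd n) (not_le.2 hn)
  have kT : G '' pieces B F₁ (k '' T) = k '' T := by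
    have e : pieces B F₁ (k '' T) = k '' (expand (-2) B '' T) := by
      rw [crysEq_iff.1 hT]
      ext w
      simp only [mem_pieces, mem_image, mem_union, mem_iUnion, Finset.mem_Icc, exists_prop,
        Set.mem_neg]
      have sh : ∀ (x : Pt) (i : ℤ), k (x + ![(i : ℝ), 0]) = k x + i * F₁ := by
        intro x i
        have := kadd x i 0
        simpa [frame] using this
      constructor
      · rintro (⟨i, hi, _, ⟨x, hx, rfl⟩, rfl⟩ | ⟨_, ⟨x, hx, rfl⟩, rfl⟩)
        · exact ⟨x + ![(i : ℝ), 0], Or.inl ⟨i, hi, x, hx, rfl⟩, sh x i⟩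
        · exact ⟨-x, Or.inr (by simpa using hx), kneg x⟩
      · rintro ⟨_, ⟨i, hi, x, hx, rfl⟩ | hx, rfl⟩
        · exact Or.inl ⟨i, hi, _, ⟨x, hx, rfl⟩, sh x i⟩
        · exact Or.inr ⟨_, ⟨_, hx, rfl⟩, by rw [kneg, neg_neg]⟩
    rw [e, image_image, image_image]
    simp only [← hb']
  have hTk : k '' T = H := Subset.antisymm
    (eq_of_image_pieces h0 hκ hG (hTc.image kc) hHc hHne kT hH)
    (eq_of_image_pieces h0 hκ hG hHc (hTc.image kc) (hTne.image k) hH kT)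
  have := isCompact_iff_compactSpace.1 hTc
  have hcont : Continuous (Equiv.Set.image k T kinj) := by
    exact Continuous.subtype_mk (kc.comp continuous_subtype_val) _
  exact ⟨(hcont.homeoOfEquivCompactToT2).trans (Homeomorph.setCongr hTk)⟩

end Model

theorem diskLike_of_homeomorph_convex {T : Set Pt} {H : Set ℂ} (hc : Convex ℝ H) (hK : IsCompact H)
    (hne : (interior H).Nonempty) (h : Nonempty (T ≃ₜ H)) : DiskLike T := by
  obtain ⟨h⟩ := h
  obtain ⟨g, -, hg, -⟩ :=
    exists_homeomorph_image_interior_closure_frontier_eq_unitBall hc hne hK.isBounded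
  rw [hK.isClosed.closure_eq] at hg
  have e : (Complex.orthonormalBasisOneI.repr.toHomeomorph) '' Metric.closedBall (0 : ℂ) 1
      = Metric.closedBall (0 : EuclideanSpace ℝ (Fin 2)) 1 := by
    simp
  exact ⟨h.trans ((g.image H).trans ((Homeomorph.setCongr hg).trans
    ((Complex.orthonormalBasisOneI.repr.toHomeomorph.image _).trans (Homeomorph.setCongr e))))⟩

theorem EvAff.unique {f : ℂ → ℂ} {z v u u' : ℂ} (h : EvAff f z v u) (h' : EvAff f z v u') :
    u = u' := by
  have h0 : ∀ᶠ t : ℝ in 𝓝[>] 0, f z + t * u = f z + t * u' := by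
    have := (h.and h').filter_mono (nhdsWithin_mono 0 Ioi_subset_Ici_self)
    filter_upwards [this] with t ht
    rw [← ht.1, ht.2]
  obtain ⟨t, ht, h1⟩ := (h0.and self_mem_nhdsWithin).exists
  have h2 : (t : ℂ) ≠ 0 := by exact_mod_cast (show (0 : ℝ) < t from h1).ne'
  exact mul_left_cancel₀ h2 (add_left_cancel ht)

/-- A lift of the expansion to the plane, with model `P` of the domain and model `Q` of the target,
shows that the tile is homeomorphic to `H`. -/
theorem diskLike_of_lift {B : ℤ} {T : Set Pt} {P Q : ℂ → ℂ} {F₁ F₂ e₁ e₂ o : ℂ} {κ : ℝ} {D R H : Set ℂ}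
    (hB : 2 ≤ B) (hP : Tame P) (hQc : Continuous Q) (hQi : Function.Injective Q)
    (h0 : 0 ≤ κ) (hκ : κ < 1) (hF : F₁.re * F₂.im - F₁.im * F₂.re ≠ 0)
    (hP1 : ∀ z, P (z + e₁) = P z + F₁) (hP2 : ∀ z, P (z + e₂) = P z + F₂)
    (hPo : ∀ z, P (o - z) = -P z)
    (hQ1 : ∀ z, Q (z + B * e₁) = Q z + (2 * F₁ - F₂)) (hQ2 : ∀ z, Q (z + e₂) = Q z + F₁)
    (hQo : ∀ z, Q (o + (B - 1) * e₁ - z) = -Q z)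
    (hE : ∀ z v u, EvAff P z v u → ∃ u', EvAff Q z v u' ∧ ‖u'‖ ≤ κ * ‖u‖)
    (hPD : P '' D = H) (hQR : Q '' R = H)
    (hR : ∀ z, z ∈ R ↔ (∃ i : ℤ, (0 ≤ i ∧ i ≤ B - 2) ∧ z - i * e₁ ∈ D) ∨ o - z ∈ D)
    (hK : IsCompact H) (hc : Convex ℝ H) (hne : (interior H).Nonempty)
    (hTne : T.Nonempty) (hTc : IsCompact T) (hT : CrysEq (-2) B T) : DiskLike T := by
  have ha : ∀ w, P (hP.homeo.symm w) = w := hP.apply_symm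
  have hi : ∀ z, hP.homeo.symm (P z) = z := hP.symm_apply
  have hPe : ∀ (i : ℤ) z, P (z + i * e₁) = P z + i * F₁ := by
    intro i
    induction i using Int.induction_on with
    | zero => simp
    | succ n ih =>
      intro z
      have := hP1 (z + n * e₁)
      have h2 := ih z
      push_cast at this h2 ⊢
      rw [show z + (n + 1) * e₁ = z + n * e₁ + e₁ by ring, this, h2]; ring
    | pred n ih =>
      intro z
      have h1 := hP1 (z + (-n - 1) * e₁)
      have h2 := ih z
      push_cast at h1 h2 ⊢
      rw [show z + (-n - 1) * e₁ + e₁ = z + -n * e₁ by ring, h2] at h1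
      rw [← add_right_cancel_iff (a := F₁), ← h1]; ring
  refine diskLike_of_homeomorph_convex hc hK hne
    (homeomorph_of_model (G := fun w => Q (hP.homeo.symm w)) (F₁ := F₁) (F₂ := F₂) hB h0 hκ
      (fun w w' => hP.lip_comp_symm hQc hE ..)
      (fun w w' h => hP.homeo.symm.injective (hQi h)) hF ?_ ?_ ?_ hK
      (hne.mono interior_subset) ?_ hTne hTc hT)
  · intro w
    obtain ⟨z, rfl⟩ := hP.bijective.2 w
    simp only [← hPe, hi, hQ1]
  · intro w
    obtain ⟨z, rfl⟩ := hP.bijective.2 w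
    simp only [← hP2, hi, hQ2]
  · intro w
    obtain ⟨z, rfl⟩ := hP.bijective.2 w
    have e : ((B : ℂ) - 1) * F₁ - P z = P (o + (B - 1) * e₁ - z) := by
      have := hPe (B - 1) (o - z)
      rw [hPo] at this
      push_cast at this
      rw [show o + (B - 1) * e₁ - z = o - z + (B - 1) * e₁ by ring, this]; ring
    simp only [e, hi, hQo]
  · have e : pieces B F₁ H = P '' R := by
      ext w
      rw [mem_pieces, ← hPD]
      constructor
      · rintro (⟨i, hib, _, ⟨z, hz, rfl⟩, rfl⟩ | ⟨_, ⟨z, hz, rfl⟩, rfl⟩)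
        · refine ⟨z + i * e₁, (hR _).2 (Or.inl ⟨i, hib, ?_⟩), hPe i z⟩
          simpa using hz
        · refine ⟨o - z, (hR _).2 (Or.inr ?_), hPo z⟩
          simpa using hz
      · rintro ⟨z, hz, rfl⟩
        rcases (hR z).1 hz with ⟨i, hib, h⟩ | h
        · refine Or.inl ⟨i, hib, _, ⟨_, h, rfl⟩, ?_⟩
          rw [← hPe]; congr 1; ring
        · refine Or.inr ⟨_, ⟨_, h, rfl⟩, ?_⟩
          rw [hPo, neg_neg]
    rw [e, ← image_comp]
    have : (fun w => Q (hP.homeo.symm w)) ∘ P = Q := by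
      funext z; simp [hi]
    rw [this, hQR]

theorem Mesh.slope_of_evAff {M : Mesh} {z v u : ℂ} {i j : ℤ} {p d : Bool} (h : EvAff M.map z v u)
    (ht : ∀ᶠ t : ℝ in 𝓝[≥] 0, z + t * v ∈ Mesh.tri i j p d) :
    u = Mesh.lin (M.sP i j p) (M.sD i j d) v :=
  h.unique (M.evAff_map ht)

theorem Table.evAff_contract {P Q : Table} {a b k n k' : ℤ} (hPw : 0 < P.w) (hPH : 0 < P.H)
    (hQw : 0 < Q.w) (hQH : 0 < Q.H) (h1 : (Q.w : ℤ) = k * P.w) (h2 : Q.s = k' * P.w + n * P.s)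
    (h3 : (Q.H : ℤ) = n * P.H) (h : contractTest P Q a b = true) (hb : 0 < b) {κ : ℝ} (hκ : 0 ≤ κ)
    (hκ2 : (a : ℝ) ≤ κ ^ 2 * b) {z v u : ℂ} (hu : EvAff P.mesh.map z v u) :
    ∃ u', EvAff Q.mesh.map z v u' ∧ ‖u'‖ ≤ κ * ‖u‖ := by
  obtain ⟨i, j, p, d, ht⟩ := Mesh.exists_tri z v
  refine ⟨_, Q.mesh.evAff_map ht, ?_⟩
  rw [Mesh.slope_of_evAff hu ht]
  exact Mesh.norm_le_of_dominates (dominates_of_test hPw hPH hQw hQH h1 h2 h3 h i j p d) hb hκ hκ2 _ _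

theorem poly_interior_nonempty {l : List (ℤ × ℤ × ℤ)} {p : ℤ × ℤ} (h : ∀ k ∈ l, levZ k p < 0) :
    (interior (poly l)).Nonempty := by
  refine ⟨toC p, interior_maximal (polyo_subset_poly l) (polyo_isOpen l) ?_⟩
  intro k hk
  rw [lev_toC]
  exact_mod_cast h k hk

theorem sqrt_bound (a b : ℤ) (ha : 0 ≤ a) (hb : 0 < b) (hab : a < b) :
    0 ≤ √((a : ℝ) / b) ∧ √((a : ℝ) / b) < 1 ∧ (a : ℝ) ≤ √((a : ℝ) / b) ^ 2 * b := by
  have hb' : (0 : ℝ) < b := by exact_mod_cast hb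
  have ha' : (0 : ℝ) ≤ a := by exact_mod_cast ha
  have hab' : (a : ℝ) < b := by exact_mod_cast hab
  refine ⟨Real.sqrt_nonneg _, ?_, ?_⟩
  · rw [Real.sqrt_lt' one_pos, one_pow, div_lt_one hb']; exact hab'
  · rw [Real.sq_sqrt (by positivity)]; field_simp; rfl

theorem Table.map_add_eq (T : Table) (hw : 0 < T.w) (hH : 0 < T.H) (k n : ℤ) {p F : ℂ}
    (hp : p = toC (k * T.w + n * T.s, n * T.H))
    (hF : F = toC (k * T.U.1 + n * T.W.1, k * T.U.2 + n * T.W.2)) (z : ℂ) :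
    T.mesh.map (z + p) = T.mesh.map z + F := by
  rw [hp, hF, T.map_add hw hH]

theorem Table.map_turn_eq (T : Table) (hw : 0 < T.w) (hH : 0 < T.H) {p : ℤ × ℤ}
    (h : T.turnTest p.1 p.2 = true) {q : ℂ} (hq : q = toC p) (z : ℂ) :
    T.mesh.map (q - z) = -T.mesh.map z := by
  rw [hq]; exact T.map_turn hw hH h z

theorem diskLike_two {T : Set Pt} (hTne : T.Nonempty) (hTc : IsCompact T)
    (hT : CrysEq (-2) 2 T) : DiskLike T := by
  obtain ⟨κ0, κ1, κ2⟩ := sqrt_bound 9 10 (by norm_num) (by norm_num) (by norm_num)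
  have hPD := domainTwo_rect.image_eq (by norm_num) (by norm_num) domainTwo_tame.homeo
      domainTwo_tame.homeo_apply
  have hQR := targetTwo_step.image_eq (by norm_num) (by norm_num) (by norm_num) (by norm_num)
      (by norm_num) targetTwo_tame.homeo targetTwo_tame.homeo_apply
  have hK : IsCompact (poly hexagonTwo) := by
    rw [← hPD]; exact (rect_isCompact _ _ _ _).image domainTwo_tame.homeo.continuous
  refine diskLike_of_lift (F₁ := toC (-300, -1850)) (F₂ := toC (1700, -1850)) (e₁ := toC (0, -2)) (e₂ := toC (2, -2))
    (o := toC (1, 0)) (by norm_num) domainTwo_tame targetTwo_tame.cont targetTwo_tame.bijective.1 κ0 κ1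
    (by norm_num [toC]) (domainTwo.map_add_eq (by decide) (by decide) 0 (-1) rfl rfl)
    (domainTwo.map_add_eq (by decide) (by decide) 1 (-1) rfl rfl)
    (domainTwo.map_turn_eq (p := (1, 0)) (by decide) (by decide) domainTwo_turn rfl)
    (targetTwo.map_add_eq (by decide) (by decide) 1 (-2) ?_ ?_)
    (targetTwo.map_add_eq (by decide) (by decide) 1 (-1) rfl rfl)
    (targetTwo.map_turn_eq (p := (1, -2)) (by decide) (by decide) targetTwo_turn ?_)
    (fun z v u hu => Table.evAff_contract (k := 2) (k' := 1) (n := 1) (by decide) (by decide)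
      (by decide) (by decide) (by decide) (by decide) (by decide) contract_two (by norm_num) κ0 κ2 hu)
    hPD hQR ?_ hK (poly_convex _) (poly_interior_nonempty (p := (1043, 660)) (by decide)) hTne hTc hT
  · apply Complex.ext <;> norm_num [toC, targetTwo]
  · apply Complex.ext <;> norm_num [toC, targetTwo]
  · apply Complex.ext <;> norm_num [toC]
  · intro z
    simp only [mem_union, rect, mem_ofPred_eq, Complex.sub_re, Complex.sub_im, toC]
    constructor
    · rintro (⟨⟨h1, h2⟩, h3, h4⟩ | ⟨⟨h1, h2⟩, h3, h4⟩)
      · refine Or.inl ⟨0, by norm_num, ?_⟩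
        norm_num at *
        exact ⟨⟨h1, h2⟩, h3, h4⟩
      · refine Or.inr ?_
        norm_num at *
        refine ⟨⟨?_, ?_⟩, ?_, ?_⟩ <;> linarith
    · rintro (⟨i, ⟨hi, hi'⟩, ⟨h1, h2⟩, h3, h4⟩ | ⟨⟨h1, h2⟩, h3, h4⟩)
      · obtain rfl : i = 0 := by omega
        refine Or.inl ?_
        norm_num at *
        exact ⟨⟨h1, h2⟩, h3, h4⟩
      · refine Or.inr ?_
        norm_num at *
        refine ⟨⟨?_, ?_⟩, ?_, ?_⟩ <;> linarith

theorem diskLike_three {T : Set Pt} (hTne : T.Nonempty) (hTc : IsCompact T)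
    (hT : CrysEq (-2) 3 T) : DiskLike T := by
  obtain ⟨κ0, κ1, κ2⟩ := sqrt_bound 9 10 (by norm_num) (by norm_num) (by norm_num)
  have hPD := domainThree_rect.image_eq (by norm_num) (by norm_num) domainThree_tame.homeo
      domainThree_tame.homeo_apply
  have hQR := targetThree_step.image_eq (by norm_num) (by norm_num) (by norm_num) (by norm_num)
      (by norm_num) targetThree_tame.homeo targetThree_tame.homeo_apply
  have hK : IsCompact (poly hexagonThree) := by
    rw [← hPD]; exact (rect_isCompact _ _ _ _).image domainThree_tame.homeo.continuous
  refine diskLike_of_lift (F₁ := toC (2000, 0)) (F₂ := toC (1400, 2650)) (e₁ := toC (2, 0)) (e₂ := toC (2, 2))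
    (o := toC (3, 0)) (by norm_num) domainThree_tame targetThree_tame.cont targetThree_tame.bijective.1 κ0 κ1
    (by norm_num [toC]) (domainThree.map_add_eq (by decide) (by decide) 1 0 rfl rfl)
    (domainThree.map_add_eq (by decide) (by decide) 1 1 rfl rfl)
    (domainThree.map_turn_eq (p := (3, 0)) (by decide) (by decide) domainThree_turn rfl)
    (targetThree.map_add_eq (by decide) (by decide) 1 0 ?_ ?_)
    (targetThree.map_add_eq (by decide) (by decide) 0 1 rfl rfl)
    (targetThree.map_turn_eq (p := (7, 0)) (by decide) (by decide) targetThree_turn ?_)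
    (fun z v u hu => Table.evAff_contract (k := 3) (k' := 1) (n := 1) (by decide) (by decide)
      (by decide) (by decide) (by decide) (by decide) (by decide) contract_three (by norm_num) κ0 κ2 hu)
    hPD hQR ?_ hK (poly_convex _) (poly_interior_nonempty (p := (-1153, 454)) (by decide)) hTne hTc hT
  · apply Complex.ext <;> norm_num [toC, targetThree]
  · apply Complex.ext <;> norm_num [toC, targetThree]
  · apply Complex.ext <;> norm_num [toC]
  · intro z
    simp only [mem_union, rect, mem_ofPred_eq, Complex.sub_re, Complex.sub_im, toC]
    constructor
    · rintro (⟨⟨h1, h2⟩, h3, h4⟩ | ⟨⟨h1, h2⟩, h3, h4⟩)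
      · rcases le_total z.re 2 with h | h
        · refine Or.inl ⟨0, by norm_num, ?_⟩
          norm_num at *
          refine ⟨⟨?_, ?_⟩, ?_, ?_⟩ <;> linarith
        · refine Or.inl ⟨1, by norm_num, ?_⟩
          norm_num at *
          refine ⟨⟨?_, ?_⟩, ?_, ?_⟩ <;> linarith
      · refine Or.inr ?_
        norm_num at *
        refine ⟨⟨?_, ?_⟩, ?_, ?_⟩ <;> linarith
    · rintro (⟨i, ⟨hi, hi'⟩, ⟨h1, h2⟩, h3, h4⟩ | ⟨⟨h1, h2⟩, h3, h4⟩)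
      · refine Or.inl ?_
        obtain rfl | rfl : i = 0 ∨ i = 1 := by omega
        all_goals
          norm_num at *
          refine ⟨⟨?_, ?_⟩, ?_, ?_⟩ <;> linarith
      · refine Or.inr ?_
        norm_num at *
        refine ⟨⟨?_, ?_⟩, ?_, ?_⟩ <;> linarith

/-- The piecewise affine bijection of the line that commutes with the passage from `2b` to `8`,
with slope `1` on `[-4, 3]` and slope `1 / (2b - 7)` on `[3, 2b - 4]`. -/
def fold (b x : ℝ) : ℝ :=
  8 * ⌊(x + 4) / (2 * b)⌋ + min (x - 2 * b * ⌊(x + 4) / (2 * b)⌋)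
    (3 + (x - 2 * b * ⌊(x + 4) / (2 * b)⌋ - 3) / (2 * b - 7))

section fold

variable {b : ℝ}

theorem fold_aux (hb : 4 ≤ b) {x : ℝ} {n : ℤ} (h1 : 2 * b * n - 4 ≤ x)
    (h2 : x ≤ 2 * b * n + (2 * b - 4)) :
    fold b x = 8 * n + min (x - 2 * b * n) (3 + (x - 2 * b * n - 3) / (2 * b - 7)) := by
  have hb' : 0 < 2 * b := by linarith
  have hq : 0 < 2 * b - 7 := by linarith
  have a1 : (n : ℝ) ≤ (x + 4) / (2 * b) := by rw [le_div_iff₀ hb']; linarith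
  have a2 : (x + 4) / (2 * b) ≤ n + 1 := by rw [div_le_iff₀ hb']; linarith
  rcases Mesh.floor_cases a1 a2 with h | ⟨h, h'⟩
  · rw [fold, h]
  · have hx : x = 2 * b * n + (2 * b - 4) := by
      rw [div_eq_iff hb'.ne'] at h'; linarith
    have e : (2 * b - 4 - 3) / (2 * b - 7) = 1 := by
      rw [div_eq_one_iff_eq hq.ne']; ring
    rw [fold, h, hx]
    push_cast
    rw [show 2 * b * n + (2 * b - 4) - 2 * b * (n + 1) = -4 by ring,
      show 2 * b * n + (2 * b - 4) - 2 * b * n = 2 * b - 4 by ring, e, min_eq_left, min_eq_right]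
    · ring
    · linarith
    · have : (-4 - 3) / (2 * b - 7) = -(7 / (2 * b - 7)) := by ring
      have h7 : 7 / (2 * b - 7) ≤ 7 := div_le_self (by norm_num) (by linarith)
      rw [this]; linarith

theorem fold_eq (hb : 4 ≤ b) {x : ℝ} {n : ℤ} (h1 : 2 * b * n - 4 ≤ x) (h2 : x ≤ 2 * b * n + 3) :
    fold b x = x + (8 - 2 * b) * n := by
  have hq : 0 < 2 * b - 7 := by linarith
  have : (x - 2 * b * n) ≤ 3 + (x - 2 * b * n - 3) / (2 * b - 7) := by
    have : (3 - (x - 2 * b * n)) / (2 * b - 7) ≤ 3 - (x - 2 * b * n) :=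
      div_le_self (by linarith) (by linarith)
    rw [← neg_sub, neg_div] at this
    linarith
  rw [fold_aux hb h1 (by linarith), min_eq_left this]; ring

theorem fold_eq' (hb : 4 ≤ b) {x : ℝ} {n : ℤ} (h1 : 2 * b * n + 3 ≤ x)
    (h2 : x ≤ 2 * b * n + (2 * b - 4)) :
    fold b x = 8 * n + 3 + (x - 2 * b * n - 3) / (2 * b - 7) := by
  have : 3 + (x - 2 * b * n - 3) / (2 * b - 7) ≤ (x - 2 * b * n) := by
    have : (x - 2 * b * n - 3) / (2 * b - 7) ≤ x - 2 * b * n - 3 :=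
      div_le_self (by linarith) (by linarith)
    linarith
  rw [fold_aux hb (by linarith) h2, min_eq_right this]; ring

theorem exists_strip (hb : 4 ≤ b) (x : ℝ) : ∃ n : ℤ, 2 * b * n - 4 ≤ x ∧ x < 2 * b * n + (2 * b - 4) := by
  have hb' : 0 < 2 * b := by linarith
  refine ⟨⌊(x + 4) / (2 * b)⌋, ?_, ?_⟩
  · have := Int.floor_le ((x + 4) / (2 * b))
    rw [le_div_iff₀ hb'] at this
    linarith
  · have := Int.lt_floor_add_one ((x + 4) / (2 * b))
    rw [div_lt_iff₀ hb'] at this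
    linarith

theorem fold_bounds (hb : 4 ≤ b) {x : ℝ} {n : ℤ} (h1 : 2 * b * n - 4 ≤ x)
    (h2 : x < 2 * b * n + (2 * b - 4)) : 8 * (n : ℝ) - 4 ≤ fold b x ∧ fold b x < 8 * n + 4 := by
  have hq : 0 < 2 * b - 7 := by linarith
  rcases le_total x (2 * b * n + 3) with h | h
  · rw [fold_eq hb h1 h]; constructor <;> linarith
  · rw [fold_eq' hb h h2.le]
    have a1 : 0 ≤ (x - 2 * b * n - 3) / (2 * b - 7) := div_nonneg (by linarith) hq.le
    have a2 : (x - 2 * b * n - 3) / (2 * b - 7) < 1 := by rw [div_lt_one hq]; linarith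
    constructor <;> linarith

theorem fold_strictMono (hb : 4 ≤ b) : StrictMono (fold b) := by
  have hq : 0 < 2 * b - 7 := by linarith
  intro x y hxy
  obtain ⟨n, h1, h2⟩ := exists_strip hb x
  obtain ⟨m, h3, h4⟩ := exists_strip hb y
  have hnm : n ≤ m := by
    have : 2 * b * n < 2 * b * (m + 1) := by linarith
    have : (n : ℝ) < m + 1 := lt_of_mul_lt_mul_left this (by linarith)
    exact Int.lt_add_one_iff.1 (by exact_mod_cast this)
  rcases hnm.eq_or_lt with rfl | hnm
  · rw [fold_aux hb h1 h2.le, fold_aux hb h3 h4.le]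
    refine add_lt_add_right (min_lt_min (by linarith) ?_) _
    gcongr
  · have b1 := (fold_bounds hb h1 h2).2
    have b2 := (fold_bounds hb h3 h4).1
    have : (n : ℝ) + 1 ≤ m := by exact_mod_cast hnm
    linarith

theorem fold_surjective (hb : 4 ≤ b) : Function.Surjective (fold b) := by
  intro c
  have hq : 0 < 2 * b - 7 := by linarith
  obtain ⟨n, h1, h2⟩ := exists_strip le_rfl c
  rcases le_total c (2 * 4 * n + 3) with h | h
  · refine ⟨c + (2 * b - 8) * n, ?_⟩
    rw [fold_eq hb (n := n) (by linarith) (by linarith)]; ring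
  · refine ⟨2 * b * n + 3 + (c - 8 * n - 3) * (2 * b - 7), ?_⟩
    rw [fold_eq' hb (n := n) (by nlinarith) (by nlinarith)]
    field_simp; ring

theorem fold_continuous (hb : 4 ≤ b) : Continuous (fold b) :=
  (fold_strictMono hb).monotone.continuous_of_surjective (fold_surjective hb)

theorem fold_add (hb : 4 ≤ b) (x : ℝ) : fold b (x + 2 * b) = fold b x + 8 := by
  have hb' : 2 * b ≠ 0 := by linarith
  have e : (x + 2 * b + 4) / (2 * b) = (x + 4) / (2 * b) + 1 := by field_simp; ring
  have e' : x + 2 * b - 2 * b * (⌊(x + 4) / (2 * b)⌋ + 1) = x - 2 * b * ⌊(x + 4) / (2 * b)⌋ := by ring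
  simp only [fold, e, Int.floor_add_one]
  push_cast
  rw [e']; ring

theorem fold_turn (hb : 4 ≤ b) (x : ℝ) : fold b (2 * b - 1 - x) = 7 - fold b x := by
  have hq : 0 < 2 * b - 7 := by linarith
  obtain ⟨n, h1, h2⟩ := exists_strip hb x
  rcases le_total x (2 * b * n + 3) with h | h
  · rw [fold_eq hb h1 h, fold_eq hb (n := 1 - n) (by push_cast; linarith) (by push_cast; linarith)]
    push_cast; ring
  · rw [fold_eq' hb h h2.le, fold_eq' hb (n := -n) (by push_cast; linarith) (by push_cast; linarith)]
    push_cast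
    field_simp; ring

end fold

/-- The map that folds the rows of the plane along diagonals. -/
def shear (b : ℝ) (z : ℂ) : ℂ := ⟨fold b (z.re - z.im) + z.im, z.im⟩

section shear

variable {b : ℝ}

theorem shear_continuous (hb : 4 ≤ b) : Continuous (shear b) := by
  have h : shear b = fun z => ((fold b (z.re - z.im) + z.im : ℝ) : ℂ) + (z.im : ℂ) * Complex.I := by
    funext z; apply Complex.ext <;> simp [shear]
  have := fold_continuous hb
  rw [h]
  fun_prop

theorem shear_injective (hb : 4 ≤ b) : Function.Injective (shear b) := by
  intro z w h
  have h1 := congrArg Complex.re h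
  have h2 := congrArg Complex.im h
  simp only [shear] at h1 h2
  rw [h2] at h1
  have h3 := (fold_strictMono hb).injective (add_right_cancel h1)
  exact Complex.ext (by linarith) h2

theorem shear_image (hb : 4 ≤ b) :
    shear b '' {z | ((0 ≤ z.re ∧ z.re ≤ 2 * b - 2) ∧ 0 ≤ z.im ∧ z.im ≤ 2) ∨
      ((-1 ≤ z.re ∧ z.re ≤ 1) ∧ -2 ≤ z.im ∧ z.im ≤ 0)} =
    rect 0 6 0 2 ∪ rect (-1) 1 (-2) 0 := by
  have hm := fold_strictMono hb
  have key : ∀ z : ℂ, shear b z ∈ rect 0 6 0 2 ∪ rect (-1) 1 (-2) 0 ↔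
      ((0 ≤ z.re ∧ z.re ≤ 2 * b - 2) ∧ 0 ≤ z.im ∧ z.im ≤ 2) ∨
      ((-1 ≤ z.re ∧ z.re ≤ 1) ∧ -2 ≤ z.im ∧ z.im ≤ 0) := by
    intro z
    simp only [mem_union, rect, mem_ofPred_eq, shear]
    norm_num
    refine or_congr (and_congr_left fun hy => ?_) (and_congr_left fun hy => ?_)
    · have a1 : fold b (-z.im) = -z.im := by
        rw [fold_eq hb (n := 0) (by push_cast; linarith) (by push_cast; linarith)]; simp
      have a2 : fold b (2 * b - 2 - z.im) = 6 - z.im := by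
        rw [fold_eq hb (n := 1) (by push_cast; linarith) (by push_cast; linarith)]; push_cast; ring
      refine and_congr ?_ ?_
      · rw [← neg_le_iff_add_nonneg, ← a1, hm.le_iff_le]; constructor <;> intro <;> linarith
      · rw [← le_sub_iff_add_le, ← a2, hm.le_iff_le]; constructor <;> intro <;> linarith
    · have a1 : fold b (-1 - z.im) = -1 - z.im := by
        rw [fold_eq hb (n := 0) (by push_cast; linarith) (by push_cast; linarith)]; simp
      have a2 : fold b (1 - z.im) = 1 - z.im := by
        rw [fold_eq hb (n := 0) (by push_cast; linarith) (by push_cast; linarith)]; simp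
      refine and_congr ?_ ?_
      · rw [← sub_le_iff_le_add, ← a1, hm.le_iff_le]; constructor <;> intro <;> linarith
      · rw [← le_sub_iff_add_le, ← a2, hm.le_iff_le]; constructor <;> intro <;> linarith
  ext w
  constructor
  · rintro ⟨z, hz, rfl⟩
    exact (key z).2 hz
  · intro hw
    obtain ⟨x, hx⟩ := fold_surjective hb (w.re - w.im)
    have e : shear b ⟨x + w.im, w.im⟩ = w := by
      apply Complex.ext <;> simp [shear, hx]
    exact ⟨⟨x + w.im, w.im⟩, (key _).1 (by rwa [e]), e⟩

end shear

theorem EvAff.comp {f g : ℂ → ℂ} {z v v' u : ℂ} (hg : EvAff g z v v') (hf : EvAff f (g z) v' u) :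
    EvAff (f ∘ g) z v u := by
  filter_upwards [hg, hf] with t h1 h2
  simp only [Function.comp, h1, h2]

namespace Table

/-- The finite test for the contraction along the compressed diagonal strips of `Q`, at any column
of `P`. -/
def stripTest : Bool :=
  allCells targetFour.w targetFour.H fun i j => both fun c => both fun p => both fun d =>
    both fun p' => both fun d' =>
      decide ((i - j) % 8 ∉ (if d then [2, 3, 4] else [3, 4, 5] : List ℤ)) ||
      (Mesh.dominates 99 100 (domainFour.mesh.sP (cond c 1 0) j p') (domainFour.mesh.sD (cond c 1 0) j d')
        (targetFour.mesh.sP i j p) (targetFour.mesh.sD i j d) &&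
      Mesh.dominates 99 100 (domainFour.mesh.sP (cond c 1 0) j p') (domainFour.mesh.sD (cond c 1 0) j d')
        (targetFour.mesh.sP i j p) (-targetFour.mesh.sP i j p))

theorem stripTest_true : stripTest = true := by decide +kernel

theorem domainFour_column (i j : ℤ) : ∃ c : Bool,
    (∀ p, domainFour.mesh.sP i j p = domainFour.mesh.sP (cond c 1 0) j p) ∧
    ∀ d, domainFour.mesh.sD i j d = domainFour.mesh.sD (cond c 1 0) j d := by
  have h1 : ∀ k i j p, domainFour.mesh.sP (i + k * 2) j p = domainFour.mesh.sP i j p := by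
    intro k i j p
    have := domainFour.sP_add (by decide) (by decide) k 0 i j p
    simpa [domainFour] using this
  have h2 : ∀ k i j p, domainFour.mesh.sD (i + k * 2) j p = domainFour.mesh.sD i j p := by
    intro k i j p
    have := domainFour.sD_add (by decide) (by decide) k 0 i j p
    simpa [domainFour] using this
  rcases Int.even_or_odd' i with ⟨k, rfl | rfl⟩
  · exact ⟨false, fun p => by have := h1 k 0 j p; rwa [zero_add, mul_comm] at this,
      fun p => by have := h2 k 0 j p; rwa [zero_add, mul_comm] at this⟩
  · exact ⟨true, fun p => by have := h1 k 1 j p; rwa [add_comm, mul_comm] at this,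
      fun p => by have := h2 k 1 j p; rwa [add_comm, mul_comm] at this⟩

theorem strip_dominates (i j i' : ℤ) (p d p' d' : Bool)
    (h : (i - j) % 8 ∈ (if d then [2, 3, 4] else [3, 4, 5] : List ℤ)) :
    Mesh.dominates 99 100 (domainFour.mesh.sP i' j p') (domainFour.mesh.sD i' j d')
        (targetFour.mesh.sP i j p) (targetFour.mesh.sD i j d) = true ∧
      Mesh.dominates 99 100 (domainFour.mesh.sP i' j p') (domainFour.mesh.sD i' j d')
        (targetFour.mesh.sP i j p) (-targetFour.mesh.sP i j p) = true := by
  obtain ⟨c, h1, h2⟩ := domainFour_column i' j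
  rw [h1, h2]
  revert h
  refine lattice_induction (w := 8) (H := 4) (s := 4) (Φ := fun i j =>
    (i - j) % 8 ∈ (if d then [2, 3, 4] else [3, 4, 5] : List ℤ) →
    Mesh.dominates 99 100 (domainFour.mesh.sP (cond c 1 0) j p') (domainFour.mesh.sD (cond c 1 0) j d')
        (targetFour.mesh.sP i j p) (targetFour.mesh.sD i j d) = true ∧
      Mesh.dominates 99 100 (domainFour.mesh.sP (cond c 1 0) j p') (domainFour.mesh.sD (cond c 1 0) j d')
        (targetFour.mesh.sP i j p) (-targetFour.mesh.sP i j p) = true) (by decide) (by decide)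
    ?_ ?_ ?_ i j
  · intro i j
    have e1 := targetFour.sP_add_left (by decide) i j p
    have e2 := targetFour.sD_add_left (by decide) i j d
    have e3 : (i + ((8 : ℕ) : ℤ) - j) % 8 = (i - j) % 8 := by omega
    change targetFour.mesh.sP (i + ((8 : ℕ) : ℤ)) j p = _ at e1
    change targetFour.mesh.sD (i + ((8 : ℕ) : ℤ)) j d = _ at e2
    rw [e1, e2, e3]
  · intro i j
    have e1 := targetFour.sP_add_right (by decide) i j p
    have e2 := targetFour.sD_add_right (by decide) i j d
    have e3 : (i + 4 - (j + ((4 : ℕ) : ℤ))) % 8 = (i - j) % 8 := by omega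
    change targetFour.mesh.sP (i + 4) (j + ((4 : ℕ) : ℤ)) p = _ at e1
    change targetFour.mesh.sD (i + 4) (j + ((4 : ℕ) : ℤ)) d = _ at e2
    have e4 : domainFour.mesh.sP (cond c 1 0) (j + ((4 : ℕ) : ℤ)) p' = domainFour.mesh.sP (cond c 1 0) j p' := by
      have := domainFour.sP_add_right (by decide) (cond c 1 0) j p'
      change domainFour.mesh.sP (cond c 1 0 + 0) (j + ((4 : ℕ) : ℤ)) p' = _ at this
      rwa [add_zero] at this
    have e5 : domainFour.mesh.sD (cond c 1 0) (j + ((4 : ℕ) : ℤ)) d' = domainFour.mesh.sD (cond c 1 0) j d' := by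
      have := domainFour.sD_add_right (by decide) (cond c 1 0) j d'
      change domainFour.mesh.sD (cond c 1 0 + 0) (j + ((4 : ℕ) : ℤ)) d' = _ at this
      rwa [add_zero] at this
    rw [e1, e2, e3, e4, e5]
  · intro i j hi hj hm
    have := both_spec (both_spec (both_spec (both_spec (both_spec
      (allCells_spec stripTest_true hi hj) c) p) d) p') d'
    simpa [hm] using this

end Table

theorem tri_add {i j m : ℤ} {p d : Bool} {z : ℂ} (h : z ∈ Mesh.tri i j p d) :
    z + toC (m, 0) ∈ Mesh.tri (i + m) j p d := by
  have e1 : Mesh.cp (i + m) j (z + toC (m, 0)) = Mesh.cp i j z := by simp [Mesh.cp]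
  have e2 : Mesh.cd (i + m) j (z + toC (m, 0)) = Mesh.cd i j z := by simp [Mesh.cd]
  obtain ⟨⟨⟨h1, h2⟩, h3, h4⟩, hp, hd⟩ := h
  refine ⟨⟨⟨?_, ?_⟩, ?_, ?_⟩, ?_, ?_⟩
  · simpa using h1
  · simp; linarith
  · simpa using h3
  · simpa using h4
  · rwa [e1]
  · rwa [e2]

theorem evAff_fold_rigid {B : ℤ} {κ : ℝ} (hκ : 0 ≤ κ)
    (hκ2 : ((99 : ℤ) : ℝ) ≤ κ ^ 2 * (100 : ℤ)) {z v u : ℂ} (hu : EvAff domainFour.mesh.map z v u) {n : ℤ}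
    (h : ∀ᶠ t : ℝ in 𝓝[≥] 0, shear B (z + t * v) = z + t * v + toC ((8 - 2 * B) * n, 0)) :
    ∃ u', EvAff (targetFour.mesh.map ∘ shear B) z v u' ∧ ‖u'‖ ≤ κ * ‖u‖ := by
  obtain ⟨i, j, p, d, ht⟩ := Mesh.exists_tri z v
  have hz : shear B z = z + toC ((8 - 2 * B) * n, 0) := by
    simpa using h.self_of_nhdsWithin (by simp)
  have hs : EvAff (shear B) z v v := by
    filter_upwards [h] with t h1
    rw [h1, hz]; ring
  have ht' : ∀ᶠ t : ℝ in 𝓝[≥] 0, shear B z + t * v ∈ Mesh.tri (i + (8 - 2 * B) * n) j p d := by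
    filter_upwards [ht] with t h1
    have := tri_add (m := (8 - 2 * B) * n) h1
    rwa [add_right_comm, ← hz] at this
  refine ⟨_, hs.comp (targetFour.mesh.evAff_map ht'), ?_⟩
  have e1 := domainFour.sP_add (by decide) (by decide) ((4 - B) * n) 0 i j p
  have e2 := domainFour.sD_add (by decide) (by decide) ((4 - B) * n) 0 i j d
  have e : i + ((4 - B) * n * domainFour.w + 0 * domainFour.s) = i + (8 - 2 * B) * n := by
    simp [domainFour]; ring
  rw [e, zero_mul, add_zero] at e1 e2
  rw [Mesh.slope_of_evAff hu ht, ← e1, ← e2]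
  exact Mesh.norm_le_of_dominates (Table.dominates_of_test (k := 4) (k' := 2) (n := 1) (by decide)
    (by decide) (by decide) (by decide) (by decide) (by decide) (by decide) contract_four
    (i + (8 - 2 * B) * n) j p d) (by norm_num) hκ hκ2 _ _

theorem evAff_fold_compress {b : ℝ} (hb : 4 ≤ b) {κ : ℝ} (hκ : 0 ≤ κ)
    (hκ2 : ((99 : ℤ) : ℝ) ≤ κ ^ 2 * (100 : ℤ)) {z v u : ℂ} (hu : EvAff domainFour.mesh.map z v u) {n : ℤ}
    (h : ∀ᶠ t : ℝ in 𝓝[≥] 0, 2 * b * n + 3 ≤ (z + t * v).re - (z + t * v).im ∧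
      (z + t * v).re - (z + t * v).im ≤ 2 * b * n + (2 * b - 4)) :
    ∃ u', EvAff (targetFour.mesh.map ∘ shear b) z v u' ∧ ‖u'‖ ≤ κ * ‖u‖ := by
  have hq : 0 < 2 * b - 7 := by linarith
  set s : ℝ := 1 / (2 * b - 7) with hs
  have hs0 : 0 ≤ s := by positivity
  have hs1 : s ≤ 1 := by rw [hs, div_le_one hq]; linarith
  set v' : ℂ := ⟨s * (v.re - v.im) + v.im, v.im⟩ with hv'
  have h' : ∀ᶠ t : ℝ in 𝓝[≥] 0, shear b (z + t * v) = ⟨8 * n + 3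
      + s * ((z + t * v).re - (z + t * v).im - 2 * b * n - 3) + (z + t * v).im, (z + t * v).im⟩ := by
    filter_upwards [h] with t h1
    simp only [shear, fold_eq' hb h1.1 h1.2, hs]
    apply Complex.ext
    · simp only; ring
    · rfl
  have h0 := h.self_of_nhdsWithin (by simp)
  have hz := h'.self_of_nhdsWithin (by simp)
  simp only [Complex.ofReal_zero, zero_mul, add_zero] at h0 hz
  have hS : EvAff (shear b) z v v' := by
    filter_upwards [h'] with t h1
    rw [h1, hz]
    apply Complex.ext
    · simp [hv']; ring
    · simp [hv']
  obtain ⟨j, hj⟩ := ray_floor z.im v.im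
  obtain ⟨i', hi'⟩ := ray_floor z.re v.re
  obtain ⟨i, hi⟩ := ray_floor (shear b z).re v'.re
  obtain ⟨p', d', ht'⟩ := Mesh.ray_tri hi' hj
  obtain ⟨p, d, ht⟩ := Mesh.ray_tri hi (show ∀ᶠ t : ℝ in 𝓝[≥] 0, (j : ℝ) ≤ (shear b z).im + t * v'.im ∧
    (shear b z).im + t * v'.im ≤ j + 1 from hj)
  have hmem : (i - j) % 8 ∈ (if d then [2, 3, 4] else [3, 4, 5] : List ℤ) := by
    have ht0 := ht.self_of_nhdsWithin (by simp)
    simp only [Complex.ofReal_zero, zero_mul, add_zero] at ht0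
    obtain ⟨⟨⟨h1, h2⟩, h3, h4⟩, -, hd⟩ := ht0
    have e : (shear b z).re - (shear b z).im = 8 * n + 3 + s * (z.re - z.im - 2 * b * n - 3) := by
      rw [hz]; simp only; ring
    have e1 : 0 ≤ s * (z.re - z.im - 2 * b * n - 3) := mul_nonneg hs0 (by linarith)
    have e2 : s * (z.re - z.im - 2 * b * n - 3) ≤ 1 := by
      rw [hs, one_div, inv_mul_le_iff₀ hq]; linarith
    unfold Mesh.cd at hd
    cases d
    · simp only [Bool.false_eq_true, if_false] at hd ⊢
      have k1 : (8 * n + 3 : ℝ) ≤ i - j := by linarith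
      have k2 : (i - j : ℝ) ≤ 8 * n + 5 := by linarith
      have k1' : 8 * n + 3 ≤ i - j := by exact_mod_cast k1
      have k2' : i - j ≤ 8 * n + 5 := by exact_mod_cast k2
      simp only [List.mem_cons, List.not_mem_nil]
      omega
    · simp only [if_true] at hd ⊢
      have k1 : (8 * n + 2 : ℝ) ≤ i - j := by linarith
      have k2 : (i - j : ℝ) ≤ 8 * n + 4 := by linarith
      have k1' : 8 * n + 2 ≤ i - j := by exact_mod_cast k1
      have k2' : i - j ≤ 8 * n + 4 := by exact_mod_cast k2
      simp only [List.mem_cons, List.not_mem_nil]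
      omega
  obtain ⟨D1, D2⟩ := Table.strip_dominates i j i' p d p' d' hmem
  refine ⟨_, hS.comp (targetFour.mesh.evAff_map ht), ?_⟩
  rw [Mesh.slope_of_evAff hu ht']
  have n1 := Mesh.norm_le_of_dominates D1 (by norm_num) hκ hκ2 (v.re + v.im) (v.re - v.im)
  have n2 := Mesh.norm_le_of_dominates D2 (by norm_num) hκ hκ2 (v.re + v.im) (v.re - v.im)
  set g := targetFour.mesh.sP i j p
  set k := targetFour.mesh.sD i j d
  have e : Mesh.lin g k v' = (s : ℂ) * (((v.re + v.im : ℝ) : ℂ) * toC g + ((v.re - v.im : ℝ) : ℂ) * toC k)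
      + ((1 - s : ℝ) : ℂ) * (((v.re + v.im : ℝ) : ℂ) * toC g + ((v.re - v.im : ℝ) : ℂ) * toC (-g)) := by
    simp only [Mesh.lin, hv', toC_neg]
    push_cast; ring
  rw [e]
  refine (norm_add_le _ _).trans ?_
  rw [norm_mul, norm_mul, Complex.norm_real, Complex.norm_real, Real.norm_of_nonneg hs0,
    Real.norm_of_nonneg (sub_nonneg.2 hs1)]
  unfold Mesh.lin
  nlinarith [mul_le_mul_of_nonneg_left n1 hs0, mul_le_mul_of_nonneg_left n2 (sub_nonneg.2 hs1)]

theorem evAff_fold {B : ℤ} (hB : 4 ≤ B) {κ : ℝ} (hκ : 0 ≤ κ)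
    (hκ2 : ((99 : ℤ) : ℝ) ≤ κ ^ 2 * (100 : ℤ)) (z v u : ℂ) (hu : EvAff domainFour.mesh.map z v u) :
    ∃ u', EvAff (targetFour.mesh.map ∘ shear B) z v u' ∧ ‖u'‖ ≤ κ * ‖u‖ := by
  have hb : (4 : ℝ) ≤ B := by exact_mod_cast hB
  have hb' : (0 : ℝ) < 2 * B := by linarith
  obtain ⟨n, hn⟩ := ray_floor ((z.re - z.im + 4) / (2 * B)) ((v.re - v.im) / (2 * B))
  have hn' : ∀ᶠ t : ℝ in 𝓝[≥] 0, 2 * (B : ℝ) * n - 4 ≤ (z + t * v).re - (z + t * v).im ∧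
      (z + t * v).re - (z + t * v).im ≤ 2 * B * n + (2 * B - 4) := by
    filter_upwards [hn] with t ht
    have e : (z.re - z.im + 4) / (2 * B) + t * ((v.re - v.im) / (2 * B))
      = ((z + t * v).re - (z + t * v).im + 4) / (2 * B) := by simp; ring
    rw [e, le_div_iff₀ hb', div_le_iff₀ hb'] at ht
    constructor <;> linarith [ht.1, ht.2]
  have e : ∀ t : ℝ, z.re - z.im - (2 * B * n + 3) + t * (v.re - v.im)
      = (z + t * v).re - (z + t * v).im - (2 * B * n + 3) := by intro t; simp; ring
  rcases ray_sign (z.re - z.im - (2 * B * n + 3)) (v.re - v.im) with h | h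
  · refine evAff_fold_compress hb hκ hκ2 hu (n := n) ?_
    filter_upwards [h, hn'] with t h1 h2
    rw [e] at h1
    exact ⟨by linarith, h2.2⟩
  · refine evAff_fold_rigid hκ hκ2 hu (n := n) ?_
    filter_upwards [h, hn'] with t h1 h2
    rw [e] at h1
    have := fold_eq hb h2.1 (by linarith)
    apply Complex.ext
    · simp only [shear, this]; simp; ring
    · simp [shear]

theorem diskLike_of_four_le {B : ℤ} (hB : 4 ≤ B) {T : Set Pt} (hTne : T.Nonempty) (hTc : IsCompact T)
    (hT : CrysEq (-2) B T) : DiskLike T := by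
  obtain ⟨κ0, κ1, κ2⟩ := sqrt_bound 99 100 (by norm_num) (by norm_num) (by norm_num)
  have hb : (4 : ℝ) ≤ B := by exact_mod_cast hB
  have hPD := domainFour_rect.image_eq (by norm_num) (by norm_num) domainFour_tame.homeo
      domainFour_tame.homeo_apply
  have hQR := targetFour_step.image_eq (by norm_num) (by norm_num) (by norm_num) (by norm_num)
      (by norm_num) targetFour_tame.homeo targetFour_tame.homeo_apply
  rw [← shear_image hb, ← image_comp] at hQR
  have hK : IsCompact (poly hexagonFour) := by
    rw [← hPD]; exact (rect_isCompact _ _ _ _).image domainFour_tame.homeo.continuous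
  have f1 : ∀ z, shear B (z + B * toC (2, 0)) = shear B z + toC (8, 0) := by
    intro z
    have := fold_add hb (z.re - z.im)
    have e : (z + B * toC (2, 0)).re - (z + B * toC (2, 0)).im = z.re - z.im + 2 * B := by
      simp; ring
    apply Complex.ext
    · simp only [shear, e, this]; simp; ring
    · simp [shear]
  have f2 : ∀ z, shear B (z + toC (4, 4)) = shear B z + toC (4, 4) := by
    intro z
    apply Complex.ext
    · simp [shear]; ring
    · simp [shear]
  have f3 : ∀ z, shear B (toC (1, 0) + (B - 1) * toC (2, 0) - z) = toC (7, 0) - shear B z := by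
    intro z
    have := fold_turn hb (z.re - z.im)
    have e : (toC (1, 0) + (B - 1) * toC (2, 0) - z).re - (toC (1, 0) + (B - 1) * toC (2, 0) - z).im
      = 2 * B - 1 - (z.re - z.im) := by
      simp; ring
    apply Complex.ext
    · simp only [shear, e, this]; simp; ring
    · simp [shear]
  have g1 := targetFour.map_add_eq (p := toC (8, 0)) (by decide) (by decide) 1 0 rfl rfl
  have g2 := targetFour.map_add_eq (p := toC (4, 4)) (by decide) (by decide) 0 1 rfl rfl
  have g3 := targetFour.map_turn_eq (p := (7, 0)) (by decide) (by decide) targetFour_turn rfl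
  refine diskLike_of_lift (F₁ := toC (50000, 0)) (F₂ := toC (33000, 71000)) (e₁ := toC (2, 0))
    (e₂ := toC (4, 4)) (o := toC (1, 0)) (Q := targetFour.mesh.map ∘ shear B) (by linarith)
    domainFour_tame (targetFour_tame.cont.comp (shear_continuous hb))
    (targetFour_tame.bijective.1.comp (shear_injective hb)) κ0 κ1
    (by norm_num [toC]) (domainFour.map_add_eq (by decide) (by decide) 1 0 rfl rfl)
    (domainFour.map_add_eq (by decide) (by decide) 2 1 rfl rfl)
    (domainFour.map_turn_eq (p := (1, 0)) (by decide) (by decide) domainFour_turn rfl)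
    ?_ ?_ ?_ (evAff_fold hB κ0 κ2) hPD hQR ?_ hK (poly_convex _)
    (poly_interior_nonempty (p := (-15244, 6674)) (by decide)) hTne hTc hT
  · intro z
    simp only [Function.comp, f1, g1]
    congr 1
    apply Complex.ext <;> norm_num [toC, targetFour]
  · intro z
    simp only [Function.comp, f2, g2]
    congr 1
  · intro z
    simp only [Function.comp, f3, g3]
  · intro z
    simp only [rect, mem_ofPred_eq, Complex.sub_re, Complex.sub_im, toC]
    constructor
    · rintro (⟨⟨h1, h2⟩, h3, h4⟩ | ⟨⟨h1, h2⟩, h3, h4⟩)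
      · left
        rcases lt_or_ge z.re (2 * B - 2) with h | h
        · have a1 := Int.floor_le (z.re / 2)
          have a2 := Int.lt_floor_add_one (z.re / 2)
          have a0 : 0 ≤ ⌊z.re / 2⌋ := Int.floor_nonneg.2 (by linarith)
          have a3 : ⌊z.re / 2⌋ < B - 1 := by
            rw [Int.floor_lt]; push_cast; linarith
          refine ⟨⌊z.re / 2⌋, ⟨a0, by omega⟩, ?_⟩
          simp
          refine ⟨⟨?_, ?_⟩, ?_, ?_⟩ <;> linarith
        · refine ⟨B - 2, ⟨by omega, le_rfl⟩, ?_⟩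
          simp
          refine ⟨⟨?_, ?_⟩, ?_, ?_⟩ <;> linarith
      · refine Or.inr ?_
        norm_num at *
        refine ⟨⟨?_, ?_⟩, ?_, ?_⟩ <;> linarith
    · rintro (⟨i, ⟨hi, hi'⟩, h⟩ | ⟨⟨h1, h2⟩, h3, h4⟩)
      · refine Or.inl ?_
        have b1 : (0 : ℝ) ≤ i := by exact_mod_cast hi
        have b2 : (i : ℝ) ≤ B - 2 := by exact_mod_cast hi'
        simp at h
        refine ⟨⟨?_, ?_⟩, ?_, ?_⟩ <;> linarith [h.1.1, h.1.2, h.2.1, h.2.2]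
      · refine Or.inr ?_
        norm_num at *
        refine ⟨⟨?_, ?_⟩, ?_, ?_⟩ <;> linarith

theorem diskLike_of_two_le {B : ℤ} (hB : 2 ≤ B) {T : Set Pt} (hTne : T.Nonempty) (hTc : IsCompact T)
    (hT : CrysEq (-2) B T) : DiskLike T := by
  rcases lt_or_ge B 4 with h | h
  · obtain rfl | rfl : B = 2 ∨ B = 3 := by omega
    · exact diskLike_two hTne hTc hT
    · exact diskLike_three hTne hTc hT
  · exact diskLike_of_four_le h hTne hTc hT

theorem ContractibleSpace.exists_circle_lift {X : Type*} [TopologicalSpace X]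
    [ContractibleSpace X] (f : C(X, Circle)) : ∃ θ : C(X, ℝ), ∀ x, Circle.exp (θ x) = f x := by
  obtain ⟨z, hz⟩ := (id_nullhomotopic X).comp_right f
  obtain ⟨H⟩ := hz.symm
  have h0 : ∀ a, H.toContinuousMap (0, a) = Circle.exp ((ContinuousMap.const X (Complex.arg z)) a) := by
    intro a
    simp
  let K := Circle.isCoveringMap_exp.liftHomotopy H.toContinuousMap _ h0
  refine ⟨⟨fun x => K (1, x), by fun_prop⟩, fun x => ?_⟩
  have := congr_fun (Circle.isCoveringMap_exp.liftHomotopy_lifts H.toContinuousMap _ h0) (1, x)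
  exact this.trans (by simp)

theorem IsPreconnected.eq_of_circle_exp_eq_one {X : Type*} [TopologicalSpace X] {S : Set X}
    (hS : IsPreconnected S) {g : X → ℝ} (hg : Continuous g) (h : ∀ x ∈ S, Circle.exp (g x) = 1)
    {x y : X} (hx : x ∈ S) (hy : y ∈ S) : g x = g y := by
  have hd : IsDiscrete (range ((↑) : ℤ → ℝ)) :=
    ⟨(Int.isClosedEmbedding_coe_real.isEmbedding.toHomeomorph.symm.isEmbedding).discreteTopology⟩
  have hm : MapsTo (fun x => g x / (2 * Real.pi)) S (range ((↑) : ℤ → ℝ)) := by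
    intro x hx
    obtain ⟨n, hn⟩ := Circle.exp_eq_one.1 (h x hx)
    exact ⟨n, by simp only [hn]; field_simp⟩
  have := hS.constant_of_mapsTo hd (by fun_prop) hm hx hy
  field_simp at this
  exact this

/-- A contractible normal space is unicoherent. -/
theorem ContractibleSpace.false_of_inter_eq_union {X : Type*} [TopologicalSpace X]
    [ContractibleSpace X] [NormalSpace X] {P Q S₁ S₂ : Set X}
    (hP : IsClosed P) (hQ : IsClosed Q) (hPc : IsPreconnected P) (hQc : IsPreconnected Q)
    (hPQ : P ∪ Q = univ) (h₁ : IsClosed S₁) (h₂ : IsClosed S₂) (hd : Disjoint S₁ S₂)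
    (hn₁ : S₁.Nonempty) (hn₂ : S₂.Nonempty) (hS : P ∩ Q = S₁ ∪ S₂) : False := by
  classical
  obtain ⟨u, hu0, hu1, -⟩ := exists_continuous_zero_one_of_isClosed h₁ h₂ hd
  have hpi : Circle.exp Real.pi = Circle.exp (-Real.pi) :=
    Circle.exp_eq_exp.2 ⟨1, by push_cast; ring⟩
  let F : X → Circle := fun x =>
    if x ∈ P then Circle.exp (Real.pi * u x) else Circle.exp (-(Real.pi * u x))
  have hFP : ∀ x ∈ P, F x = Circle.exp (Real.pi * u x) := fun x hx => if_pos hx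
  have hFQ : ∀ x ∈ Q, F x = Circle.exp (-(Real.pi * u x)) := by
    intro x hx
    by_cases hxP : x ∈ P
    · rw [hFP x hxP]
      have : x ∈ S₁ ∪ S₂ := hS ▸ ⟨hxP, hx⟩
      rcases this with h | h
      · simp [show u x = 0 from hu0 h]
      · simpa [show u x = 1 from hu1 h] using hpi
    · exact if_neg hxP
  have hF : Continuous F := by
    rw [← continuousOn_univ, ← hPQ]
    refine ContinuousOn.union_of_isClosed ?_ ?_ hP hQ
    · exact ContinuousOn.congr (f := fun x => Circle.exp (Real.pi * u x)) (by fun_prop) hFP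
    · exact ContinuousOn.congr (f := fun x => Circle.exp (-(Real.pi * u x))) (by fun_prop) hFQ
  obtain ⟨θ, hθ⟩ := ContractibleSpace.exists_circle_lift ⟨F, hF⟩
  obtain ⟨s, hs⟩ := hn₁
  obtain ⟨t, ht⟩ := hn₂
  have hs' : s ∈ P ∩ Q := hS ▸ Or.inl hs
  have ht' : t ∈ P ∩ Q := hS ▸ Or.inr ht
  have e1 := hPc.eq_of_circle_exp_eq_one (g := fun x => θ x - Real.pi * u x) (by fun_prop)
    (fun x hx => by rw [Circle.exp_sub, hθ]; simp [hFP x hx]) hs'.1 ht'.1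
  have e2 := hQc.eq_of_circle_exp_eq_one (g := fun x => θ x + Real.pi * u x) (by fun_prop)
    (fun x hx => by rw [Circle.exp_add, hθ]; simp [hFQ x hx]) hs'.2 ht'.2
  simp only [show u s = 0 from hu0 hs, show u t = 1 from hu1 ht] at e1 e2
  linarith [Real.pi_pos]

theorem DiskLike.contractibleSpace {T : Set Pt} (h : DiskLike T) : ContractibleSpace T := by
  obtain ⟨e⟩ := h
  have : ContractibleSpace (Metric.closedBall (0 : EuclideanSpace ℝ (Fin 2)) 1) :=
    (convex_closedBall _ _).contractibleSpace ⟨0, by simp⟩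
  exact e.contractibleSpace

theorem not_diskLike_of_inter_eq_union {T P Q S₁ S₂ : Set Pt}
    (hP : IsClosed P) (hQ : IsClosed Q) (hPc : IsPreconnected P) (hQc : IsPreconnected Q)
    (hPQ : P ∪ Q = T) (h₁ : IsClosed S₁) (h₂ : IsClosed S₂) (hd : Disjoint S₁ S₂)
    (hn₁ : S₁.Nonempty) (hn₂ : S₂.Nonempty) (hS : P ∩ Q = S₁ ∪ S₂) : ¬ DiskLike T := by
  intro hT
  have := hT.contractibleSpace
  have himg : ∀ S ⊆ T, ((↑) : T → Pt) '' ((↑) ⁻¹' S) = S := fun S hS => by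
    rw [Subtype.image_preimage_coe, inter_eq_right.2 hS]
  have hST : S₁ ∪ S₂ ⊆ T := hS ▸ inter_subset_left.trans (subset_union_left.trans hPQ.subset)
  have hpre : ∀ S ⊆ T, IsPreconnected S → IsPreconnected (((↑) : T → Pt) ⁻¹' S) := fun S hS h => by
    rw [← himg S hS] at h
    exact (Topology.IsInducing.subtypeVal.isPreconnected_image).1 h
  have hne : ∀ S ⊆ T, S.Nonempty → (((↑) : T → Pt) ⁻¹' S).Nonempty := by
    rintro S hS ⟨x, hx⟩
    exact ⟨⟨x, hS hx⟩, hx⟩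
  refine ContractibleSpace.false_of_inter_eq_union (X := T) (P := (↑) ⁻¹' P) (Q := (↑) ⁻¹' Q)
    (S₁ := (↑) ⁻¹' S₁) (S₂ := (↑) ⁻¹' S₂)
    (hP.preimage continuous_subtype_val) (hQ.preimage continuous_subtype_val)
    (hpre _ (hPQ ▸ subset_union_left) hPc) (hpre _ (hPQ ▸ subset_union_right) hQc) ?_
    (h₁.preimage continuous_subtype_val) (h₂.preimage continuous_subtype_val)
    (hd.preimage _) (hne _ (subset_union_left.trans hST) hn₁)
    (hne _ (subset_union_right.trans hST) hn₂) ?_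
  · rw [← preimage_union, hPQ]; simp
  · rw [← preimage_inter, hS, preimage_union]

theorem abs_le_one_of_step {a B N : ℤ} (ha : 3 ≤ a) (hB : 2 * a - 2 ≤ B) {Z : ℤ → ℤ → Prop}
    (hneg : ∀ p q, Z p q → Z (-p) (-q)) (hbd : ∀ p q, Z p q → q ≤ N)
    (hstep : ∀ p q, Z p q → ∃ δ, |δ| ≤ B - 1 ∧ Z (-B * q - δ) (p + a * q)) {p q : ℤ} (h : Z p q) :
    |q| ≤ 1 := by
  obtain ⟨Q, ⟨p₀, h₀⟩, hQ⟩ := Int.exists_greatest_of_bdd (P := fun q => ∃ p, Z p q)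
    ⟨N, fun q ⟨p, h⟩ => hbd p q h⟩ ⟨q, p, h⟩
  have hle : ∀ {p q}, Z p q → q ≤ Q ∧ -Q ≤ q := fun {p q} h =>
    ⟨hQ _ ⟨p, h⟩, by linarith [hQ _ ⟨-p, hneg _ _ h⟩]⟩
  obtain ⟨δ₀, hδ₀, h₁⟩ := hstep _ _ h₀
  obtain ⟨δ₁, hδ₁, h₂⟩ := hstep _ _ h₁
  obtain ⟨δ₂, hδ₂, h₃⟩ := hstep _ _ h₂
  obtain ⟨δ₃, hδ₃, h₄⟩ := hstep _ _ h₃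
  have b₁ := hle h₁
  have b₂ := hle h₂
  have b₃ := hle h₃
  have b₄ := hle h₄
  set q₁ := p₀ + a * Q with hq₁
  rw [abs_le] at hδ₀ hδ₁ hδ₂ hδ₃
  suffices Q ≤ 1 by
    have := hle h
    rw [abs_le]
    omega
  by_contra! hlt
  have key : a * B * Q = (a ^ 2 - B) * q₁ - a * δ₀ - δ₁ -
      (-B * q₁ - δ₁ + a * (-B * Q - δ₀ + a * q₁)) := by ring
  have hδ : -(a * δ₀) - δ₁ ≤ (a + 1) * (B - 1) := by nlinarith
  rcases le_or_gt B (a ^ 2) with hc | hc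
  · have h1 : (a ^ 2 - B) * q₁ ≤ (a ^ 2 - B) * Q :=
      mul_le_mul_of_nonneg_left b₁.1 (by linarith)
    have h2 : Q * (a * B - a ^ 2 + B - 1) ≤ (a + 1) * (B - 1) := by nlinarith
    have h3 : 0 < a * B - a ^ 2 + B - 1 := by nlinarith
    have h4 : 2 * (a * B - a ^ 2 + B - 1) ≤ (a + 1) * (B - 1) := by nlinarith
    have h5 : a ≤ 3 := by nlinarith
    obtain rfl : a = 3 := by omega
    obtain rfl : B = 4 := by omega
    omega
  · have h1 : (a ^ 2 - B) * q₁ ≤ (B - a ^ 2) * Q := by nlinarith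
    have h2 : Q * ((a - 1) * (B + a + 1)) ≤ (a + 1) * (B - 1) := by nlinarith
    have h3 : 2 * ((a - 1) * (B + a + 1)) ≤ Q * ((a - 1) * (B + a + 1)) :=
      mul_le_mul_of_nonneg_right (by omega) (by nlinarith)
    nlinarith

section steps

variable {a B : ℤ} {T : Set Pt}

theorem expand_neg_left (a B : ℤ) (x : Pt) :
    expand (-a) B x = ![((B : ℝ) - 1) / 2 - B * x 1, x 0 + a * x 1] := by
  simp [expand]

theorem expand_neg_apply (a B : ℤ) (x : Pt) :
    expand (-a) B (-x) = ![(B : ℝ) - 1, 0] - expand (-a) B x := by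
  simp only [expand_neg_left]
  ext i; fin_cases i <;> simp <;> ring

theorem expand_injective (hB : B ≠ 0) : Function.Injective (expand (-a) B) := by
  intro x y h
  simp only [expand_neg_left] at h
  have h0 := congr_fun h 0
  have h1 := congr_fun h 1
  have hB' : (B : ℝ) ≠ 0 := by exact_mod_cast hB
  simp at h0 h1
  have e1 : x 1 = y 1 := h0.resolve_right hB
  have e0 : x 0 = y 0 := by rw [e1] at h1; linarith
  ext i; fin_cases i <;> assumption

theorem expand_surjective (hB : B ≠ 0) : Function.Surjective (expand (-a) B) := by
  intro y
  have hB' : (B : ℝ) ≠ 0 := by exact_mod_cast hB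
  refine ⟨![y 1 - a * ((((B : ℝ) - 1) / 2 - y 0) / B), (((B : ℝ) - 1) / 2 - y 0) / B], ?_⟩
  rw [expand_neg_left]
  ext i; fin_cases i
  · simp; field_simp; ring
  · simp

theorem sub_intCast_zero (x : Pt) : x - ![((0 : ℤ) : ℝ), 0] = x := by
  ext i; fin_cases i <;> simp

theorem CrysEq.mem_iff (hB : B ≠ 0) (hT : CrysEq (-a) B T) (x : Pt) :
    x ∈ T ↔ expand (-a) B x ∈ -T ∨
      ∃ k : ℤ, 0 ≤ k ∧ k ≤ B - 2 ∧ expand (-a) B x - ![(k : ℝ), 0] ∈ T := by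
  rw [crysEq_iff] at hT
  rw [← (expand_injective (a := a) hB).mem_set_image, hT]
  simp only [mem_union, mem_iUnion, mem_image, Finset.mem_Icc, exists_prop]
  rw [or_comm]
  refine or_congr_right ⟨?_, ?_⟩
  · rintro ⟨k, ⟨h0, h1⟩, y, hy, e⟩
    exact ⟨k, h0, h1, by rwa [← e, add_sub_cancel_right]⟩
  · rintro ⟨k, h0, h1, h⟩
    exact ⟨k, ⟨h0, h1⟩, _, h, sub_add_cancel _ _⟩

theorem CrysEq.mem_neg_iff (hB : B ≠ 0) (hT : CrysEq (-a) B T) (x : Pt) :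
    x ∈ -T ↔ expand (-a) B x - ![((B - 1 : ℤ) : ℝ), 0] ∈ T ∨
      ∃ k : ℤ, 1 ≤ k ∧ k ≤ B - 1 ∧ expand (-a) B x - ![(k : ℝ), 0] ∈ -T := by
  rw [Set.mem_neg, hT.mem_iff hB, expand_neg_apply, Set.mem_neg]
  refine or_congr (by push_cast; rw [neg_sub]) ⟨?_, ?_⟩
  · rintro ⟨k, h0, h1, h⟩
    refine ⟨B - 1 - k, by omega, by omega, ?_⟩
    rw [Set.mem_neg]
    convert h using 1
    ext i; fin_cases i <;> simp
    ring
  · rintro ⟨k, h0, h1, h⟩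
    refine ⟨B - 1 - k, by omega, by omega, ?_⟩
    rw [Set.mem_neg] at h
    convert h using 1
    ext i; fin_cases i <;> simp

theorem CrysEq.exists_step (hB : B ≠ 0) (hB2 : 2 ≤ B) (hT : CrysEq (-a) B T) {x : Pt}
    (hx : x ∈ T ∪ -T) :
    ∃ k : ℤ, 0 ≤ k ∧ k ≤ B - 1 ∧ expand (-a) B x - ![(k : ℝ), 0] ∈ T ∪ -T := by
  rcases hx with hx | hx
  · rcases (hT.mem_iff hB x).1 hx with h | ⟨k, h0, h1, h⟩
    · exact ⟨0, le_rfl, by omega, Or.inr (by rwa [sub_intCast_zero])⟩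
    · exact ⟨k, h0, by omega, Or.inl h⟩
  · rcases (hT.mem_neg_iff hB x).1 hx with h | ⟨k, h0, h1, h⟩
    · exact ⟨B - 1, by omega, le_rfl, Or.inl h⟩
    · exact ⟨k, by omega, h1, Or.inr h⟩

theorem CrysEq.exists_step_of_mem (hB : B ≠ 0) (hT : CrysEq (-a) B T) {x : Pt} (hx : x ∈ T) :
    expand (-a) B x ∈ T ∪ -T ∨
      ∃ k : ℤ, 1 ≤ k ∧ k ≤ B - 2 ∧ expand (-a) B x - ![(k : ℝ), 0] ∈ T := by
  rcases (hT.mem_iff hB x).1 hx with h | ⟨k, h0, h1, h⟩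
  · exact Or.inl (Or.inr h)
  · rcases h0.eq_or_lt with rfl | h0
    · exact Or.inl (Or.inl (by rwa [sub_intCast_zero] at h))
    · exact Or.inr ⟨k, by omega, h1, h⟩

theorem CrysEq.mem_of_expand_mem (hB2 : 2 ≤ B) (hT : CrysEq (-a) B T) {x : Pt}
    (hx : expand (-a) B x ∈ T ∪ -T) : x ∈ T := by
  rw [hT.mem_iff (by omega)]
  rcases hx with h | h
  · exact Or.inr ⟨0, le_rfl, by omega, by rwa [sub_intCast_zero]⟩
  · exact Or.inl h

theorem CrysEq.mem_of_step (hB2 : 2 ≤ B) (hT : CrysEq (-a) B T) {x : Pt} {k : ℤ} (h0 : 0 ≤ k)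
    (h1 : k ≤ B - 2) (hx : expand (-a) B x - ![(k : ℝ), 0] ∈ T) : x ∈ T :=
  (hT.mem_iff (by omega) x).2 (Or.inr ⟨k, h0, h1, hx⟩)

theorem CrysEq.mem_neg_of_step (hB2 : 2 ≤ B) (hT : CrysEq (-a) B T) {x : Pt} {k : ℤ} (h0 : 1 ≤ k)
    (h1 : k ≤ B - 1) (hx : expand (-a) B x - ![(k : ℝ), 0] ∈ -T) : x ∈ -T :=
  (hT.mem_neg_iff (by omega) x).2 (Or.inr ⟨k, h0, h1, hx⟩)

/-- The difference of two points transforms linearly along expansion steps. -/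
theorem expand_step_sub {x y : Pt} {p q : ℤ} (h : x - y = ![(p : ℝ), (q : ℝ)]) (k l : ℤ) :
    (expand (-a) B x - ![(k : ℝ), 0]) - (expand (-a) B y - ![(l : ℝ), 0]) =
      ![((-B * q - (k - l) : ℤ) : ℝ), ((p + a * q : ℤ) : ℝ)] := by
  have h0 : x 0 - y 0 = p := by simpa using congr_fun h 0
  have h1 : x 1 - y 1 = q := by simpa using congr_fun h 1
  simp only [expand_neg_left]
  ext i; fin_cases i <;> simp [← h0, ← h1] <;> ring

theorem CrysEq.abs_le_one (ha : 3 ≤ a) (hB : 2 * a - 2 ≤ B) (hT : CrysEq (-a) B T)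
    (hTc : IsCompact T) {x y : Pt} (hx : x ∈ T ∪ -T) (hy : y ∈ T ∪ -T) {p q : ℤ}
    (h : x - y = ![(p : ℝ), (q : ℝ)]) : |q| ≤ 1 := by
  have hc : IsCompact (T ∪ -T) := hTc.union hTc.neg
  obtain ⟨r, hr⟩ := hc.isBounded.exists_norm_le
  refine abs_le_one_of_step (N := ⌈r + r⌉) (p := p) ha hB
    (Z := fun p q => ∃ x ∈ T ∪ -T, ∃ y ∈ T ∪ -T, x - y = ![(p : ℝ), (q : ℝ)]) ?_ ?_ ?_
    ⟨x, hx, y, hy, h⟩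
  · rintro p q ⟨x, hx, y, hy, h⟩
    refine ⟨y, hy, x, hx, ?_⟩
    rw [← neg_sub, h]
    simp
  · rintro p q ⟨x, hx, y, hy, h⟩
    have h1 : x 1 - y 1 = q := by simpa using congr_fun h 1
    have := (le_abs_self _).trans ((norm_le_pi_norm x 1).trans (hr x hx))
    have := (neg_le_abs _).trans ((norm_le_pi_norm y 1).trans (hr y hy))
    have : (q : ℝ) ≤ (⌈r + r⌉ : ℤ) := (by linarith : (q : ℝ) ≤ r + r).trans (Int.le_ceil _)
    exact_mod_cast this
  · rintro p q ⟨x, hx, y, hy, h⟩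
    obtain ⟨k, hk0, hk1, hx'⟩ := hT.exists_step (by omega) (by omega) hx
    obtain ⟨l, hl0, hl1, hy'⟩ := hT.exists_step (by omega) (by omega) hy
    exact ⟨k - l, by rw [abs_le]; omega, _, hx', _, hy', expand_step_sub h k l⟩

end steps

section contraction

variable {a B : ℤ} {T : Set Pt}

/-- A quadratic form which is strictly increased by the expansion. -/
def expandForm (a B : ℤ) (x : Pt) : ℝ :=
  (B + 1) * (x 0 ^ 2 + x 1 ^ 2) + 2 * a * x 0 * x 1 +
    (B - 1) * ((B + 1) ^ 2 - a ^ 2) / 2 * x 1 ^ 2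

theorem continuous_expandForm (a B : ℤ) : Continuous (expandForm a B) := by
  unfold expandForm
  fun_prop

theorem expandForm_pos (ha : 3 ≤ a) (hB : a < B) {x : Pt} (hx : x ≠ 0) : 0 < expandForm a B x := by
  have ha' : (3 : ℝ) ≤ a := by exact_mod_cast ha
  have hB' : (a : ℝ) < B := by exact_mod_cast hB
  have h : 0 < x 0 ^ 2 + x 1 ^ 2 := by
    by_contra! h
    apply hx
    ext i; fin_cases i <;> simp <;> nlinarith [sq_nonneg (x 0), sq_nonneg (x 1)]
  have h1 : 0 ≤ ((B : ℝ) - 1) * ((B + 1) ^ 2 - a ^ 2) / 2 * x 1 ^ 2 :=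
    mul_nonneg (div_nonneg (mul_nonneg (by linarith) (by nlinarith)) (by norm_num))
      (sq_nonneg _)
  have h2 : 0 < ((B : ℝ) + 1 - a) * (x 0 ^ 2 + x 1 ^ 2) := mul_pos (by linarith) h
  unfold expandForm
  nlinarith [mul_nonneg (by linarith : (0 : ℝ) ≤ a) (sq_nonneg (x 0 + x 1))]

theorem exists_expandForm_expand (ha : 3 ≤ a) (hB : a < B) :
    ∃ K : ℝ, 1 < K ∧ ∀ x y, K * expandForm a B (x - y) ≤
      expandForm a B (expand (-a) B x - expand (-a) B y) := by
  have ha' : (3 : ℝ) ≤ a := by exact_mod_cast ha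
  have hB' : (a : ℝ) < B := by exact_mod_cast hB
  set θ : ℝ := (B - 1) * ((B + 1) ^ 2 - a ^ 2) / 2 with hθ
  have hθ0 : 0 < θ := by
    have : 0 < ((B : ℝ) - 1) * ((B + 1) ^ 2 - a ^ 2) := mul_pos (by linarith) (by nlinarith)
    positivity
  have hB0 : (0 : ℝ) < B := by linarith
  have ha0 : (0 : ℝ) < a := by linarith
  set C : ℝ := (2 * a ^ 2 + 2) * (B + 1 + a + θ) with hC
  have hC0 : 0 < C := by positivity
  refine ⟨1 + θ / C, by linarith [div_pos hθ0 hC0], fun x y => ?_⟩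
  obtain ⟨p, hp⟩ : ∃ p, p = x 0 - y 0 := ⟨_, rfl⟩
  obtain ⟨q, hq⟩ : ∃ q, q = x 1 - y 1 := ⟨_, rfl⟩
  have e1 : expandForm a B (x - y) = (B + 1) * (p ^ 2 + q ^ 2) + 2 * a * p * q + θ * q ^ 2 := by
    simp [expandForm, hp, hq, hθ]
  have e2 : expandForm a B (expand (-a) B x - expand (-a) B y) =
      (B + 1) * (p ^ 2 + q ^ 2) + 2 * a * p * q + θ * q ^ 2 + θ * (q ^ 2 + (p + a * q) ^ 2) := by
    simp [expandForm, expand_neg_left, hp, hq, hθ]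
    ring
  rw [e2, e1]
  have h1 : p ^ 2 + q ^ 2 ≤ (2 * a ^ 2 + 2) * (q ^ 2 + (p + a * q) ^ 2) := by
    have : (0 : ℝ) ≤ 2 * a ^ 2 * (p + a * q) ^ 2 := by positivity
    nlinarith [sq_nonneg (p + 2 * a * q), sq_nonneg q]
  have h2 : (B + 1) * (p ^ 2 + q ^ 2) + 2 * a * p * q + θ * q ^ 2 ≤
      (B + 1 + a + θ) * (p ^ 2 + q ^ 2) := by
    nlinarith [mul_nonneg ha0.le (sq_nonneg (p - q)), mul_nonneg hθ0.le (sq_nonneg p)]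
  have h3 : (B + 1) * (p ^ 2 + q ^ 2) + 2 * a * p * q + θ * q ^ 2 ≤
      C * (q ^ 2 + (p + a * q) ^ 2) := by
    refine h2.trans ?_
    rw [hC, mul_comm (2 * (a : ℝ) ^ 2 + 2), mul_assoc]
    exact mul_le_mul_of_nonneg_left h1 (by positivity)
  have h4 : θ / C * ((B + 1) * (p ^ 2 + q ^ 2) + 2 * a * p * q + θ * q ^ 2) ≤
      θ * (q ^ 2 + (p + a * q) ^ 2) := by
    calc _ ≤ θ / C * (C * (q ^ 2 + (p + a * q) ^ 2)) :=
          mul_le_mul_of_nonneg_left h3 (by positivity)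
      _ = _ := by field_simp
  linarith

theorem CrysEq.fixed_mem (ha : 3 ≤ a) (hB : a < B) (hT : CrysEq (-a) B T) (hTne : T.Nonempty)
    (hTc : IsCompact T) {y : Pt} {k : ℤ} (h0 : 0 ≤ k) (h1 : k ≤ B - 2)
    (hy : expand (-a) B y - ![(k : ℝ), 0] = y) : y ∈ T := by
  obtain ⟨K, hK, hE⟩ := exists_expandForm_expand ha hB
  obtain ⟨t, ht, hmin⟩ := hTc.exists_isMinOn (f := fun t => expandForm a B (t - y)) hTne
    ((continuous_expandForm a B).comp (by fun_prop)).continuousOn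
  obtain ⟨z, hz⟩ := expand_surjective (a := a) (B := B) (by omega) (t + ![(k : ℝ), 0])
  have hzT : z ∈ T := hT.mem_of_step (by omega) h0 h1 (by rwa [hz, add_sub_cancel_right])
  have h2 := hE z y
  have e : expand (-a) B z - expand (-a) B y = t - y := by
    rw [hz, sub_eq_iff_eq_add.1 hy]; abel
  rw [e] at h2
  have h3 : expandForm a B (t - y) ≤ expandForm a B (z - y) := hmin hzT
  by_contra hyT
  have : z - y ≠ 0 := sub_ne_zero.2 (by rintro rfl; exact hyT hzT)
  nlinarith [expandForm_pos ha hB this]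

/-- The unit vector in the first direction, in the form in which digits appear. -/
abbrev unitDigit : Pt := ![((1 : ℤ) : ℝ), 0]

theorem CrysEq.exists_fixed_pair (ha : 3 ≤ a) (hB : 2 * a - 2 ≤ B) (hT : CrysEq (-a) B T)
    (hTne : T.Nonempty) (hTc : IsCompact T) :
    ∃ y ∈ T, y + ![((a - 1 : ℤ) : ℝ), -1] ∈ T ∩ -T := by
  have hB' : (a : ℝ) < B := by exact_mod_cast (by omega : a < B)
  have hne : (B : ℝ) + 1 - a ≠ 0 := by linarith
  obtain ⟨u, hu⟩ : ∃ u : ℝ, ((B : ℝ) - 1) / 2 = u * (B + 1 - a) :=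
    ⟨(((B : ℝ) - 1) / 2) / (B + 1 - a), by field_simp⟩
  let y : Pt := ![(1 - a) * u, u]
  refine ⟨y, hT.fixed_mem ha (by omega) hTne hTc (k := 0) le_rfl (by omega) ?_, ?_, ?_⟩
  · rw [sub_intCast_zero, expand_neg_left, hu]
    ext i; fin_cases i <;> simp [y] <;> ring
  · refine hT.fixed_mem ha (by omega) hTne hTc (k := B - a + 1) (by omega) (by omega) ?_
    rw [expand_neg_left, hu]
    ext i; fin_cases i <;> simp [y] <;> ring
  · refine hT.fixed_mem ha (by omega) hTne hTc (k := a - 2) (by omega) (by omega) ?_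
    rw [expand_neg_apply, expand_neg_left, hu]
    ext i; fin_cases i <;> simp [y] <;> ring

theorem CrysEq.mem_union_neg_of_step (hB2 : 2 ≤ B) (hT : CrysEq (-a) B T) {x : Pt} {k : ℤ}
    (h0 : 0 ≤ k) (h1 : k ≤ B - 1) (hx : expand (-a) B x - ![(k : ℝ), 0] ∈ T) : x ∈ T ∪ -T := by
  rcases h1.eq_or_lt with rfl | h1
  · exact Or.inr ((hT.mem_neg_iff (by omega) x).2 (Or.inl hx))
  · exact Or.inl (hT.mem_of_step hB2 h0 (by omega) hx)

theorem expand_sub_unitDigit (x : Pt) :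
    expand (-a) B (x - unitDigit) = expand (-a) B x - ![0, 1] := by
  simp only [expand_neg_left]
  ext i; fin_cases i <;> simp
  ring

theorem CrysEq.exists_first (ha : 3 ≤ a) (hB : 2 * a - 2 ≤ B) (hT : CrysEq (-a) B T)
    (hTne : T.Nonempty) (hTc : IsCompact T) :
    ∃ x ∈ T, x - unitDigit ∈ T ∧ expand (-a) B (x - unitDigit) ∈ T := by
  obtain ⟨y, hy, hy', -⟩ := hT.exists_fixed_pair ha hB hTne hTc
  obtain ⟨x, hx⟩ := expand_surjective (a := a) (B := B) (by omega) (y + ![((a - 1 : ℤ) : ℝ), 0])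
  have h : expand (-a) B (x - unitDigit) ∈ T := by
    rw [expand_sub_unitDigit, hx]
    convert hy' using 1
    ext i; fin_cases i <;> simp [Matrix.vecHead, Matrix.vecTail]
    ring
  exact ⟨x, hT.mem_of_step (by omega) (k := a - 1) (by omega) (by omega)
    (by rwa [hx, add_sub_cancel_right]), hT.mem_of_expand_mem (by omega) (Or.inl h), h⟩

theorem CrysEq.exists_second (ha : 3 ≤ a) (hB : 2 * a - 2 ≤ B) (hT : CrysEq (-a) B T)
    (hTne : T.Nonempty) (hTc : IsCompact T) :
    ∃ x ∈ T ∪ -T, x - unitDigit ∈ T ∩ -T ∧ expand (-a) B (x - unitDigit) - unitDigit ∈ T ∧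
      expand (-a) B (x - unitDigit) - unitDigit + ![-((a : ℝ) - 1), 1] ∈ T := by
  obtain ⟨y, hy, hy', hy''⟩ := hT.exists_fixed_pair ha hB hTne hTc
  obtain ⟨x, hx⟩ := expand_surjective (a := a) (B := B) (by omega) (y + ![(a : ℝ), 0])
  have h : expand (-a) B (x - unitDigit) - unitDigit = y + ![((a - 1 : ℤ) : ℝ), -1] := by
    rw [expand_sub_unitDigit, hx]
    ext i; fin_cases i <;> simp [Matrix.vecHead, Matrix.vecTail] <;> ring
  refine ⟨x, hT.mem_union_neg_of_step (by omega) (k := a) (by omega) (by omega)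
    (by rwa [hx, add_sub_cancel_right]), ⟨hT.mem_of_step (by omega) (k := 1) (by omega) (by omega)
    (by rw [h]; exact hy'), hT.mem_neg_of_step (by omega) (k := 1) (by omega) (by omega)
    (by rw [h]; exact hy'')⟩, by rw [h]; exact hy', ?_⟩
  rw [h]
  convert hy using 1
  ext i; fin_cases i <;> simp [Matrix.vecHead, Matrix.vecTail]
  ring

theorem CrysEq.inter_neg_nonempty (ha : 3 ≤ a) (hB : 2 * a - 2 ≤ B) (hT : CrysEq (-a) B T)
    (hTne : T.Nonempty) (hTc : IsCompact T) : (T ∩ -T).Nonempty := by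
  obtain ⟨x, hx, ⟨-, hx'⟩, -⟩ := hT.exists_second ha hB hTne hTc
  obtain ⟨z, hz⟩ := expand_surjective (a := a) (B := B) (by omega) x
  refine ⟨z, hT.mem_of_expand_mem (by omega) (hz ▸ hx), ?_⟩
  refine hT.mem_of_step (by omega) (k := B - 2) (by omega) (by omega) ?_
  rw [expand_neg_apply, hz]
  rw [Set.mem_neg] at hx'
  convert hx' using 1
  ext i; fin_cases i <;> simp [Matrix.vecHead, Matrix.vecTail]
  ring

theorem CrysEq.chain_constant (ha : 3 ≤ a) (hB : 2 * a - 2 ≤ B) (hT : CrysEq (-a) B T)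
    (hTne : T.Nonempty) (hTc : IsCompact T) {K r : ℝ} (hK : 1 < K)
    (hE : ∀ x y, K * expandForm a B (x - y) ≤
      expandForm a B (expand (-a) B x - expand (-a) B y))
    (ih : ∀ φ : Pt → Prop, (∀ x ∈ T, ∀ y ∈ T, expandForm a B (x - y) < r → (φ x ↔ φ y)) →
      ∀ x ∈ T, ∀ y ∈ T, φ x ↔ φ y)
    {φ : Pt → Prop} (hφ : ∀ x ∈ T, ∀ y ∈ T, expandForm a B (x - y) < r / K → (φ x ↔ φ y)) :
    ∀ x ∈ T, ∀ y ∈ T, φ x ↔ φ y := by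
  have hK0 : 0 < K := by linarith
  choose F hF using expand_surjective (a := a) (B := B) (by omega)
  have hFE : ∀ x, F (expand (-a) B x) = x := fun x =>
    expand_injective (a := a) (B := B) (by omega) (hF _)
  have hlt : ∀ x y, expandForm a B (x - y) < r → expandForm a B (F x - F y) < r / K := by
    intro x y h
    have := hE (F x) (F y)
    rw [hF, hF] at this
    rw [lt_div_iff₀ hK0]
    linarith
  have hneg : ∀ x : Pt, expandForm a B (-x) = expandForm a B x := fun x => by simp [expandForm]
  have hk : ∀ k : ℤ, 0 ≤ k → k ≤ B - 2 → ∀ x ∈ T, ∀ y ∈ T,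
      (φ (F (x + ![(k : ℝ), 0])) ↔ φ (F (y + ![(k : ℝ), 0]))) := by
    intro k h0 h1
    have hm : ∀ x ∈ T, F (x + ![(k : ℝ), 0]) ∈ T := fun x hx =>
      hT.mem_of_step (by omega) h0 h1 (by rwa [hF, add_sub_cancel_right])
    exact ih _ fun x hx y hy h => hφ _ (hm x hx) _ (hm y hy)
      (hlt _ _ (by rwa [add_sub_add_right_eq_sub]))
  have hn : ∀ x ∈ T, ∀ y ∈ T, (φ (F (-x)) ↔ φ (F (-y))) := by
    have hm : ∀ x ∈ T, F (-x) ∈ T := fun x hx =>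
      hT.mem_of_expand_mem (by omega) (by rw [hF]; exact Or.inr (by simpa using hx))
    refine ih (fun x => φ (F (-x))) fun x hx y hy h => hφ _ (hm x hx) _ (hm y hy) (hlt _ _ ?_)
    rwa [← neg_sub', hneg]
  obtain ⟨s, hs, hs', -⟩ := hT.exists_first ha hB hTne hTc
  obtain ⟨z, hz, hz'⟩ := hT.inter_neg_nonempty ha hB hTne hTc
  have hchain : ∀ n : ℕ, (n : ℤ) ≤ B - 2 → ∀ x ∈ T,
      (φ (F (x + ![((n : ℤ) : ℝ), 0])) ↔ φ (F (z + ![((0 : ℤ) : ℝ), 0]))) := by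
    intro n
    induction n with
    | zero => exact fun _ x hx => hk 0 le_rfl (by omega) x hx z hz
    | succ n ihn =>
      intro hn x hx
      rw [hk _ (by omega) hn x hx _ hs', ← ihn (by push_cast at hn; omega) s hs]
      have : s - unitDigit + ![(((n + 1 : ℕ) : ℤ) : ℝ), 0] = s + ![((n : ℤ) : ℝ), 0] := by
        ext i; fin_cases i <;> simp [Matrix.vecHead, Matrix.vecTail]
      rw [this]
  have hall : ∀ x ∈ T, (φ x ↔ φ (F (z + ![((0 : ℤ) : ℝ), 0]))) := by
    intro x hx
    rcases (hT.mem_iff (by omega) x).1 hx with h | ⟨k, h0, h1, h⟩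
    · have := hn _ h _ hz'
      rw [neg_neg, neg_neg, hFE] at this
      rw [this, ← sub_eq_iff_eq_add.1 (sub_intCast_zero z)]
    · obtain ⟨n, rfl⟩ := Int.eq_ofNat_of_zero_le h0
      have := hchain n h1 _ h
      rwa [sub_add_cancel, hFE] at this
  exact fun x hx y hy => (hall x hx).trans (hall y hy).symm

theorem CrysEq.isPreconnected (ha : 3 ≤ a) (hB : 2 * a - 2 ≤ B) (hT : CrysEq (-a) B T)
    (hTne : T.Nonempty) (hTc : IsCompact T) : IsPreconnected T := by
  obtain ⟨K, hK, hE⟩ := exists_expandForm_expand ha (by omega : a < B)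
  have hcont : Continuous fun z : Pt × Pt => expandForm a B (z.1 - z.2) :=
    (continuous_expandForm a B).comp (by fun_prop)
  obtain ⟨D, hD⟩ := (hTc.prod hTc).bddAbove_image hcont.continuousOn
  have hDlt : ∀ x ∈ T, ∀ y ∈ T, expandForm a B (x - y) < D + 1 := fun x hx y hy =>
    (hD ⟨(x, y), ⟨hx, hy⟩, rfl⟩).trans_lt (lt_add_one D)
  have hP : ∀ n : ℕ, ∀ φ : Pt → Prop,
      (∀ x ∈ T, ∀ y ∈ T, expandForm a B (x - y) < (D + 1) / K ^ n → (φ x ↔ φ y)) →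
      ∀ x ∈ T, ∀ y ∈ T, φ x ↔ φ y := by
    intro n
    induction n with
    | zero => exact fun φ h x hx y hy => h x hx y hy (by simpa using hDlt x hx y hy)
    | succ n ih =>
      intro φ h
      exact hT.chain_constant ha hB hTne hTc hK hE ih (fun x hx y hy hxy => h x hx y hy
        (by rwa [pow_succ, ← div_div]))
  rw [isPreconnected_closed_iff]
  intro u v hu hv huv ⟨x, hxT, hxu⟩ ⟨y, hyT, hyv⟩
  by_contra hemp
  have hdis : ∀ z ∈ T, z ∈ u → z ∈ v → False := fun z hz hzu hzv => hemp ⟨z, hz, hzu, hzv⟩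
  obtain ⟨⟨s, t⟩, ⟨⟨hs, hsu⟩, ht, htv⟩, hmin⟩ :=
    ((hTc.inter_right hu).prod (hTc.inter_right hv)).exists_isMinOn
      ⟨(x, y), ⟨hxT, hxu⟩, hyT, hyv⟩ hcont.continuousOn
  have hpos : 0 < expandForm a B (s - t) :=
    expandForm_pos ha (by omega) (sub_ne_zero.2 (by rintro rfl; exact hdis s hs hsu htv))
  obtain ⟨n, hn⟩ := pow_unbounded_of_one_lt ((D + 1) / expandForm a B (s - t)) hK
  rw [div_lt_comm₀ hpos (by positivity)] at hn
  have key : ∀ p ∈ T, ∀ q ∈ T, expandForm a B (p - q) < (D + 1) / K ^ n → p ∈ u → q ∈ u := by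
    intro p hp q hq hpq hpu
    by_contra hqu
    have : expandForm a B (s - t) ≤ expandForm a B (p - q) :=
      hmin (show (p, q) ∈ (T ∩ u) ×ˢ (T ∩ v) from ⟨⟨hp, hpu⟩, hq, (huv hq).resolve_left hqu⟩)
    linarith
  have hneg : ∀ x : Pt, expandForm a B (-x) = expandForm a B x := fun x => by simp [expandForm]
  have := (hP n (· ∈ u) fun p hp q hq hpq => ⟨key p hp q hq hpq, key q hq p hp
    (by rwa [← neg_sub, hneg])⟩) x hxT y hyT
  exact hdis y hyT (this.1 hxu) hyv

end contraction

section separation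

variable {a B : ℤ} {T : Set Pt}

theorem CrysEq.step_abs (ha : 3 ≤ a) (hB : 2 * a - 2 ≤ B) (hT : CrysEq (-a) B T)
    (hTc : IsCompact T) {x y : Pt} {p q k l : ℤ} (h : x - y = ![(p : ℝ), (q : ℝ)])
    (hx : expand (-a) B x - ![(k : ℝ), 0] ∈ T ∪ -T)
    (hy : expand (-a) B y - ![(l : ℝ), 0] ∈ T ∪ -T) :
    |p + a * q| ≤ 1 ∧ |-B * q - (k - l) + a * (p + a * q)| ≤ 1 := by
  have h' := expand_step_sub (a := a) (B := B) h k l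
  refine ⟨hT.abs_le_one ha hB hTc hx hy h', ?_⟩
  obtain ⟨k', -, -, hx'⟩ := hT.exists_step (by omega) (by omega) hx
  obtain ⟨l', -, -, hy'⟩ := hT.exists_step (by omega) (by omega) hy
  exact hT.abs_le_one ha hB hTc hx' hy' (expand_step_sub h' k' l')

theorem CrysEq.height_nonneg (ha : 3 ≤ a) (hB : 2 * a - 2 ≤ B) (hT : CrysEq (-a) B T)
    (hTc : IsCompact T) {x y : Pt} (hx : x ∈ T ∪ -T) (hy : y ∈ T ∪ -T) {p : ℤ}
    (h : x - y = ![(p : ℝ), ((1 : ℤ) : ℝ)]) : 0 ≤ p + a ∧ p + a ≤ 1 := by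
  obtain ⟨k, hk0, hk1, hx'⟩ := hT.exists_step (by omega) (by omega) hx
  obtain ⟨l, hl0, hl1, hy'⟩ := hT.exists_step (by omega) (by omega) hy
  obtain ⟨h1, h2⟩ := hT.step_abs ha hB hTc h hx' hy'
  rw [mul_one, abs_le] at h1
  refine ⟨?_, h1.2⟩
  by_contra! hlt
  rw [mul_one, mul_one, show p + a = -1 by omega, abs_le] at h2
  omega

theorem CrysEq.digits_of_sub_eq (ha : 3 ≤ a) (hB : 2 * a - 2 ≤ B) (hT : CrysEq (-a) B T)
    (hTc : IsCompact T) {x y : Pt} {k l : ℤ}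
    (h : x - y = ![((-a : ℤ) : ℝ), ((1 : ℤ) : ℝ)])
    (hk : 0 ≤ k) (hl : l ≤ B - 1)
    (hx : expand (-a) B x - ![(k : ℝ), 0] ∈ T ∪ -T)
    (hy : expand (-a) B y - ![(l : ℝ), 0] ∈ T ∪ -T) : k = 0 ∧ l = B - 1 := by
  have h' := expand_step_sub (a := a) (B := B) h k l
  obtain ⟨k', -, -, hx'⟩ := hT.exists_step (by omega) (by omega) hx
  obtain ⟨l', -, -, hy'⟩ := hT.exists_step (by omega) (by omega) hy
  obtain ⟨h1, -⟩ := hT.step_abs ha hB hTc h' hx' hy'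
  rw [show -B * 1 - (k - l) + a * (-a + a * 1) = -B - (k - l) by ring, abs_le] at h1
  omega

theorem CrysEq.exists_step_le (hB2 : 2 ≤ B) (hT : CrysEq (-a) B T) {x : Pt} (hx : x ∈ T) :
    ∃ k : ℤ, 0 ≤ k ∧ k ≤ B - 2 ∧ expand (-a) B x - ![(k : ℝ), 0] ∈ T ∪ -T ∧
      (1 ≤ k → expand (-a) B x - ![(k : ℝ), 0] ∈ T) := by
  rcases hT.exists_step_of_mem (by omega) hx with h | ⟨k, h0, h1, h⟩
  · exact ⟨0, le_rfl, by omega, by rwa [sub_intCast_zero], by omega⟩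
  · exact ⟨k, by omega, h1, Or.inl h, fun _ => h⟩

theorem CrysEq.sub_ne (ha : 3 ≤ a) (hB : 2 * a - 2 ≤ B) (hT : CrysEq (-a) B T)
    (hTc : IsCompact T) {x y : Pt} (hx : x ∈ T ∪ -T) (hy : y ∈ T) :
    x - y ≠ ![((-a : ℤ) : ℝ), ((1 : ℤ) : ℝ)] := by
  intro h
  obtain ⟨k, hk0, -, hx'⟩ := hT.exists_step (by omega) (by omega) hx
  obtain ⟨l, -, hl1, hy', -⟩ := hT.exists_step_le (by omega) hy
  have := hT.digits_of_sub_eq ha hB hTc h hk0 (by omega) hx' hy'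
  omega

/-- Points `x` of `T ∪ -T` with `x - (1, 0) ∈ T` such that `x - (1, 0)` has first digit `0`. -/
def leftOverlap (a B : ℤ) (T : Set Pt) : Set Pt :=
  {x | x ∈ T ∪ -T ∧ x - unitDigit ∈ T ∧ expand (-a) B (x - unitDigit) ∈ T ∪ -T}

/-- Points `x` of `T ∪ -T` with `x - (1, 0) ∈ T` such that `x - (1, 0)` has a positive first
digit `l` and the resulting point is a translate of a point of `T ∪ -T`. -/
def rightOverlap (a B : ℤ) (T : Set Pt) : Set Pt :=
  {x | x ∈ T ∪ -T ∧ x - unitDigit ∈ T ∧ ∃ l ∈ Finset.Icc 1 (B - 2),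
    expand (-a) B (x - unitDigit) - ![(l : ℝ), 0] ∈ T ∧
      expand (-a) B (x - unitDigit) - ![(l : ℝ), 0] + ![((1 - a : ℤ) : ℝ), ((1 : ℤ) : ℝ)]
        ∈ T ∪ -T}

theorem CrysEq.mem_overlap (ha : 3 ≤ a) (hB : 2 * a - 2 ≤ B) (hT : CrysEq (-a) B T)
    (hTc : IsCompact T) {x : Pt} (hx : x ∈ T ∪ -T) (ht : x - unitDigit ∈ T) :
    x ∈ leftOverlap a B T ∪ rightOverlap a B T := by
  rcases hT.exists_step_of_mem (by omega) ht with h | ⟨l, hl0, hl1, h⟩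
  · exact Or.inl ⟨hx, ht, h⟩
  · refine Or.inr ⟨hx, ht, l, Finset.mem_Icc.2 ⟨hl0, hl1⟩, h, ?_⟩
    obtain ⟨k, hk0, hk1, hx'⟩ := hT.exists_step (by omega) (by omega) hx
    have hd : x - (x - unitDigit) = ![((1 : ℤ) : ℝ), ((0 : ℤ) : ℝ)] := by
      rw [sub_sub_cancel, Int.cast_zero]
    have hd' := expand_step_sub (a := a) (B := B) hd k l
    rw [show -B * 0 - (k - l) = -(k - l) by ring, show 1 + a * 0 = (1 : ℤ) by ring] at hd'
    have h1 := hT.height_nonneg ha hB hTc hx' (Or.inl h) hd'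
    have h2 : k - l ≠ a := fun e => hT.sub_ne ha hB hTc hx' h (by rw [hd', e])
    have h3 : -(k - l) = 1 - a := by omega
    rw [h3] at hd'
    rwa [← hd', add_sub_cancel]

theorem CrysEq.disjoint_overlap (ha : 3 ≤ a) (hB : 2 * a - 2 ≤ B) (hT : CrysEq (-a) B T)
    (hTc : IsCompact T) : Disjoint (leftOverlap a B T) (rightOverlap a B T) := by
  rw [Set.disjoint_left]
  rintro x ⟨-, -, ht⟩ ⟨-, -, l, hl, ht₁, hx₁⟩
  rw [Finset.mem_Icc] at hl
  set t := x - unitDigit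
  set s := expand (-a) B t with hs
  set t₁ := s - ![(l : ℝ), 0] with ht₁_def
  have hst : s - t₁ = ![(l : ℝ), ((0 : ℤ) : ℝ)] := by rw [ht₁_def, sub_sub_cancel, Int.cast_zero]
  obtain ⟨m, hm0, hm1, hs'⟩ := hT.exists_step (by omega) (by omega) ht
  obtain ⟨n, hn0, hn1, ht₂, ht₂'⟩ := hT.exists_step_le (by omega) ht₁
  obtain ⟨k, hk0, hk1, hx₂⟩ := hT.exists_step (by omega) (by omega) hx₁
  obtain ⟨h1, -⟩ := hT.step_abs ha hB hTc hst hs' ht₂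
  rw [mul_zero, add_zero, abs_le] at h1
  obtain rfl : l = 1 := by omega
  have hxs : t₁ + ![((1 - a : ℤ) : ℝ), ((1 : ℤ) : ℝ)] - s = ![((-a : ℤ) : ℝ), ((1 : ℤ) : ℝ)] := by
    rw [ht₁_def]
    ext i; fin_cases i <;> simp [Matrix.vecHead, Matrix.vecTail]
  have hxt : t₁ + ![((1 - a : ℤ) : ℝ), ((1 : ℤ) : ℝ)] - t₁ =
      ![((1 - a : ℤ) : ℝ), ((1 : ℤ) : ℝ)] := add_sub_cancel_left _ _
  obtain ⟨rfl, rfl⟩ := hT.digits_of_sub_eq ha hB hTc hxs hk0 hm1 hx₂ hs'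
  have hd₁ := expand_step_sub (a := a) (B := B) hst (B - 1) n
  rw [show 1 + a * 0 = (1 : ℤ) by ring, show -B * 0 - (B - 1 - n) = -(B - 1 - n) by ring] at hd₁
  have b₁ := hT.height_nonneg ha hB hTc hs' ht₂ hd₁
  have hd₂ := expand_step_sub (a := a) (B := B) hxt 0 n
  rw [show 1 - a + a * 1 = (1 : ℤ) by ring, show -B * 1 - (0 - n) = -B + n by ring] at hd₂
  have b₂ := hT.height_nonneg ha hB hTc hx₂ ht₂ hd₂
  refine hT.sub_ne ha hB hTc hx₂ (ht₂' (by omega)) ?_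
  rw [hd₂, show -B + n = -a by omega]

/-- The inverse of the expansion. -/
def contract (a B : ℤ) (y : Pt) : Pt :=
  ![y 1 - a * ((((B : ℝ) - 1) / 2 - y 0) / B), (((B : ℝ) - 1) / 2 - y 0) / B]

theorem continuous_contract (a B : ℤ) : Continuous (contract a B) := by
  unfold contract
  fun_prop

theorem expand_contract (hB : B ≠ 0) (y : Pt) : expand (-a) B (contract a B y) = y := by
  have hB' : (B : ℝ) ≠ 0 := by exact_mod_cast hB
  rw [expand_neg_left, contract]
  ext i; fin_cases i
  · simp; field_simp; ring
  · simp

theorem isPreconnected_preimage_expand (hB : B ≠ 0) {S : Set Pt} (hS : IsPreconnected S) :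
    IsPreconnected (expand (-a) B ⁻¹' S) := by
  convert hS.image (contract a B) (continuous_contract a B).continuousOn
  rw [image_eq_preimage_of_inverse (g := expand (-a) B) (expand_contract hB)
    (fun x => expand_injective hB (expand_contract hB _))]

theorem CrysEq.not_diskLike (ha : 3 ≤ a) (hB : 2 * a - 2 ≤ B) (hTne : T.Nonempty)
    (hTc : IsCompact T) (hT : CrysEq (-a) B T) : ¬ DiskLike T := by
  have hB0 : B ≠ 0 := by omega
  have hcont : Continuous (expand (-a) B) := expand_continuous _ _
  have hclosed : IsClosed T := hTc.isClosed
  have hclosed' : IsClosed (T ∪ -T) := hclosed.union hTc.neg.isClosed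
  have hTpre := hT.isPreconnected ha hB hTne hTc
  have hshift : ∀ k : ℤ, {z | expand (-a) B z - ![(k : ℝ), 0] ∈ T} =
      expand (-a) B ⁻¹' ((fun x => x + ![(k : ℝ), 0]) '' T) := by
    intro k
    ext z
    rw [Set.mem_preimage, Set.image_add_right, Set.mem_preimage, ← sub_eq_add_neg]
    rfl
  refine not_diskLike_of_inter_eq_union (T := T) (P := expand (-a) B ⁻¹' (T ∪ -T))
    (Q := ⋃ k ∈ Icc (1 : ℤ) (B - 2), {z | expand (-a) B z - ![(k : ℝ), 0] ∈ T})
    (S₁ := expand (-a) B ⁻¹' leftOverlap a B T) (S₂ := expand (-a) B ⁻¹' rightOverlap a B T)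
    (hclosed'.preimage hcont) ?_ (isPreconnected_preimage_expand hB0 ?_) ?_ ?_ ?_ ?_
    ((hT.disjoint_overlap ha hB hTc).preimage _) ?_ ?_ ?_
  · exact (finite_Icc _ _).isClosed_biUnion fun k _ => hclosed.preimage (by fun_prop)
  · obtain ⟨z, hz, hz'⟩ := hT.inter_neg_nonempty ha hB hTne hTc
    refine IsPreconnected.union z hz hz' hTpre ?_
    rw [← Set.image_neg_eq_neg]
    exact hTpre.image _ continuous_neg.continuousOn
  · refine IsPreconnected.biUnion_of_chain ordConnected_Icc (fun k _ => ?_) fun k _ _ => ?_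
    · rw [hshift]
      exact isPreconnected_preimage_expand hB0 (hTpre.image _ (by fun_prop))
    · obtain ⟨s, hs, hs', -⟩ := hT.exists_first ha hB hTne hTc
      refine ⟨contract a B (s + ![(k : ℝ), 0]), ?_, ?_⟩
      · rwa [Set.mem_ofPred_eq, expand_contract hB0, add_sub_cancel_right]
      · rw [Set.mem_ofPred_eq, expand_contract hB0]
        convert hs' using 1
        ext i; fin_cases i <;> simp [Matrix.vecHead, Matrix.vecTail]
        ring
  · ext z
    simp only [mem_union, mem_iUnion, mem_preimage, exists_prop, mem_Icc, Set.mem_ofPred_eq]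
    refine ⟨?_, fun hz => ?_⟩
    · rintro (h | ⟨k, ⟨h0, h1⟩, h⟩)
      · exact hT.mem_of_expand_mem (by omega) h
      · exact hT.mem_of_step (by omega) (by omega) h1 h
    · rcases hT.exists_step_of_mem hB0 hz with h | ⟨k, h0, h1, h⟩
      · exact Or.inl h
      · exact Or.inr ⟨k, ⟨h0, h1⟩, h⟩
  · refine IsClosed.preimage hcont ?_
    exact hclosed'.inter ((hclosed.preimage (by fun_prop)).inter (hclosed'.preimage (by fun_prop)))
  · refine IsClosed.preimage hcont ?_
    have : IsClosed (⋃ l ∈ Finset.Icc 1 (B - 2), {x |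
        expand (-a) B (x - unitDigit) - ![(l : ℝ), 0] ∈ T ∧
        expand (-a) B (x - unitDigit) - ![(l : ℝ), 0] + ![((1 - a : ℤ) : ℝ), ((1 : ℤ) : ℝ)]
          ∈ T ∪ -T}) :=
      isClosed_biUnion_finset fun l _ => (hclosed.preimage (by fun_prop)).inter
        (hclosed'.preimage (by fun_prop))
    convert hclosed'.inter ((hclosed.preimage (f := fun x => x - unitDigit) (by fun_prop)).inter
      this) using 1
    ext x
    simp only [rightOverlap, Set.mem_ofPred_eq, mem_inter_iff, mem_preimage, mem_iUnion,
      exists_prop]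
  · obtain ⟨x, hx, hx', hx''⟩ := hT.exists_first ha hB hTne hTc
    exact ⟨contract a B x, by
      rw [mem_preimage, expand_contract hB0]; exact ⟨Or.inl hx, hx', Or.inl hx''⟩⟩
  · obtain ⟨x, hx, ⟨hx', -⟩, h, h'⟩ := hT.exists_second ha hB hTne hTc
    refine ⟨contract a B x, ?_⟩
    rw [mem_preimage, expand_contract hB0]
    refine ⟨hx, hx', 1, Finset.mem_Icc.2 ⟨le_rfl, by omega⟩, h, Or.inl ?_⟩
    convert h' using 4
    · push_cast; ring
    · push_cast; ring
  · ext z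
    simp only [mem_inter_iff, mem_iUnion, exists_prop, mem_Icc, Set.mem_ofPred_eq]
    constructor
    · rintro ⟨hz, k, ⟨h0, h1⟩, h⟩
      have hd : expand (-a) B z - (expand (-a) B z - ![(k : ℝ), 0]) =
          ![(k : ℝ), ((0 : ℤ) : ℝ)] := by rw [sub_sub_cancel, Int.cast_zero]
      obtain ⟨m, -, -, hm⟩ := hT.exists_step hB0 (by omega) hz
      obtain ⟨n, -, -, hn⟩ := hT.exists_step hB0 (by omega) (Or.inl h)
      obtain ⟨hk, -⟩ := hT.step_abs ha hB hTc hd hm hn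
      rw [mul_zero, add_zero, abs_le] at hk
      obtain rfl : k = 1 := by omega
      exact hT.mem_overlap ha hB hTc hz h
    · rintro (h | h)
      · exact ⟨h.1, 1, ⟨le_rfl, by omega⟩, h.2.1⟩
      · exact ⟨h.1, 1, ⟨le_rfl, by omega⟩, h.2.1⟩

end separation

theorem stmt_17 (A B : ℤ) (hA : 2 ≤ -A) (hAB : -A ≤ B) (h2A : 2 * |A| < B + 3)
    (T : Set Pt) (hTne : T.Nonempty) (hTc : IsCompact T) (hT : CrysEq A B T) :
    (A = -2 → DiskLike T) ∧ (A ≤ -3 → ¬ DiskLike T) := by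
  refine ⟨?_, fun hA3 => ?_⟩
  · rintro rfl
    exact diskLike_of_two_le (by omega) hTne hTc hT
  · obtain ⟨a, rfl⟩ : ∃ a, A = -a := ⟨-A, (neg_neg A).symm⟩
    rw [abs_neg, abs_of_nonneg (by omega)] at h2A
    exact hT.not_diskLike (by omega) (by omega) hTne hTc
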